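/- arXiv:2205.04218 — 2 statements merged into one kernel-verified Lean document; each statement's English description precedes it below -/
import Mathlib

section
/- Let g be a finite-dimensional complex Lie algebra which is strongly disemisimple, i.e., g = s1 ∔ s2 is the direct vector space sum (s1 ∩ s2 = 0) of two semisimple Lie subalgebras s1 and s2 of g, and suppose g is not semisimple (i.e., rad(g) ≠ 0). Then neither s1 nor s2 is a Levi subalgebra of g; that is, for i = 1, 2 it is not the case that s_i + rad(g) = g and s_i ∩ rad(g) = 0. -/
open LieAlgebra LieModule Module

lemma semisimple_perfect {s : Type*} [LieRing s] [LieAlgebra ℂ s] [Module.Finite ℂ s]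
    [HasTrivialRadical ℂ s] : ⁅(⊤ : LieIdeal ℂ s), (⊤ : LieIdeal ℂ s)⁆ = ⊤ := by
  set D : LieIdeal ℂ s := ⁅(⊤ : LieIdeal ℂ s), (⊤ : LieIdeal ℂ s)⁆ with hD
  have hc := LieIdeal.isCompl_killingCompl (K := ℂ) D
  have hab : IsLieAbelian (D.killingCompl : LieIdeal ℂ s) := by
    rw [LieSubmodule.lie_abelian_iff_lie_self_eq_bot, eq_bot_iff]
    have h1 : ⁅D.killingCompl, D.killingCompl⁆ ≤ D := LieSubmodule.mono_lie le_top le_top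
    have h2 : ⁅D.killingCompl, D.killingCompl⁆ ≤ D.killingCompl := LieSubmodule.lie_le_right _ _
    exact hc.disjoint h1 h2
  have h0 : D.killingCompl = ⊥ := IsKilling.ideal_eq_bot_of_isLieAbelian _
  have := hc.codisjoint
  rw [h0, codisjoint_bot] at this
  exact this

lemma perfect_hom {s : Type*} [LieRing s] [LieAlgebra ℂ s]
    (hp : ⁅(⊤ : LieIdeal ℂ s), (⊤ : LieIdeal ℂ s)⁆ = ⊤)
    {W : Type*} [AddCommGroup W] [Module ℂ W] (g : s →ₗ[ℂ] W)
    (hg : ∀ x y : s, g ⁅x, y⁆ = 0) (x : s) : g x = 0 := by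
  have h : (⁅(⊤ : LieIdeal ℂ s), (⊤ : LieIdeal ℂ s)⁆ : LieIdeal ℂ s).toSubmodule
      ≤ LinearMap.ker g := by
    rw [LieSubmodule.lieIdeal_oper_eq_linear_span', Submodule.span_le]
    rintro _ ⟨a, -, b, -, rfl⟩
    exact hg a b
  rw [hp] at h
  exact h trivial

/-- No étale modules. -/
lemma no_etale {s : Type*} [LieRing s] [LieAlgebra ℂ s]
    (hp : ⁅(⊤ : LieIdeal ℂ s), (⊤ : LieIdeal ℂ s)⁆ = ⊤)
    {M : Type*} [AddCommGroup M] [Module ℂ M] [LieRingModule s M] [LieModule ℂ s M]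
    [Module.Finite ℂ M] (v : M) (e : s ≃ₗ[ℂ] M) (he : ∀ x, e x = ⁅x, v⁆) : Subsingleton M := by
  let R : M →ₗ[ℂ] (M →ₗ[ℂ] M) :=
    ((toEnd ℂ s M : s →ₗ[ℂ] Module.End ℂ M) ∘ₗ (e.symm : M →ₗ[ℂ] s)).flip
  have hR : ∀ m n, R m n = ⁅e.symm n, m⁆ := fun m n => rfl
  have key : ∀ (x : s) (m : M), LinearMap.trace ℂ M (R ⁅x, m⁆) = LinearMap.trace ℂ M (R m * R ⁅x, v⁆) := by
    intro x m
    have : R ⁅x, m⁆ = (toEnd ℂ s M x * R m - R m * toEnd ℂ s M x) + R m * R ⁅x, v⁆ := by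
      ext n
      obtain ⟨y, rfl⟩ := e.surjective n
      simp only [LinearMap.add_apply, LinearMap.sub_apply, Module.End.mul_apply, hR, toEnd_apply_apply,
        e.symm_apply_apply]
      have h1 : e.symm ⁅x, e y⁆ = e.symm ⁅y, ⁅x, v⁆⁆ - ⁅y, x⁆ := by
        apply e.injective
        rw [map_sub, e.apply_symm_apply, e.apply_symm_apply, he, he, lie_lie]
        abel
      rw [h1, sub_lie, lie_lie]
      abel
    rw [this, map_add, map_sub, LinearMap.trace_mul_comm, sub_self, zero_add]
  have h0 := perfect_hom hp (LinearMap.trace ℂ M ∘ₗ R ∘ₗ (e : s →ₗ[ℂ] M)) (by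
    intro x y
    simp only [LinearMap.comp_apply, LinearEquiv.coe_coe, he, lie_lie, map_sub, key]
    rw [LinearMap.trace_mul_comm, sub_self])
  have h1 := h0 (e.symm v)
  have h2 : R v = LinearMap.id := by
    ext n
    rw [hR, ← he]; simp
  simp only [LinearMap.comp_apply, LinearEquiv.coe_coe, e.apply_symm_apply, h2,
    LinearMap.trace_id] at h1
  exact Module.finrank_zero_iff.mp (by exact_mod_cast h1)

lemma casimir_tensor {s V W : Type*} [LieRing s] [LieAlgebra ℂ s]
    [AddCommGroup V] [Module ℂ V] [LieRingModule s V] [LieModule ℂ s V]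
    [AddCommGroup W] [Module ℂ W]
    (τ : LinearMap.BilinForm ℂ V) (hτ : τ.Nondegenerate) (hs : τ.IsSymm)
    (hinv : ∀ (x : s) (a b : V), τ ⁅x, a⁆ b = - τ a ⁅x, b⁆)
    {ι : Type*} [Fintype ι] [DecidableEq ι] (b : Basis ι ℂ V)
    (B : V →ₗ[ℂ] V →ₗ[ℂ] W) (x : s) :
    ∑ i, (B ⁅x, b i⁆ (τ.dualBasis hτ b i) + B (b i) ⁅x, τ.dualBasis hτ b i⁆) = 0 := by
  set b' := τ.dualBasis hτ b with hb'
  have e1 : ∀ y : V, y = ∑ j, τ y (b' j) • b j := by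
    intro y
    have h := (τ.dualBasis hτ b').sum_repr y
    simp only [LinearMap.BilinForm.dualBasis_repr_apply] at h
    rw [hb', LinearMap.BilinForm.dualBasis_dualBasis hτ hs] at h
    exact h.symm
  have e2 : ∀ y : V, y = ∑ j, τ y (b j) • b' j := by
    intro y
    have h := b'.sum_repr y
    simp only [hb', LinearMap.BilinForm.dualBasis_repr_apply] at h
    exact h.symm
  rw [Finset.sum_add_distrib]
  have h1 : ∑ i, B ⁅x, b i⁆ (b' i) = ∑ i, ∑ j, τ ⁅x, b i⁆ (b' j) • B (b j) (b' i) := by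
    refine Finset.sum_congr rfl fun i _ => ?_
    conv_lhs => rw [e1 ⁅x, b i⁆]
    simp
  have h2 : ∑ i, B (b i) ⁅x, b' i⁆ = ∑ i, ∑ j, τ ⁅x, b' i⁆ (b j) • B (b i) (b' j) := by
    refine Finset.sum_congr rfl fun i _ => ?_
    conv_lhs => rw [e2 ⁅x, b' i⁆]
    simp
  rw [h1, h2, Finset.sum_comm, ← Finset.sum_add_distrib]
  refine Finset.sum_eq_zero fun i _ => ?_
  rw [← Finset.sum_add_distrib]
  refine Finset.sum_eq_zero fun j _ => ?_
  rw [← add_smul, hinv x (b j), hs.eq ⁅x, b' i⁆]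
  simp

lemma whitehead_irred {s : Type*} [LieRing s] [LieAlgebra ℂ s] [Module.Finite ℂ s]
    [HasTrivialRadical ℂ s]
    {M : Type*} [AddCommGroup M] [Module ℂ M] [LieRingModule s M] [LieModule ℂ s M]
    [Module.Finite ℂ M] (hirr : ∀ N : LieSubmodule ℂ s M, N = ⊥ ∨ N = ⊤)
    (f : s →ₗ[ℂ] M) (hf : ∀ x y : s, f ⁅x, y⁆ = ⁅x, f y⁆ - ⁅y, f x⁆) :
    ∃ m : M, ∀ x, f x = ⁅x, m⁆ := by
  rcases subsingleton_or_nontrivial M with hM | hM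
  · exact ⟨0, fun x => Subsingleton.elim _ _⟩
  set τ := traceForm ℂ s M with hτ
  let Z : LieIdeal ℂ s := InvariantForm.orthogonal τ (traceForm_lieInvariant ℂ s M) ⊤
  have hZ : ∀ x, x ∈ Z ↔ ∀ y, τ y x = 0 := by
    intro x
    rw [InvariantForm.mem_orthogonal]
    simp
  let J : LieIdeal ℂ s := Z.killingCompl
  have hZJ : IsCompl Z J := LieIdeal.isCompl_killingCompl Z
  by_cases hJ : J = ⊥
  · have hZtop : Z = ⊤ := by
      have := hZJ.codisjoint
      rwa [hJ, codisjoint_bot] at this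
    have hτ0 : traceForm ℂ s M = 0 := by
      ext x y
      exact (hZ y).1 (hZtop ▸ LieSubmodule.mem_top y) x
    have hn := isNilpotent_derivedSeries_of_traceForm_eq_zero hτ0
    have hd : derivedSeries ℂ s 1 = ⊤ := semisimple_perfect
    have hnt := nontrivial_max_triv_of_isNilpotent ℂ (derivedSeries ℂ s 1) M
    obtain ⟨⟨m, hm⟩, hm0⟩ := exists_ne (0 : maxTrivSubmodule ℂ (derivedSeries ℂ s 1) M)
    have hm1 : m ∈ maxTrivSubmodule ℂ s M := by
      rw [mem_maxTrivSubmodule] at hm ⊢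
      intro x
      exact hm ⟨x, hd ▸ LieSubmodule.mem_top x⟩
    have htop : maxTrivSubmodule ℂ s M = ⊤ := by
      rcases hirr (maxTrivSubmodule ℂ s M) with h | h
      · rw [h, LieSubmodule.mem_bot] at hm1
        exact absurd (Subtype.ext hm1) hm0
      · exact h
    have htriv : ∀ (x : s) (m : M), ⁅x, m⁆ = 0 := fun x m =>
      (mem_maxTrivSubmodule ℂ s M m).1 (htop ▸ LieSubmodule.mem_top m) x
    refine ⟨0, fun x => ?_⟩
    rw [lie_zero]
    exact perfect_hom semisimple_perfect f (fun x y => by rw [hf, htriv, htriv, sub_zero]) x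
  · let τJ : LinearMap.BilinForm ℂ J := τ.restrict J.toSubmodule
    have hτJ : ∀ a b : J, τJ a b = τ (a : s) (b : s) := fun a b => rfl
    have hsymm : τJ.IsSymm := ⟨fun a b => by
      simp only [hτJ]; exact traceForm_comm ℂ s M _ _⟩
    have hnd : τJ.Nondegenerate := by
      refine (hsymm.isRefl.nondegenerate_iff_separatingLeft).2 ?_
      intro x hx
      have hxZ : (x : s) ∈ Z := by
        rw [hZ]
        intro y
        have hy : y ∈ (Z ⊔ J : LieIdeal ℂ s) := by
          rw [hZJ.codisjoint.eq_top]; exact LieSubmodule.mem_top y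
        obtain ⟨z, hz, j, hj, rfl⟩ := (LieSubmodule.mem_sup _ _ _).1 hy
        rw [map_add, LinearMap.add_apply]
        have h1 : τ z x = 0 := by
          rw [hτ, traceForm_comm]; exact (hZ z).1 hz x
        have h2 : τ j x = 0 := by
          rw [hτ, traceForm_comm]; exact hx ⟨j, hj⟩
        rw [h1, h2, add_zero]
      have := hZJ.disjoint.le_bot (show (x : s) ∈ Z ⊓ J from ⟨hxZ, x.2⟩)
      exact Subtype.ext ((LieSubmodule.mem_bot _).1 this)
    have hinv : ∀ (x : s) (a b : J), τJ ⁅x, a⁆ b = - τJ a ⁅x, b⁆ := by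
      intro x a b
      simp only [hτJ, LieSubmodule.coe_bracket]
      exact traceForm_lieInvariant ℂ s M x a b
    let b := Module.finBasis ℂ J
    set b' := τJ.dualBasis hnd b with hb'
    let T : J →ₗ[ℂ] Module.End ℂ M := (toEnd ℂ s M : s →ₗ[ℂ] Module.End ℂ M) ∘ₗ J.toSubmodule.subtype
    have hT : ∀ (a : J) (m : M), T a m = ⁅(a : s), m⁆ := fun _ _ => rfl
    let C : Module.End ℂ M := ∑ i, T (b i) * T (b' i)
    have hC : ∀ m, C m = ∑ i, ⁅(b i : s), ⁅(b' i : s), m⁆⁆ := by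
      intro m; simp [C, hT]
    -- commutation
    have hcomm : ∀ (x : s) (m : M), C ⁅x, m⁆ = ⁅x, C m⁆ := by
      intro x m
      have h := casimir_tensor τJ hnd hsymm hinv b
        (((LinearMap.mul ℂ (Module.End ℂ M)).compl₁₂ T T).compr₂ (LinearMap.applyₗ m)) x
      simp only [LinearMap.compr₂_apply, LinearMap.compl₁₂_apply, LinearMap.mul_apply',
        LinearMap.applyₗ_apply_apply, Module.End.mul_apply, hT, LieSubmodule.coe_bracket] at h
      rw [hC, hC, lie_sum, ← sub_eq_zero, ← neg_eq_zero, ← h, neg_sub,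
        ← Finset.sum_sub_distrib]
      refine Finset.sum_congr rfl fun i _ => ?_
      rw [lie_lie, lie_lie, lie_sub]
      abel
    have hv : ∀ x : s, ⁅x, ∑ i, ⁅(b i : s), f (b' i)⁆⁆ = C (f x) := by
      intro x
      have h := casimir_tensor τJ hnd hsymm hinv b
        (T.compl₂ (f ∘ₗ J.toSubmodule.subtype)) x
      have h' : ∑ i, (⁅⁅x, (b i : s)⁆, f (b' i)⁆ + ⁅(b i : s), f ⁅x, (b' i : s)⁆⁆) = 0 := h
      rw [hC, lie_sum, ← sub_eq_zero, ← h', ← Finset.sum_sub_distrib]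
      refine Finset.sum_congr rfl fun i _ => ?_
      rw [hf, lie_lie, lie_sub]
      abel
    have htr : LinearMap.trace ℂ M C = finrank ℂ J := by
      have h1 : ∀ i, LinearMap.trace ℂ M (T (b i) * T (b' i)) = 1 := by
        intro i
        have := LinearMap.BilinForm.apply_dualBasis_right hnd hsymm b i i
        rw [if_pos rfl] at this
        exact this
      simp only [C, map_sum, h1]
      simp
    let K : LieSubmodule ℂ s M :=
      { toSubmodule := LinearMap.ker C
        lie_mem := by
          intro x m hm
          have hm' : C m = 0 := hm
          show C ⁅x, m⁆ = 0
          rw [hcomm, hm', lie_zero] }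
    have hK : ∀ m, m ∈ K ↔ C m = 0 := fun m => Iff.rfl
    have hinj : Function.Injective C := by
      rcases hirr K with h | h
      · rw [← LinearMap.ker_eq_bot, eq_bot_iff]
        intro m hm
        have : m ∈ K := hm
        rw [h, LieSubmodule.mem_bot] at this
        simpa using this
      · exfalso
        have hC0 : C = 0 := by
          ext m
          exact (hK m).1 (h ▸ LieSubmodule.mem_top m)
        rw [hC0, map_zero] at htr
        have h0 : finrank ℂ J = 0 := by exact_mod_cast htr.symm
        have := Module.finrank_zero_iff.mp h0
        apply hJ
        rw [eq_bot_iff]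
        intro x hx
        have : (⟨x, hx⟩ : J) = 0 := Subsingleton.elim _ _
        simpa using congrArg Subtype.val this
    obtain ⟨m, hm⟩ := (LinearMap.injective_iff_surjective.1 hinj) (∑ i, ⁅(b i : s), f (b' i)⁆)
    refine ⟨m, fun x => hinj ?_⟩
    rw [hcomm, hm, hv]

lemma whitehead {s : Type*} [LieRing s] [LieAlgebra ℂ s] [Module.Finite ℂ s]
    [HasTrivialRadical ℂ s] (n : ℕ) :
    ∀ {M : Type*} [AddCommGroup M] [Module ℂ M] [LieRingModule s M] [LieModule ℂ s M]
    [Module.Finite ℂ M] (_ : finrank ℂ M = n)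
    (f : s →ₗ[ℂ] M) (_ : ∀ x y : s, f ⁅x, y⁆ = ⁅x, f y⁆ - ⁅y, f x⁆),
    ∃ m : M, ∀ x, f x = ⁅x, m⁆ := by
  induction n using Nat.strong_induction_on with
  | _ n ih =>
    intro M _ _ _ _ _ hn f hf
    by_cases hirr : ∀ N : LieSubmodule ℂ s M, N = ⊥ ∨ N = ⊤
    · exact whitehead_irred hirr f hf
    push Not at hirr
    obtain ⟨N, hN0, hN1⟩ := hirr
    have hN0' : N.toSubmodule ≠ ⊥ := by simpa using hN0
    have hN1' : N.toSubmodule ≠ ⊤ := by simpa using hN1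
    have hlt1 : finrank ℂ N < n := by
      rw [← hn]; exact Submodule.finrank_lt hN1'
    have hlt2 : finrank ℂ (M ⧸ N) < n := by
      have h := Submodule.finrank_quotient_add_finrank N.toSubmodule
      have h2 : 0 < finrank ℂ N.toSubmodule := by
        rw [Module.finrank_pos_iff, Submodule.nontrivial_iff_ne_bot]; exact hN0'
      have h3 : finrank ℂ (M ⧸ N) = finrank ℂ (M ⧸ N.toSubmodule) := rfl
      omega
    have : Module.Finite ℂ (M ⧸ N) := inferInstanceAs (Module.Finite ℂ (M ⧸ N.toSubmodule))
    let q : M →ₗ⁅ℂ, s⁆ M ⧸ N := LieSubmodule.Quotient.mk' N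
    have hq0 : ∀ m, q m = 0 ↔ m ∈ N := fun m => LieSubmodule.Quotient.mk_eq_zero'
    obtain ⟨mb, hmb⟩ := ih _ hlt2 (M := M ⧸ N) rfl ((q : M →ₗ[ℂ] M ⧸ N) ∘ₗ f) (by
      intro x y
      simp [hf])
    obtain ⟨m, rfl⟩ := LieSubmodule.Quotient.surjective_mk' N mb
    have hmem : ∀ x, f x - ⁅x, m⁆ ∈ N := by
      intro x
      rw [← hq0, map_sub, sub_eq_zero, LieModuleHom.map_lie]
      exact hmb x
    let g : s →ₗ[ℂ] N := LinearMap.codRestrict N.toSubmodule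
      (f - (toEnd ℂ s M : s →ₗ[ℂ] Module.End ℂ M).flip m) hmem
    have hg : ∀ x, ((g x : N) : M) = f x - ⁅x, m⁆ := fun x => rfl
    obtain ⟨w, hw⟩ := ih _ hlt1 (M := N) rfl g (by
      intro x y
      apply Subtype.ext
      simp only [hg, LieSubmodule.coe_bracket, LieSubmodule.coe_sub, hf, lie_sub, lie_lie]
      abel)
    refine ⟨m + w, fun x => ?_⟩
    have := congrArg Subtype.val (hw x)
    rw [LieSubmodule.coe_bracket, hg] at this
    rw [lie_add, ← this]
    abel

/-- Relative version. -/
lemma whitehead_rel {s : Type*} [LieRing s] [LieAlgebra ℂ s] [Module.Finite ℂ s]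
    [HasTrivialRadical ℂ s]
    {M : Type*} [AddCommGroup M] [Module ℂ M] [LieRingModule s M] [LieModule ℂ s M]
    [Module.Finite ℂ M] (N N' : LieSubmodule ℂ s M)
    (f : s →ₗ[ℂ] M) (hN : ∀ x, f x ∈ N)
    (hf : ∀ x y : s, f ⁅x, y⁆ - (⁅x, f y⁆ - ⁅y, f x⁆) ∈ N') :
    ∃ m ∈ N, ∀ x, f x - ⁅x, m⁆ ∈ N' := by
  have : Module.Finite ℂ (M ⧸ N') := inferInstanceAs (Module.Finite ℂ (M ⧸ N'.toSubmodule))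
  let q : M →ₗ⁅ℂ, s⁆ M ⧸ N' := LieSubmodule.Quotient.mk' N'
  have hq0 : ∀ m, q m = 0 ↔ m ∈ N' := fun m => LieSubmodule.Quotient.mk_eq_zero'
  let P : LieSubmodule ℂ s (M ⧸ N') := N.map q
  have hP : ∀ m ∈ N, q m ∈ P := fun m hm => LieSubmodule.mem_map_of_mem hm
  let g : s →ₗ[ℂ] P := LinearMap.codRestrict P.toSubmodule ((q : M →ₗ[ℂ] M ⧸ N') ∘ₗ f)
    (fun x => hP _ (hN x))
  have hg : ∀ x, ((g x : P) : M ⧸ N') = q (f x) := fun x => rfl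
  obtain ⟨⟨w, hw⟩, hwg⟩ := whitehead _ (M := P) rfl g (by
    intro x y
    apply Subtype.ext
    simp only [hg, LieSubmodule.coe_bracket, LieSubmodule.coe_sub]
    rw [← sub_eq_zero, ← LieModuleHom.map_lie, ← LieModuleHom.map_lie, ← map_sub, ← map_sub, hq0]
    exact hf x y)
  obtain ⟨m, hm, rfl⟩ := (LieSubmodule.mem_map _).1 hw
  refine ⟨m, hm, fun x => ?_⟩
  rw [← hq0, map_sub, LieModuleHom.map_lie, sub_eq_zero]
  exact congrArg Subtype.val (hwg x)

lemma exists_rad_invariant {L : Type*} [LieRing L] [LieAlgebra ℂ L] [Module.Finite ℂ L]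
    (hp : ⁅(⊤ : LieIdeal ℂ L), (⊤ : LieIdeal ℂ L)⁆ = ⊤)
    (r : LieIdeal ℂ L) [IsSolvable r]
    {V : Type*} [AddCommGroup V] [Module ℂ V] [LieRingModule L V] [LieModule ℂ L V]
    [Module.Finite ℂ V] [Nontrivial V] : ∃ v : V, v ≠ 0 ∧ ∀ z ∈ r, ⁅z, v⁆ = 0 := by
  obtain ⟨χ, hχ⟩ : ∃ χ : Module.Dual ℂ r, Nontrivial (weightSpace V χ) :=
    exists_nontrivial_weightSpace_of_isSolvable ℂ r V
  let N : LieSubmodule ℂ L V := weightSpaceOfIsLieTower ℂ V χ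
  have hN : Nontrivial N := hχ
  have hmem : ∀ v ∈ N, ∀ (y : L) (hy : y ∈ r), ⁅y, v⁆ = χ ⟨y, hy⟩ • v := by
    intro v hv
    simpa [N, weightSpaceOfIsLieTower, mem_weightSpace] using hv
  have htr := perfect_hom hp (LinearMap.trace ℂ N ∘ₗ (toEnd ℂ L N : L →ₗ[ℂ] Module.End ℂ N)) (by
    intro x y
    simp)
  have hχ0 : ∀ (y : L) (hy : y ∈ r), χ ⟨y, hy⟩ = 0 := by
    intro y hy
    have h1 : toEnd ℂ L N y = χ ⟨y, hy⟩ • LinearMap.id := by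
      ext v
      simpa using hmem v v.2 y hy
    have h2 := htr y
    have h3 : finrank ℂ N ≠ 0 := (Module.finrank_pos_iff.mpr hN).ne'
    simp only [LinearMap.comp_apply, LieHom.coe_toLinearMap, h1, map_smul, LinearMap.trace_id,
      smul_eq_mul, mul_eq_zero] at h2
    rcases h2 with h2 | h2
    · exact h2
    · exact absurd (by exact_mod_cast h2) h3
  obtain ⟨⟨v, hv⟩, hv0⟩ := exists_ne (0 : N)
  refine ⟨v, fun h => hv0 (Subtype.ext h), fun z hz => ?_⟩
  rw [hmem v hv z hz, hχ0, zero_smul]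

lemma eq_bot_of_lie_eq {L : Type*} [LieRing L] [LieAlgebra ℂ L] [Module.Finite ℂ L]
    (hp : ⁅(⊤ : LieIdeal ℂ L), (⊤ : LieIdeal ℂ L)⁆ = ⊤)
    (r : LieIdeal ℂ L) [IsSolvable r] (N : LieIdeal ℂ L) (h : N ≤ ⁅r, N⁆) : N = ⊥ := by
  by_contra hN
  have hnt : Nontrivial N := by
    have : N.toSubmodule ≠ ⊥ := by simpa using hN
    exact (Submodule.nontrivial_iff_ne_bot).2 this
  have : Nontrivial (Module.Dual ℂ N) := inferInstance
  obtain ⟨ξ, hξ0, hξ⟩ := exists_rad_invariant hp r (V := Module.Dual ℂ N)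
  apply hξ0
  have hz : ∀ z ∈ r, ∀ n : N, ξ ⁅z, n⁆ = 0 := by
    intro z hz n
    have := congrArg (fun t : Module.Dual ℂ N => t n) (hξ z hz)
    simpa using this
  have hle : (⁅r, N⁆ : LieIdeal ℂ L).toSubmodule ≤ (LinearMap.ker ξ).map N.toSubmodule.subtype := by
    rw [LieSubmodule.lieIdeal_oper_eq_linear_span', Submodule.span_le]
    rintro _ ⟨a, ha, b, hb, rfl⟩
    let c : N := ⁅a, (⟨b, hb⟩ : N)⁆
    exact ⟨c, hz a ha ⟨b, hb⟩, rfl⟩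
  ext n
  obtain ⟨n', hn', he⟩ := hle (h n.2)
  have : n' = n := Subtype.ext he
  rw [← this]
  exact hn'

/-- Lower central filtration. -/
def lcsD {L : Type*} [LieRing L] [LieAlgebra ℂ L] (r : LieIdeal ℂ L) : ℕ → LieIdeal ℂ L
  | 0 => r
  | k + 1 => ⁅r, lcsD r k⁆

lemma lcsD_succ_le {L : Type*} [LieRing L] [LieAlgebra ℂ L] (r : LieIdeal ℂ L) (k : ℕ) :
    lcsD r (k + 1) ≤ lcsD r k := LieSubmodule.lie_le_right _ _

lemma lcsD_antitone {L : Type*} [LieRing L] [LieAlgebra ℂ L] (r : LieIdeal ℂ L) :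
    Antitone (lcsD r) := antitone_nat_of_succ_le (lcsD_succ_le r)

lemma lcsD_le {L : Type*} [LieRing L] [LieAlgebra ℂ L] (r : LieIdeal ℂ L) (k : ℕ) :
    lcsD r k ≤ r := lcsD_antitone r (Nat.zero_le k)

lemma lcsD_lie {L : Type*} [LieRing L] [LieAlgebra ℂ L] (r : LieIdeal ℂ L) (k : ℕ)
    {x y : L} (hx : x ∈ r) (hy : y ∈ lcsD r k) : ⁅x, y⁆ ∈ lcsD r (k + 1) :=
  LieSubmodule.lie_mem_lie hx hy

lemma lcsD_lie' {L : Type*} [LieRing L] [LieAlgebra ℂ L] (r : LieIdeal ℂ L) (k : ℕ)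
    {x y : L} (hx : x ∈ r) (hy : y ∈ lcsD r k) : ⁅y, x⁆ ∈ lcsD r (k + 1) := by
  rw [← lie_skew]
  exact neg_mem (lcsD_lie r k hx hy)

lemma lcsD_eq_bot {L : Type*} [LieRing L] [LieAlgebra ℂ L] [Module.Finite ℂ L]
    (hp : ⁅(⊤ : LieIdeal ℂ L), (⊤ : LieIdeal ℂ L)⁆ = ⊤)
    (r : LieIdeal ℂ L) [IsSolvable r] : ∃ k, lcsD r k = ⊥ := by
  have : WellFoundedLT (LieSubmodule ℂ L L) := LieSubmodule.wellFoundedLT_of_isArtinian ℂ L L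
  obtain ⟨k, hk⟩ := WellFoundedGT.monotone_chain_condition (α := (LieSubmodule ℂ L L)ᵒᵈ)
    ⟨fun n => OrderDual.toDual (lcsD r n), fun a b h => lcsD_antitone r h⟩
  refine ⟨k, eq_bot_of_lie_eq hp r _ ?_⟩
  have : lcsD r k = lcsD r (k + 1) := hk (k + 1) (Nat.le_succ k)
  exact this.le

lemma ad_pow_mem {L : Type*} [LieRing L] [LieAlgebra ℂ L] (r : LieIdeal ℂ L) {v : L} (hv : v ∈ r)
    (x : L) (n : ℕ) : ((ad ℂ L v) ^ (n + 1)) x ∈ lcsD r n := by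
  induction n with
  | zero =>
    simp only [zero_add, pow_one, ad_apply]
    exact lie_mem_left ℂ L r v x hv
  | succ n ih =>
    rw [pow_succ', Module.End.mul_apply, ad_apply]
    exact lcsD_lie r n hv ih

lemma ad_pow_diff {L : Type*} [LieRing L] [LieAlgebra ℂ L] (r : LieIdeal ℂ L) {v w : L} (k : ℕ)
    (hv : v ∈ r) (hw : w ∈ lcsD r k) (x : L) (n : ℕ) :
    ((ad ℂ L (v + w)) ^ (n + 2)) x - ((ad ℂ L v) ^ (n + 2)) x ∈ lcsD r (k + 1) := by
  have key : ∀ n, ((ad ℂ L (v + w)) ^ (n + 1)) x - ((ad ℂ L v) ^ (n + 1)) x ∈ lcsD r k →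
      ((ad ℂ L (v + w)) ^ (n + 2)) x - ((ad ℂ L v) ^ (n + 2)) x ∈ lcsD r (k + 1) := by
    intro n h
    have hvw : v + w ∈ r := add_mem hv (lcsD_le r k hw)
    rw [pow_succ' _ (n + 1), pow_succ' (ad ℂ L v) (n + 1), Module.End.mul_apply,
      Module.End.mul_apply, ad_apply, ad_apply]
    have h1 := lcsD_lie r k hv h
    have h2 := lcsD_lie' r k (lcsD_le r n (ad_pow_mem r hvw x n)) hw
    have := add_mem h1 h2
    convert this using 1
    rw [lie_sub, add_lie]
    abel
  have all : ∀ n, ((ad ℂ L (v + w)) ^ (n + 1)) x - ((ad ℂ L v) ^ (n + 1)) x ∈ lcsD r k := by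
    intro n
    induction n with
    | zero =>
      simp only [zero_add, pow_one, ad_apply, add_lie, add_sub_cancel_left]
      exact lie_mem_left ℂ L _ w x hw
    | succ n ih => exact lcsD_succ_le r k (key n ih)
  exact key n (all n)

/-- Truncated exponential of `ad v`. -/
noncomputable def expAd {L : Type*} [LieRing L] [LieAlgebra ℂ L] (K : ℕ) (v : L) : L →ₗ[ℂ] L :=
  ∑ i ∈ Finset.range K, ((i.factorial : ℂ)⁻¹) • (ad ℂ L v) ^ i

lemma expAd_apply {L : Type*} [LieRing L] [LieAlgebra ℂ L] (K : ℕ) (v x : L) :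
    expAd K v x = ∑ i ∈ Finset.range K, ((i.factorial : ℂ)⁻¹) • ((ad ℂ L v) ^ i) x := by
  simp [expAd]

lemma expAd_props {L : Type*} [LieRing L] [LieAlgebra ℂ L] (K : ℕ) (v : L)
    (hK : (ad ℂ L v) ^ K = 0) :
    (∀ x y, expAd K v ⁅x, y⁆ = ⁅expAd K v x, expAd K v y⁆) ∧ Function.Injective (expAd K v) := by
  let : Module ℚ L := Module.compHom L (algebraMap ℚ ℂ)
  have hsm : ∀ (q : ℚ) (x : L), q • x = (q : ℂ) • x := fun q x => rfl
  let : LieAlgebra ℚ L := { lie_smul := fun q x y => by simp only [hsm, lie_smul] }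
  have : SMulCommClass ℂ ℚ L := ⟨fun c q x => by simp only [hsm]; exact smul_comm _ _ _⟩
  have hD : (LieDerivation.ad ℂ L v).toLinearMap = ad ℂ L v :=
    LieDerivation.coe_ad_apply_eq_ad_apply v
  have hn : IsNilpotent (LieDerivation.ad ℂ L v).toLinearMap := by
    rw [hD]; exact ⟨K, hK⟩
  have he : ∀ x, LieDerivation.exp (LieDerivation.ad ℂ L v) hn x = expAd K v x := by
    intro x
    rw [LieDerivation.exp_map_apply, hD, IsNilpotent.exp_eq_sum hK, expAd_apply,
      LinearMap.sum_apply]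
    refine Finset.sum_congr rfl fun i _ => ?_
    rw [LinearMap.smul_apply, hsm]
    simp
  constructor
  · intro x y
    simp only [← he]
    exact LieEquiv.map_lie _ _ _
  · intro x y h
    rw [← he, ← he] at h
    exact (LieDerivation.exp (LieDerivation.ad ℂ L v) hn).injective h

lemma expAd_sub_self {L : Type*} [LieRing L] [LieAlgebra ℂ L] (r : LieIdeal ℂ L) (K : ℕ)
    {v : L} (hv : v ∈ r) (x : L) : expAd (K + 1) v x - x ∈ r := by
  rw [expAd_apply, Finset.sum_range_succ']
  simp only [Nat.factorial_zero, Nat.cast_one, inv_one, pow_zero, one_smul, Module.End.one_apply,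
    add_sub_cancel_right]
  exact sum_mem fun i _ => SMulMemClass.smul_mem _ (lcsD_le r i (ad_pow_mem r hv x i))

lemma expAd_add {L : Type*} [LieRing L] [LieAlgebra ℂ L] (r : LieIdeal ℂ L) (K : ℕ)
    {v w : L} (k : ℕ) (hv : v ∈ r) (hw : w ∈ lcsD r k) (x : L) :
    expAd (K + 2) (v + w) x - expAd (K + 2) v x - ⁅w, x⁆ ∈ lcsD r (k + 1) := by
  rw [expAd_apply, expAd_apply, Finset.sum_range_succ', Finset.sum_range_succ',
    Finset.sum_range_succ' _ (K + 1), Finset.sum_range_succ' _ K]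
  have h : ∑ i ∈ Finset.range K, (((i + 2).factorial : ℂ)⁻¹) •
      (((ad ℂ L (v + w)) ^ (i + 2)) x - ((ad ℂ L v) ^ (i + 2)) x) ∈ lcsD r (k + 1) :=
    sum_mem fun i _ => SMulMemClass.smul_mem _ (ad_pow_diff r k hv hw x i)
  convert h using 1
  simp only [smul_sub, Finset.sum_sub_distrib, zero_add, pow_one, pow_zero, ad_apply, add_lie,
    Nat.factorial_one, Nat.factorial_zero, Nat.cast_one, inv_one, one_smul, add_assoc, one_add_one_eq_two]
  abel

lemma malcev {L s : Type*} [LieRing L] [LieAlgebra ℂ L] [Module.Finite ℂ L]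
    [LieRing s] [LieAlgebra ℂ s] [Module.Finite ℂ s] [HasTrivialRadical ℂ s]
    (r : LieIdeal ℂ L) (n : ℕ) (hn : lcsD r n = ⊥)
    (σ φ : s →ₗ⁅ℂ⁆ L) (h : ∀ x, σ x - φ x ∈ r) :
    ∃ v ∈ r, ∀ x, expAd (n + 2) v (σ x) = φ x := by
  let : LieRingModule s L := LieRingModule.compLieHom L φ
  have : LieModule ℂ s L := LieModule.compLieHom L φ
  have hb : ∀ (x : s) (m : L), ⁅x, m⁆ = ⁅φ x, m⁆ := fun _ _ => rfl
  let S : ℕ → LieSubmodule ℂ s L := fun k =>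
    { toSubmodule := (lcsD r k).toSubmodule
      lie_mem := fun {x m} hm => (lcsD r k).lie_mem (x := φ x) hm }
  have hS : ∀ k m, m ∈ S k ↔ m ∈ lcsD r k := fun _ _ => Iff.rfl
  have hnil : ∀ v ∈ r, (ad ℂ L v) ^ (n + 2) = 0 := by
    intro v hv
    ext x
    have h1 := lcsD_succ_le r n (ad_pow_mem r hv x (n + 1))
    rw [hn, LieSubmodule.mem_bot] at h1
    exact h1
  have main : ∀ k, ∃ v ∈ r, ∀ x, expAd (n + 2) v (σ x) - φ x ∈ lcsD r k := by
    intro k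
    induction k with
    | zero =>
      refine ⟨0, zero_mem r, fun x => ?_⟩
      have := add_mem (expAd_sub_self r (n + 1) (zero_mem r) (σ x)) (h x)
      rwa [sub_add_sub_cancel] at this
    | succ k ih =>
      obtain ⟨v, hv, hvk⟩ := ih
      let c : s →ₗ[ℂ] L := (expAd (n + 2) v) ∘ₗ (σ : s →ₗ[ℂ] L) - (φ : s →ₗ[ℂ] L)
      have hc : ∀ x, c x = expAd (n + 2) v (σ x) - φ x := fun x => rfl
      have hc' : ∀ x, expAd (n + 2) v (σ x) = c x + φ x := fun x => by rw [hc]; abel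
      obtain ⟨w, hw, hwc⟩ := whitehead_rel (S k) (S (k + 1)) c (fun x => hvk x) (by
        intro x y
        rw [hS]
        have : c ⁅x, y⁆ - (⁅x, c y⁆ - ⁅y, c x⁆) = ⁅c x, c y⁆ := by
          rw [hb, hb, hc ⁅x, y⁆, LieHom.map_lie, LieHom.map_lie, (expAd_props _ v (hnil v hv)).1,
            hc' x, hc' y]
          simp only [add_lie, lie_add]
          rw [← lie_skew (c x) (φ y)]
          abel
        rw [this]
        exact lcsD_lie r k (lcsD_le r k (hvk x)) (hvk y))
      refine ⟨v + w, add_mem hv (lcsD_le r k hw), fun x => ?_⟩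
      have h1 := expAd_add r n k hv hw (σ x)
      have h2 : c x - ⁅φ x, w⁆ ∈ lcsD r (k + 1) := hwc x
      have h3 := lcsD_lie' r k (h x) hw
      have := add_mem (add_mem h1 h2) h3
      convert this using 1
      rw [hc, lie_sub, ← lie_skew (φ x) w]
      abel
  obtain ⟨v, hv, hvn⟩ := main n
  refine ⟨v, hv, fun x => ?_⟩
  have := hvn x
  rw [hn, LieSubmodule.mem_bot, sub_eq_zero] at this
  exact this

lemma core_abs {L s : Type*} [LieRing L] [LieAlgebra ℂ L] [Module.Finite ℂ L]
    [LieRing s] [LieAlgebra ℂ s] [Module.Finite ℂ s] [HasTrivialRadical ℂ s]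
    (r : LieIdeal ℂ L) (φ : s →ₗ⁅ℂ⁆ L) (v : L) (hv : v ∈ r)
    (hinj : ∀ x, ⁅φ x, v⁆ = 0 → x = 0) (hd : finrank ℂ s = finrank ℂ r) : Subsingleton r := by
  let _ : LieRingModule s r := LieRingModule.compLieHom r φ
  have : LieModule ℂ s r := LieModule.compLieHom r φ
  have hb : ∀ (x : s) (m : r), ((⁅x, m⁆ : r) : L) = ⁅φ x, (m : L)⁆ := fun _ _ => rfl
  let g : s →ₗ[ℂ] r := (toEnd ℂ s r : s →ₗ[ℂ] Module.End ℂ r).flip ⟨v, hv⟩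
  have hg : ∀ x, g x = ⁅x, (⟨v, hv⟩ : r)⁆ := fun x => rfl
  have hgi : Function.Injective g := by
    rw [injective_iff_map_eq_zero]
    intro x hx
    apply hinj
    rw [hg] at hx
    have := congrArg Subtype.val hx
    rw [hb] at this
    exact this
  exact no_etale semisimple_perfect (⟨v, hv⟩ : r) (LinearMap.linearEquivOfInjective g hgi hd)
    (fun x => hg x)

lemma sum_perfect {L : Type*} [LieRing L] [LieAlgebra ℂ L] [Module.Finite ℂ L]
    (s₁ s₂ : LieSubalgebra ℂ L)
    (h₁ : HasTrivialRadical ℂ s₁) (h₂ : HasTrivialRadical ℂ s₂)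
    (hsum : s₁.toSubmodule ⊔ s₂.toSubmodule = ⊤) :
    ⁅(⊤ : LieIdeal ℂ L), (⊤ : LieIdeal ℂ L)⁆ = ⊤ := by
  set D : LieIdeal ℂ L := ⁅(⊤ : LieIdeal ℂ L), (⊤ : LieIdeal ℂ L)⁆ with hD
  have key : ∀ t : LieSubalgebra ℂ L, HasTrivialRadical ℂ t → t.toSubmodule ≤ D.toSubmodule := by
    intro t ht x hx
    have := perfect_hom (semisimple_perfect (s := t)) (D.toSubmodule.mkQ ∘ₗ t.toSubmodule.subtype)
      (by
        intro a b
        rw [LinearMap.comp_apply, Submodule.mkQ_apply, Submodule.Quotient.mk_eq_zero]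
        exact LieSubmodule.lie_mem_lie (LieSubmodule.mem_top (a : L))
          (LieSubmodule.mem_top (b : L))) ⟨x, hx⟩
    rw [LinearMap.comp_apply, Submodule.mkQ_apply, Submodule.Quotient.mk_eq_zero] at this
    exact this
  rw [← LieSubmodule.toSubmodule_eq_top, eq_top_iff, ← hsum]
  exact sup_le (key s₁ h₁) (key s₂ h₂)

lemma levi_proj {L : Type*} [LieRing L] [LieAlgebra ℂ L]
    (s : LieSubalgebra ℂ L) (r : LieIdeal ℂ L) (hc : IsCompl s.toSubmodule r.toSubmodule) :
    ∃ P : L →ₗ⁅ℂ⁆ L, (∀ x, P x ∈ s) ∧ ∀ x, x - P x ∈ r := by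
  let p : L →ₗ[ℂ] L := s.toSubmodule.projection r.toSubmodule hc
  have hp1 : ∀ x, p x ∈ s := fun x => by
    exact Submodule.projection_apply_mem hc x
  have hp2 : ∀ x, x - p x ∈ r := fun x => by
    have : x - p x ∈ LinearMap.ker p := by
      rw [LinearMap.mem_ker, map_sub, sub_eq_zero]
      symm
      exact Submodule.projection_apply_left hc ⟨p x, hp1 x⟩
    rwa [Submodule.ker_projection] at this
  have huniq : ∀ z y, y ∈ s → z - y ∈ r → p z = y := by
    intro z y hy hz
    have h1 : p z - y ∈ s.toSubmodule := sub_mem (hp1 z) hy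
    have h2 : p z - y ∈ r.toSubmodule := by
      have := sub_mem hz (hp2 z)
      have e : z - y - (z - p z) = p z - y := by abel
      rw [e] at this
      exact this
    have := hc.disjoint.le_bot (show p z - y ∈ s.toSubmodule ⊓ r.toSubmodule from ⟨h1, h2⟩)
    exact sub_eq_zero.1 ((Submodule.mem_bot ℂ).1 this)
  refine ⟨{ p with map_lie' := ?_ }, hp1, hp2⟩
  intro x y
  refine huniq _ _ (s.lie_mem (hp1 x) (hp1 y)) ?_
  have e : ⁅x, y⁆ - ⁅p x, p y⁆ = ⁅x - p x, y⁆ + ⁅p x, y - p y⁆ := by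
    rw [sub_lie, lie_sub]; abel
  have := add_mem (lie_mem_left ℂ L r _ y (hp2 x)) (lie_mem_right ℂ L r (p x) _ (hp2 y))
  rw [← e] at this
  exact this

lemma core_not_levi {L : Type*} [LieRing L] [LieAlgebra ℂ L] [Module.Finite ℂ L]
    (s₁ s₂ : LieSubalgebra ℂ L)
    (h₁ : HasTrivialRadical ℂ s₁) (h₂ : HasTrivialRadical ℂ s₂)
    (hsum : s₁.toSubmodule ⊔ s₂.toSubmodule = ⊤)
    (hdisj : s₁.toSubmodule ⊓ s₂.toSubmodule = ⊥)
    (hrad : radical ℂ L ≠ ⊥) :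
    ¬ (s₁.toSubmodule ⊔ (radical ℂ L).toSubmodule = ⊤ ∧
        s₁.toSubmodule ⊓ (radical ℂ L).toSubmodule = ⊥) := by
  rintro ⟨hs, hi⟩
  have hp := sum_perfect s₁ s₂ h₁ h₂ hsum
  have hc : IsCompl s₁.toSubmodule (radical ℂ L).toSubmodule :=
    ⟨disjoint_iff.2 hi, codisjoint_iff.2 hs⟩
  have hc2 : IsCompl s₁.toSubmodule s₂.toSubmodule :=
    ⟨disjoint_iff.2 hdisj, codisjoint_iff.2 hsum⟩
  obtain ⟨P, hP1, hP2⟩ := levi_proj s₁ (radical ℂ L) hc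
  obtain ⟨n, hn⟩ := lcsD_eq_bot hp (radical ℂ L)
  let φ : s₂ →ₗ⁅ℂ⁆ L := P.comp s₂.incl
  obtain ⟨v, hv, hvx⟩ := malcev (radical ℂ L) n hn s₂.incl φ (fun x => hP2 x)
  have hnil : (ad ℂ L v) ^ (n + 2) = 0 := by
    ext x
    have h1 := lcsD_succ_le _ n (ad_pow_mem _ hv x (n + 1))
    rw [hn, LieSubmodule.mem_bot] at h1
    exact h1
  have hinj : ∀ x : s₂, ⁅φ x, v⁆ = 0 → x = 0 := by
    intro x hx
    have h0 : ad ℂ L v (φ x) = 0 := by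
      rw [ad_apply, ← lie_skew, hx, neg_zero]
    have h1 : expAd (n + 2) v (φ x) = φ x := by
      rw [expAd_apply, Finset.sum_range_succ', Finset.sum_eq_zero]
      · simp
      · intro i _
        rw [pow_succ, Module.End.mul_apply, h0, map_zero, smul_zero]
    have h2 : s₂.incl x = φ x := by
      apply (expAd_props _ v hnil).2
      rw [h1, hvx]
    have h3 : (x : L) ∈ s₁.toSubmodule ⊓ s₂.toSubmodule := by
      refine ⟨?_, x.2⟩
      have : (x : L) = φ x := h2
      rw [this]
      exact hP1 x
    rw [hdisj, Submodule.mem_bot] at h3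
    exact Subtype.ext h3
  have hd : finrank ℂ s₂ = finrank ℂ (radical ℂ L) := by
    have e1 := Submodule.finrank_add_eq_of_isCompl hc
    have e2 := Submodule.finrank_add_eq_of_isCompl hc2
    change finrank ℂ s₂.toSubmodule = finrank ℂ (radical ℂ L).toSubmodule
    omega
  have hsub := core_abs (radical ℂ L) φ v hv hinj hd
  apply hrad
  rw [eq_bot_iff]
  intro x hx
  have : (⟨x, hx⟩ : radical ℂ L) = 0 := Subsingleton.elim _ _
  simpa using congrArg Subtype.val this

theorem strongly_disemisimple_summands_not_levi
    {L : Type*} [LieRing L] [LieAlgebra ℂ L] [Module.Finite ℂ L]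
    (s₁ s₂ : LieSubalgebra ℂ L)
    (h₁ : LieAlgebra.HasTrivialRadical ℂ s₁)
    (h₂ : LieAlgebra.HasTrivialRadical ℂ s₂)
    (hsum : s₁.toSubmodule ⊔ s₂.toSubmodule = ⊤)
    (hdisj : s₁.toSubmodule ⊓ s₂.toSubmodule = ⊥)
    (hrad : LieAlgebra.radical ℂ L ≠ ⊥) :
    (¬ (s₁.toSubmodule ⊔ (LieAlgebra.radical ℂ L).toSubmodule = ⊤ ∧
        s₁.toSubmodule ⊓ (LieAlgebra.radical ℂ L).toSubmodule = ⊥)) ∧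
    (¬ (s₂.toSubmodule ⊔ (LieAlgebra.radical ℂ L).toSubmodule = ⊤ ∧
        s₂.toSubmodule ⊓ (LieAlgebra.radical ℂ L).toSubmodule = ⊥)) := by

  exact ⟨core_not_levi s₁ s₂ h₁ h₂ hsum hdisj hrad,
    core_not_levi s₂ s₁ h₂ h₁ (by rwa [sup_comm]) (by rwa [inf_comm]) hrad⟩
end

section
/- Let g be a finite-dimensional complex Lie algebra which is strongly disemisimple, i.e., g = s1 ∔ s2 is the direct vector space sum (s1 ∩ s2 = 0) of two semisimple Lie subalgebras s1 and s2. Then g is semisimple, and g is isomorphic as a Lie algebra to the direct Lie algebra sum s1 ⊕ s2 (the external direct product of the Lie algebras s1 and s2). -/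
namespace SDS

/-- Perfect Lie algebras, in an elementary form. -/
def Perf (g : Type*) [LieRing g] [LieAlgebra ℂ g] : Prop :=
  ∀ p : Submodule ℂ g, (∀ x y : g, ⁅x, y⁆ ∈ p) → ∀ x, x ∈ p

theorem perf_of_isKilling (g : Type*) [LieRing g] [LieAlgebra ℂ g] [Module.Finite ℂ g]
    [LieAlgebra.IsKilling ℂ g] : Perf g := by
  intro p hp
  by_contra hne
  have hlt : p < ⊤ := lt_top_iff_ne_top.mpr (fun h => hne (fun x => h ▸ Submodule.mem_top))
  obtain ⟨f, hf0, hf⟩ := Submodule.exists_le_ker_of_lt_top p hlt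
  have hnd := LieAlgebra.IsKilling.killingForm_nondegenerate ℂ g
  obtain ⟨x, rfl⟩ := ((killingForm ℂ g).toDual hnd).surjective f
  apply hf0
  have hx : x ∈ LieAlgebra.center ℂ g := by
    rw [LieModule.mem_maxTrivSubmodule]
    intro y
    apply hnd.1
    intro z
    have := hf (hp y z)
    simp only [LinearMap.mem_ker, LinearMap.BilinForm.toDual_def] at this
    rw [← neg_eq_zero, ← LinearMap.neg_apply, ← map_neg, lie_skew, LieModule.traceForm_apply_lie_apply]
    exact this
  rw [LieAlgebra.center_eq_bot] at hx
  rw [(LieSubmodule.mem_bot _).1 hx, map_zero]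

theorem derived_eq_top_of_perf (g : Type*) [LieRing g] [LieAlgebra ℂ g] (h : Perf g) :
    LieAlgebra.derivedSeries ℂ g 1 = ⊤ := by
  rw [eq_top_iff]
  intro x _
  refine h (LieAlgebra.derivedSeries ℂ g 1).toSubmodule (fun x y => ?_) x
  exact LieSubmodule.lie_mem_lie (LieSubmodule.mem_top _) (LieSubmodule.mem_top _)

theorem trivial_of_traceForm_zero (g V : Type*) [LieRing g] [LieAlgebra ℂ g] [Module.Finite ℂ g]
    [AddCommGroup V] [Module ℂ V] [Module.Finite ℂ V] [LieRingModule g V] [LieModule ℂ g V]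
    (h : Perf g) (h0 : LieModule.traceForm ℂ g V = 0) (a : g) (v : V) : ⁅a, v⁆ = 0 := by
  have h1 := LieModule.isNilpotent_derivedSeries_of_traceForm_eq_zero (R := ℂ) (L := g) (M := V) h0
  rw [derived_eq_top_of_perf g h] at h1
  replace h1 : LieModule.IsNilpotent g V := (LieModule.isNilpotent_of_top_iff (R := ℂ)).1 h1
  obtain ⟨k, hk⟩ := (LieModule.isNilpotent_iff ℂ g V).1 h1
  have key : ∀ k, ∀ (a : g) (v : V), ⁅a, v⁆ ∈ LieModule.lowerCentralSeries ℂ g V k := by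
    intro k
    induction k with
    | zero => intro a v; simp
    | succ k ih =>
      intro a v
      refine h ((LieModule.lowerCentralSeries ℂ g V (k+1)).toSubmodule.comap
        ((LieModule.toEnd ℂ g V : g →ₗ[ℂ] Module.End ℂ V).flip v)) (fun x y => ?_) a
      show ⁅⁅x, y⁆, v⁆ ∈ LieModule.lowerCentralSeries ℂ g V (k+1)
      rw [lie_lie, LieModule.lowerCentralSeries_succ]
      exact sub_mem (LieSubmodule.lie_mem_lie (LieSubmodule.mem_top _) (ih _ _))
        (LieSubmodule.lie_mem_lie (LieSubmodule.mem_top _) (ih _ _))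
  have := key k a v
  rw [hk] at this
  simpa using this

end SDS

namespace SDS

/-- The span of all `⁅x, v⁆`. -/
def LSpan (s V : Type*) [LieRing s] [LieAlgebra ℂ s]
    [AddCommGroup V] [Module ℂ V] [LieRingModule s V] : Submodule ℂ V :=
  Submodule.span ℂ {m | ∃ (x : s) (v : V), ⁅x, v⁆ = m}

section
variable {s V : Type*} [LieRing s] [LieAlgebra ℂ s] [Module.Finite ℂ s]
    [LieAlgebra.IsKilling ℂ s]
    [AddCommGroup V] [Module ℂ V] [Module.Finite ℂ V] [LieRingModule s V] [LieModule ℂ s V]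

theorem perf_of_isAtom (A : LieIdeal ℂ s) (hA : IsAtom A) : Perf A := by
  have h1 := LieAlgebra.IsSemisimple.non_abelian_of_isAtom A hA
  have h2 := lie_eq_self_of_isAtom_of_nonabelian A hA h1
  intro p hp x
  have hx : (x : s) ∈ (⁅A, A⁆ : LieIdeal ℂ s) := by rw [h2]; exact x.2
  rw [← LieSubmodule.mem_toSubmodule, LieSubmodule.lieIdeal_oper_eq_linear_span'] at hx
  have hle : Submodule.span ℂ {m : s | ∃ x ∈ A, ∃ n ∈ A, ⁅x, n⁆ = m} ≤
      p.map A.toSubmodule.subtype := by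
    rw [Submodule.span_le]
    rintro _ ⟨x, hx, y, hy, rfl⟩
    exact ⟨_, hp ⟨x, hx⟩ ⟨y, hy⟩, rfl⟩
  obtain ⟨y, hy, hyx⟩ := hle hx
  have : y = x := Subtype.ext hyx
  exact this ▸ hy

theorem restrict_nondeg (A : LieIdeal ℂ s) (hA : IsAtom A)
    (hne : ∃ a ∈ A, ∃ v : V, ⁅a, v⁆ ≠ 0) (a : A)
    (ha : ∀ b : A, LieModule.traceForm ℂ s V a b = 0) : a = 0 := by
  let J : LieIdeal ℂ s :=
    { carrier := {x | x ∈ A ∧ ∀ b : A, LieModule.traceForm ℂ s V x b = 0}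
      zero_mem' := ⟨A.zero_mem, fun b => by simp⟩
      add_mem' := fun {x y} hx hy => ⟨A.add_mem hx.1 hy.1, fun b => by
        simp [hx.2 b, hy.2 b]⟩
      smul_mem' := fun c x hx => ⟨A.smul_mem c hx.1, fun b => by simp [hx.2 b]⟩
      lie_mem := fun {x y} hy => ⟨A.lie_mem hy.1, fun b => by
        rw [← lie_skew, map_neg, LinearMap.neg_apply, LieModule.traceForm_apply_lie_apply]
        have := hy.2 ⁅x, b⁆
        simpa using this⟩ }
  have hJA : J ≤ A := fun x hx => hx.1
  rcases hA.le_iff.1 hJA with h | h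
  · have : (a : s) ∈ J := ⟨a.2, ha⟩
    rw [h] at this
    exact Subtype.ext (by simpa using this)
  · exfalso
    obtain ⟨x, hx, v, hv⟩ := hne
    apply hv
    refine trivial_of_traceForm_zero A V (perf_of_isAtom A hA) ?_ ⟨x, hx⟩ v
    ext y z
    have hy : (y : s) ∈ J := by rw [h]; exact y.2
    exact hy.2 z

theorem exists_casimir (A : LieIdeal ℂ s) (hA : IsAtom A)
    (hne : ∃ a ∈ A, ∃ v : V, ⁅a, v⁆ ≠ 0) : ∃ C : Module.End ℂ V,
    (∀ (x : s) (v : V), C ⁅x, v⁆ = ⁅x, C v⁆) ∧ (∀ v : V, (∀ x : s, ⁅x, v⁆ = 0) → C v = 0) ∧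
    (∀ v, C v ∈ LSpan s V) ∧ LinearMap.trace ℂ V C ≠ 0 := by
  let B : LinearMap.BilinForm ℂ A := (LieModule.traceForm ℂ s V).domRestrict₁₂ A.toSubmodule A.toSubmodule
  have hBa : ∀ x y : A, B x y = LieModule.traceForm ℂ s V x y := fun x y => rfl
  have hsymm : ∀ x y : A, B x y = B y x := fun x y => LieModule.traceForm_comm _ _ _ _ _
  have hnd : B.Nondegenerate := by
    constructor
    · intro x hx
      exact restrict_nondeg A hA hne x hx
    · intro x hx
      exact restrict_nondeg A hA hne x (fun b => by rw [← hBa, hsymm]; exact hx b)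
  let b := Module.finBasis ℂ A
  let b' := B.dualBasis hnd b
  have hb' : ∀ i j, B (b' i) (b j) = if j = i then 1 else 0 := fun i j =>
    LinearMap.BilinForm.apply_dualBasis_left hnd b i j
  have e1 : ∀ y : A, y = ∑ j, B y (b j) • b' j := by
    intro y
    conv_lhs => rw [← b'.sum_repr y]
    refine Finset.sum_congr rfl fun j _ => ?_
    rw [LinearMap.BilinForm.dualBasis_repr_apply]
  have e2 : ∀ y : A, y = ∑ j, B (b' j) y • b j := by
    intro y
    conv_lhs => rw [← b.sum_repr y]
    refine Finset.sum_congr rfl fun j _ => ?_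
    congr 1
    have : B (b' j) (∑ i, b.repr y i • b i) = b.repr y j := by
      simp only [map_sum, map_smul, hb', smul_eq_mul, mul_ite, mul_one, mul_zero,
        Finset.sum_ite_eq', Finset.mem_univ, if_true]
    rw [b.sum_repr] at this
    exact this.symm
  have hinv : ∀ (x : s) (y z : A), B ⁅x, y⁆ z = - B y ⁅x, z⁆ := by
    intro x y z
    rw [hBa, hBa, LieSubmodule.coe_bracket, LieSubmodule.coe_bracket, ← lie_skew, map_neg,
      LinearMap.neg_apply, LieModule.traceForm_apply_lie_apply]
  let ρ : s →ₗ[ℂ] Module.End ℂ V := (LieModule.toEnd ℂ s V : s →ₗ[ℂ] Module.End ℂ V)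
  let C : Module.End ℂ V := ∑ i, ρ (b i) * ρ (b' i)
  have hC : ∀ v, C v = ∑ i, ⁅(b i : s), ⁅(b' i : s), v⁆⁆ := by
    intro v
    simp [C, ρ, LinearMap.sum_apply]
  refine ⟨C, ?_, ?_, ?_, ?_⟩
  · intro x v
    have f1 : ∀ i, ⁅⁅x, (b i : s)⁆, ⁅(b' i : s), v⁆⁆ =
        ∑ j, B (b' j) ⁅x, b i⁆ • ⁅(b j : s), ⁅(b' i : s), v⁆⁆ := by
      intro i
      rw [← LieSubmodule.coe_bracket]
      conv_lhs => rw [e2 ⁅x, b i⁆]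
      simp [sum_lie]
    have f2 : ∀ i, ⁅(b i : s), ⁅⁅x, (b' i : s)⁆, v⁆⁆ =
        - ∑ j, B (b' i) ⁅x, b j⁆ • ⁅(b i : s), ⁅(b' j : s), v⁆⁆ := by
      intro i
      rw [← LieSubmodule.coe_bracket]
      conv_lhs => rw [e1 ⁅x, b' i⁆]
      simp [sum_lie, lie_sum, hinv]
    have f3 : ∀ i, ⁅x, ⁅(b i : s), ⁅(b' i : s), v⁆⁆⁆ = ⁅⁅x, (b i : s)⁆, ⁅(b' i : s), v⁆⁆ +
      ⁅(b i : s), ⁅⁅x, (b' i : s)⁆, v⁆⁆ + ⁅(b i : s), ⁅(b' i : s), ⁅x, v⁆⁆⁆ := by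
      intro i
      rw [leibniz_lie x (b i : s), leibniz_lie x (b' i : s), lie_add, add_assoc]
    rw [hC, hC, lie_sum]
    simp only [f3, f1, f2, Finset.sum_add_distrib, Finset.sum_neg_distrib]
    rw [Finset.sum_comm, add_neg_cancel, zero_add]
  · intro v hv
    rw [hC]
    exact Finset.sum_eq_zero fun i _ => by rw [hv, lie_zero]
  · intro v
    rw [hC]
    exact Submodule.sum_mem _ fun i _ => Submodule.subset_span ⟨_, _, rfl⟩
  · have : LinearMap.trace ℂ V C = Module.finrank ℂ A := by
      have : ∀ i, LinearMap.trace ℂ V (ρ (b i) * ρ (b' i)) = 1 := by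
        intro i
        have h1 := hb' i i
        rw [hsymm, hBa, LieModule.traceForm_apply_apply] at h1
        rw [if_pos rfl] at h1
        exact h1
      simp [C, map_sum, this]
    rw [this]
    have hA0 : (A : LieIdeal ℂ s) ≠ ⊥ := hA.1
    intro h0
    apply hA0
    have h0' : Module.finrank ℂ A = 0 := by exact_mod_cast h0
    have := Module.finrank_zero_iff.1 h0'
    rw [LieSubmodule.eq_bot_iff]
    intro x hx
    have := Subsingleton.elim (⟨x, hx⟩ : A) 0
    exact congrArg Subtype.val this

end
end SDS

namespace SDS

theorem weyl_aux (s : Type*) [LieRing s] [LieAlgebra ℂ s] [Module.Finite ℂ s]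
    [LieAlgebra.IsKilling ℂ s] (n : ℕ) :
    ∀ (V : Type*) [AddCommGroup V] [Module ℂ V] [Module.Finite ℂ V] [LieRingModule s V]
      [LieModule ℂ s V], Module.finrank ℂ V = n →
      (∀ v : V, (∀ x : s, ⁅x, v⁆ = 0) → v ∈ LSpan s V → v = 0) ∧
      (∀ v : V, ∃ a b : V, v = a + b ∧ (∀ x : s, ⁅x, a⁆ = 0) ∧ b ∈ LSpan s V) := by
  induction n using Nat.strong_induction_on with
  | _ n ih =>
  intro V _ _ _ _ _ hn
  by_cases htriv : ∀ A : LieIdeal ℂ s, IsAtom A → ∀ a ∈ A, ∀ v : V, ⁅a, v⁆ = 0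
  · -- the action is trivial
    have hall : ∀ (x : s) (v : V), ⁅x, v⁆ = 0 := by
      let Kr : LieIdeal ℂ s :=
        { carrier := {x | ∀ v : V, ⁅x, v⁆ = 0}
          zero_mem' := fun v => zero_lie v
          add_mem' := fun {x y} hx hy v => by rw [add_lie, hx v, hy v, add_zero]
          smul_mem' := fun c x hx v => by rw [smul_lie, hx v, smul_zero]
          lie_mem := fun {x y} hy v => by rw [lie_lie, hy, hy, lie_zero, sub_zero] }
      have hle : (⊤ : LieIdeal ℂ s) ≤ Kr := by
        rw [← LieAlgebra.IsSemisimple.sSup_atoms_eq_top (R := ℂ) (L := s)]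
        apply sSup_le
        intro A hA a ha
        exact htriv A hA a ha
      intro x v
      exact hle (LieSubmodule.mem_top x) v
    have hs : LSpan s V = ⊥ := by
      rw [LSpan, Submodule.span_eq_bot]
      rintro _ ⟨x, v, rfl⟩
      exact hall x v
    refine ⟨fun v _ hv => ?_, fun v => ⟨v, 0, by simp, fun x => hall x v, Submodule.zero_mem _⟩⟩
    rw [hs] at hv
    simpa using hv
  · push Not at htriv
    obtain ⟨A, hA, hne⟩ := htriv
    obtain ⟨C, hC1, hC2, hC3, hC4⟩ := exists_casimir A hA hne
    obtain ⟨N, hN⟩ := Filter.eventually_atTop.1 (LinearMap.eventually_isCompl_ker_pow_range_pow C)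
    have hcompl := hN (N + 1) (Nat.le_succ N)
    have hpow : ∀ (k : ℕ) (x : s) (v : V), (C ^ k) ⁅x, v⁆ = ⁅x, (C ^ k) v⁆ := by
      intro k
      induction k with
      | zero => intro x v; simp
      | succ k ihk => intro x v; rw [pow_succ', Module.End.mul_apply, ihk, hC1]; rfl
    let K : LieSubmodule ℂ s V :=
      { (LinearMap.ker (C ^ (N + 1))) with
        lie_mem := fun {x v} hv => by
          have hv' : (C ^ (N + 1)) v = 0 := hv
          show (C ^ (N + 1)) ⁅x, v⁆ = 0
          rw [hpow, hv', lie_zero] }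
    have hK : ∀ v, v ∈ K ↔ (C ^ (N + 1)) v = 0 := fun v => Iff.rfl
    have hKlt : Module.finrank ℂ K < n := by
      rw [← hn]
      have hne : LinearMap.ker (C ^ (N + 1)) ≠ ⊤ := by
        intro h
        have h0 : C ^ (N + 1) = 0 := LinearMap.ker_eq_top.1 h
        have := LinearMap.isNilpotent_trace_of_isNilpotent (R := ℂ) (M := V) ⟨N + 1, h0⟩
        exact hC4 this.eq_zero
      exact Submodule.finrank_lt hne
    have ihK := ih _ hKlt K rfl
    have hsub : ∀ v : K, v ∈ LSpan s K → (v : V) ∈ LSpan s V := by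
      intro v hv
      have : LSpan s K ≤ (LSpan s V).comap K.toSubmodule.subtype := by
        rw [LSpan, Submodule.span_le]
        rintro _ ⟨x, v, rfl⟩
        exact Submodule.subset_span ⟨x, v, rfl⟩
      exact this hv
    -- projection to `K`
    let pr := LinearMap.ker (C ^ (N + 1)) |>.projectionOnto _ hcompl
    refine ⟨fun v hv hvs => ?_, fun v => ?_⟩
    · have hvK : v ∈ K := by
        rw [hK, pow_succ, Module.End.mul_apply, hC2 v hv, map_zero]
      have hpeq : ∀ (x : s) (w : V), (pr ⁅x, w⁆ : V) = ⁅x, (pr w : V)⁆ := by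
        intro x w
        obtain ⟨a, ha, b, hb, rfl⟩ : ∃ a ∈ LinearMap.ker (C ^ (N + 1)),
          ∃ b ∈ LinearMap.range (C ^ (N + 1)), a + b = w :=
          Submodule.mem_sup.1 (by rw [hcompl.sup_eq_top]; exact Submodule.mem_top)
        have hxa : ⁅x, a⁆ ∈ LinearMap.ker (C ^ (N + 1)) := K.lie_mem ha
        have hxb : ⁅x, b⁆ ∈ LinearMap.range (C ^ (N + 1)) := by
          obtain ⟨c, rfl⟩ := hb
          exact ⟨⁅x, c⁆, hpow _ _ _⟩
        rw [lie_add, map_add, map_add]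
        simp only [pr]
        rw [Submodule.projectionOnto_apply_of_mem_left hcompl ha,
          Submodule.projectionOnto_apply_of_mem_left hcompl hxa,
          (Submodule.projectionOnto_apply_eq_zero_iff hcompl).2 hb,
          (Submodule.projectionOnto_apply_eq_zero_iff hcompl).2 hxb, add_zero, add_zero]
      have hmap : ∀ w ∈ LSpan s V, (pr w : K) ∈ LSpan s K := by
        intro w hw
        have : LSpan s V ≤ (LSpan s K).comap pr := by
          rw [LSpan, Submodule.span_le]
          rintro _ ⟨x, v, rfl⟩
          refine Submodule.subset_span ⟨x, pr v, ?_⟩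
          exact Subtype.ext (hpeq x v).symm
        exact this hw
      have h1 := hmap v hvs
      have h2 : (pr v : K) = ⟨v, hvK⟩ :=
        Submodule.projectionOnto_apply_left hcompl ⟨v, hvK⟩
      rw [h2] at h1
      have h3 := ihK.1 ⟨v, hvK⟩ (fun x => Subtype.ext (hv x)) h1
      exact congrArg Subtype.val h3
    · obtain ⟨a, ha, b, hb, rfl⟩ : ∃ a ∈ LinearMap.ker (C ^ (N + 1)),
        ∃ b ∈ LinearMap.range (C ^ (N + 1)), a + b = v :=
        Submodule.mem_sup.1 (by rw [hcompl.sup_eq_top]; exact Submodule.mem_top)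
      obtain ⟨a1, a2, h12, ha1, ha2⟩ := ihK.2 ⟨a, ha⟩
      refine ⟨a1, a2 + b, ?_, fun x => congrArg Subtype.val (ha1 x), ?_⟩
      · rw [← add_assoc]
        congr 1
        exact congrArg Subtype.val h12
      · refine Submodule.add_mem _ (hsub _ ha2) ?_
        obtain ⟨w, rfl⟩ := hb
        rw [pow_succ', Module.End.mul_apply]
        exact hC3 _

/-- A linear map `s → End V` compatible with brackets. -/
def IsRep {s V : Type*} [LieRing s] [LieAlgebra ℂ s] [AddCommGroup V] [Module ℂ V]
    (ρ : s →ₗ[ℂ] V →ₗ[ℂ] V) : Prop :=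
  ∀ x y v, ρ ⁅x, y⁆ v = ρ x (ρ y v) - ρ y (ρ x v)

/-- The Lie module structure attached to a representation. -/
abbrev IsRep.lieRingModule {s V : Type*} [LieRing s] [LieAlgebra ℂ s] [AddCommGroup V] [Module ℂ V]
    {ρ : s →ₗ[ℂ] V →ₗ[ℂ] V} (h : IsRep ρ) : LieRingModule s V where
  bracket x v := ρ x v
  add_lie x y v := by show ρ (x + y) v = ρ x v + ρ y v; simp
  lie_add x v w := by show ρ x (v + w) = ρ x v + ρ x w; simp
  leibniz_lie x y v := by
    show ρ x (ρ y v) = ρ ⁅x, y⁆ v + ρ y (ρ x v)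
    rw [h]; simp

theorem IsRep.lieModule {s V : Type*} [LieRing s] [LieAlgebra ℂ s] [AddCommGroup V] [Module ℂ V]
    {ρ : s →ₗ[ℂ] V →ₗ[ℂ] V} (h : IsRep ρ) :
    letI := h.lieRingModule
    LieModule ℂ s V := by
  letI := h.lieRingModule
  exact {
    smul_lie := fun c x v => by show ρ (c • x) v = c • ρ x v; simp
    lie_smul := fun c x v => by show ρ x (c • v) = c • ρ x v; simp }

/-- The span of `ρ x u` for `u ∈ U`. -/
def RSpan {s V : Type*} [LieRing s] [LieAlgebra ℂ s] [AddCommGroup V] [Module ℂ V]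
    (ρ : s →ₗ[ℂ] V →ₗ[ℂ] V) (U : Submodule ℂ V) : Submodule ℂ V :=
  Submodule.span ℂ {m | ∃ (x : s), ∃ u ∈ U, ρ x u = m}

section
variable {s V : Type*} [LieRing s] [LieAlgebra ℂ s] [Module.Finite ℂ s]
    [LieAlgebra.IsKilling ℂ s]
    [AddCommGroup V] [Module ℂ V] [Module.Finite ℂ V]

theorem weyl_inter {ρ : s →ₗ[ℂ] V →ₗ[ℂ] V} (h : IsRep ρ) (v : V) (hv : ∀ x, ρ x v = 0)
    (hvs : v ∈ RSpan ρ ⊤) : v = 0 := by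
  letI := h.lieRingModule
  haveI := h.lieModule
  refine (weyl_aux s _ V rfl).1 v hv ?_
  refine Submodule.span_mono ?_ hvs
  rintro _ ⟨x, u, -, rfl⟩
  exact ⟨x, u, rfl⟩

theorem weyl_sum {ρ : s →ₗ[ℂ] V →ₗ[ℂ] V} (h : IsRep ρ) (U : Submodule ℂ V)
    (hU : ∀ x, ∀ u ∈ U, ρ x u ∈ U) (v : V) (hv : v ∈ U) :
    ∃ a b, v = a + b ∧ a ∈ U ∧ (∀ x, ρ x a = 0) ∧ b ∈ RSpan ρ U := by
  letI := h.lieRingModule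
  haveI := h.lieModule
  let K : LieSubmodule ℂ s V := { U with lie_mem := fun {x v} hv => hU x v hv }
  obtain ⟨a, b, h1, h2, h3⟩ := (weyl_aux s _ K rfl).2 ⟨v, hv⟩
  refine ⟨a, b, congrArg Subtype.val h1, a.2, fun x => congrArg Subtype.val (h2 x), ?_⟩
  have : LSpan s K ≤ (RSpan ρ U).comap K.toSubmodule.subtype := by
    rw [LSpan, Submodule.span_le]
    rintro _ ⟨x, v, rfl⟩
    exact Submodule.subset_span ⟨x, v, v.2, rfl⟩
  exact this h3

theorem RSpan_le {ρ : s →ₗ[ℂ] V →ₗ[ℂ] V} (U : Submodule ℂ V)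
    (hU : ∀ x, ∀ u ∈ U, ρ x u ∈ U) : RSpan ρ U ≤ U := by
  rw [RSpan, Submodule.span_le]
  rintro _ ⟨x, u, hu, rfl⟩
  exact hU x u hu

end

end SDS

namespace SDS

section
variable {L : Type*} [LieRing L] [LieAlgebra ℂ L]

/-- The adjoint action as a bilinear map. -/
def adm (L : Type*) [LieRing L] [LieAlgebra ℂ L] : L →ₗ[ℂ] L →ₗ[ℂ] L :=
  LinearMap.mk₂ ℂ (fun x y => ⁅x, y⁆) add_lie smul_lie lie_add (fun c x y => lie_smul c x y)

@[simp] theorem adm_apply (x y : L) : adm L x y = ⁅x, y⁆ := rfl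

theorem adm_isRep : IsRep (adm L) := fun x y z => lie_lie x y z

/-- A decomposition `L = s₁ ∔ s₂` with its projections. -/
structure Dec (s₁ s₂ : LieSubalgebra ℂ L) (P Q : L →ₗ[ℂ] L) : Prop where
  add : ∀ x, P x + Q x = x
  memP : ∀ x, P x ∈ s₁
  memQ : ∀ x, Q x ∈ s₂
  P1 : ∀ x ∈ s₁, P x = x
  P2 : ∀ x ∈ s₂, P x = 0

namespace Dec
variable {s₁ s₂ : LieSubalgebra ℂ L} {P Q : L →ₗ[ℂ] L}

theorem Q1 (d : Dec s₁ s₂ P Q) (x : L) (hx : x ∈ s₁) : Q x = 0 := by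
  have := d.add x
  rw [d.P1 x hx] at this
  simpa using this

theorem Q2 (d : Dec s₁ s₂ P Q) (x : L) (hx : x ∈ s₂) : Q x = x := by
  have := d.add x
  rwa [d.P2 x hx, zero_add] at this

theorem symm (d : Dec s₁ s₂ P Q) : Dec s₂ s₁ Q P :=
  ⟨fun x => by rw [add_comm]; exact d.add x, d.memQ, d.memP, d.Q2, d.Q1⟩

theorem perf (d : Dec s₁ s₂ P Q) (h1 : Perf s₁) (h2 : Perf s₂) : Perf L := by
  intro p hp x
  have a1 := h1 (p.comap s₁.toSubmodule.subtype) (fun x y => hp x y) ⟨P x, d.memP x⟩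
  have a2 := h2 (p.comap s₂.toSubmodule.subtype) (fun x y => hp x y) ⟨Q x, d.memQ x⟩
  rw [← d.add x]
  exact p.add_mem a1 a2

theorem trace_ad_zero (h : Perf L) [Module.Finite ℂ L] (u : L) :
    LinearMap.trace ℂ L (adm L u) = 0 := by
  refine h (LinearMap.ker ((LinearMap.trace ℂ L).comp (adm L))) (fun x y => ?_) u
  have : adm L ⁅x, y⁆ = adm L x * adm L y - adm L y * adm L x := by
    ext z; simp [lie_lie]
  rw [LinearMap.mem_ker, LinearMap.comp_apply, this, map_sub, LinearMap.trace_mul_comm, sub_self]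

theorem trace_Q_aux (d : Dec s₁ s₂ P Q) [Module.Finite ℂ L] (h2 : Perf s₂) (u : L) (hu : u ∈ s₂) :
    LinearMap.trace ℂ L (adm L u * Q) = 0 := by
  refine h2 ((LinearMap.ker ((LinearMap.trace ℂ L).comp
    ((LinearMap.mulRight ℂ Q).comp (adm L)))).comap s₂.toSubmodule.subtype)
    (fun x y => ?_) ⟨u, hu⟩
  have : adm L ⁅(x : L), (y : L)⁆ * Q =
      (adm L x * Q) * (adm L y * Q) - (adm L y * Q) * (adm L x * Q) := by
    ext z
    have e1 : Q ⁅(y : L), Q z⁆ = ⁅(y : L), Q z⁆ := d.Q2 _ (s₂.lie_mem y.2 (d.memQ z))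
    have e2 : Q ⁅(x : L), Q z⁆ = ⁅(x : L), Q z⁆ := d.Q2 _ (s₂.lie_mem x.2 (d.memQ z))
    simp [lie_lie, e1, e2]
  show LinearMap.trace ℂ L (adm L ⁅(x : L), (y : L)⁆ * Q) = 0
  rw [this, map_sub, LinearMap.trace_mul_comm, sub_self]

theorem trace_Q (d : Dec s₁ s₂ P Q) [Module.Finite ℂ L] (h1 : Perf s₁) (h2 : Perf s₂) (u : L) :
    LinearMap.trace ℂ L (adm L u * Q) = 0 := by
  have hs : ∀ u, LinearMap.trace ℂ L (adm L u * P) + LinearMap.trace ℂ L (adm L u * Q) = 0 := by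
    intro u
    rw [← map_add, ← mul_add]
    have : P + Q = 1 := by ext x; simp [d.add]
    rw [this, mul_one, trace_ad_zero (d.perf h1 h2)]
  rw [← d.add u, map_add, add_mul, map_add, d.trace_Q_aux h2 (Q u) (d.memQ u), add_zero]
  have := hs (P u)
  rwa [d.symm.trace_Q_aux h1 (P u) (d.memP u), zero_add] at this

end Dec

theorem exists_dec (s₁ s₂ : LieSubalgebra ℂ L)
    (hsum : s₁.toSubmodule ⊔ s₂.toSubmodule = ⊤) (hdisj : s₁.toSubmodule ⊓ s₂.toSubmodule = ⊥) :
    ∃ P Q : L →ₗ[ℂ] L, Dec s₁ s₂ P Q := by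
  have hc : IsCompl s₁.toSubmodule s₂.toSubmodule :=
    ⟨disjoint_iff.2 hdisj, codisjoint_iff.2 hsum⟩
  refine ⟨s₁.toSubmodule.projection _ hc, s₂.toSubmodule.projection _ hc.symm,
    fun x => Submodule.projection_add_projection_eq_self hc x,
    fun x => Submodule.projection_apply_mem hc x,
    fun x => Submodule.projection_apply_mem hc.symm x,
    fun x hx => Submodule.projection_apply_of_mem_left hc hx,
    fun x hx => (Submodule.projection_apply_eq_zero_iff hc).2 hx⟩

end
end SDS

namespace SDS

section
variable {L : Type*} [LieRing L] [LieAlgebra ℂ L]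

theorem exists_exp (v : L) (m : ℕ) (hm : (adm L v : Module.End ℂ L) ^ m = 0) :
    ∃ θ : ℂ → Module.End ℂ L,
      (∀ t, θ t = ∑ k ∈ Finset.range m, t ^ k • ((k.factorial : ℂ)⁻¹ • (adm L v : Module.End ℂ L) ^ k)) ∧
      (∀ s t, θ (s + t) = θ s * θ t) ∧ (∀ t x y, θ t ⁅x, y⁆ = ⁅θ t x, θ t y⁆) := by
  let M : Module ℚ L := Module.compHom L (algebraMap ℚ ℂ)
  have hsm : ∀ (q : ℚ) (x : L), q • x = (q : ℂ) • x := fun q x => rfl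
  let I : LieAlgebra ℚ L :=
    { M with
      lie_smul := fun q x y => by
        show ⁅x, (q : ℂ) • y⁆ = (q : ℂ) • ⁅x, y⁆
        exact lie_smul _ _ _ }
  have hN : ∀ t : ℂ, (t • (adm L v : Module.End ℂ L)) ^ m = 0 := fun t => by
    rw [smul_pow, hm, smul_zero]
  let D : ℂ → LieDerivation ℂ L L := fun t =>
    { toLinearMap := t • adm L v
      leibniz' := fun a b => by
        simp only [LinearMap.smul_apply, adm_apply]
        rw [leibniz_lie v a b, lie_smul, lie_smul, smul_add, ← lie_skew ⁅v, a⁆ b, smul_neg,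
          sub_eq_add_neg, add_comm] }
  have hD : ∀ t, IsNilpotent (D t).toLinearMap := fun t => ⟨m, hN t⟩
  refine ⟨fun t => IsNilpotent.exp (t • (adm L v : Module.End ℂ L)), fun t => ?_, fun s t => ?_,
    fun t x y => ?_⟩
  · show IsNilpotent.exp (t • (adm L v : Module.End ℂ L)) = _
    rw [IsNilpotent.exp_eq_sum (hN t)]
    refine Finset.sum_congr rfl fun k _ => ?_
    ext x
    simp only [smul_pow, LinearMap.smul_apply]
    rw [hsm]
    simp only [smul_smul]
    congr 1
    push_cast
    ring
  · simp only []
    rw [add_smul, IsNilpotent.exp_add_of_commute _ ⟨m, hN s⟩ ⟨m, hN t⟩]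
    exact ((Commute.refl _).smul_left _).smul_right _
  · exact (LieDerivation.exp (D t) (hD t)).map_lie x y

theorem det_poly {V : Type*} [AddCommGroup V] [Module ℂ V] [Module.Finite ℂ V]
    (E : ℕ → Module.End ℂ V) (m : ℕ) :
    ∃ F : Polynomial ℂ, (∀ t, F.eval t = LinearMap.det (1 + t • ∑ k ∈ Finset.range (m + 1), t ^ k • E k)) ∧
      F.eval 0 = 1 ∧ F.derivative.eval 0 = LinearMap.trace ℂ V (E 0) := by
  let b := Module.finBasis ℂ V
  let A : ℕ → Matrix _ _ ℂ := fun k => LinearMap.toMatrix b b (E k)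
  let M : Matrix (Fin (Module.finrank ℂ V)) (Fin (Module.finrank ℂ V)) (Polynomial ℂ) :=
    ∑ k ∈ Finset.range (m + 1), (Polynomial.X ^ k : Polynomial ℂ) • (A k).map Polynomial.C
  have hM : ∀ t, M.map (Polynomial.eval t) = ∑ k ∈ Finset.range (m + 1), t ^ k • A k := by
    intro t
    ext i j
    simp only [M, Matrix.map_apply, Matrix.sum_apply, Matrix.smul_apply, Polynomial.eval_finsetSum,
      smul_eq_mul, Polynomial.eval_mul, Polynomial.eval_pow, Polynomial.eval_X, Polynomial.eval_C]
  have hF : ∀ t, ((1 + (Polynomial.X : Polynomial ℂ) • M).det).eval t =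
      LinearMap.det (1 + t • ∑ k ∈ Finset.range (m + 1), t ^ k • E k) := by
    intro t
    rw [← Polynomial.coe_evalRingHom, RingHom.map_det, ← LinearMap.det_toMatrix b]
    congr 1
    have h1 : LinearMap.toMatrix b b (1 + t • ∑ k ∈ Finset.range (m + 1), t ^ k • E k) =
        1 + t • M.map (Polynomial.eval t) := by
      rw [hM, map_add, LinearMap.toMatrix_one, map_smul, map_sum]
      simp only [map_smul, A]
    rw [h1]
    ext i j
    simp [Matrix.one_apply, apply_ite (Polynomial.eval t)]
  refine ⟨(1 + (Polynomial.X : Polynomial ℂ) • M).det, hF, ?_, ?_⟩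
  · rw [hF]; simp
  · rw [Matrix.det_one_add_smul]
    have h0 : (M.trace).eval 0 = LinearMap.trace ℂ V (E 0) := by
      have h1 : (M.trace).eval 0 = (M.map (Polynomial.eval 0)).trace := by
        simp [Matrix.trace, Polynomial.eval_finsetSum]
      rw [h1, hM, LinearMap.trace_eq_matrix_trace ℂ b, Finset.sum_eq_single 0]
      · simp [A]
      · intro k _ hk; simp [hk]
      · simp
    simp [h0, Polynomial.derivative_mul]

variable {s₁ s₂ : LieSubalgebra ℂ L} {P Q : L →ₗ[ℂ] L}

theorem det_const [Module.Finite ℂ L] (d : Dec s₁ s₂ P Q) (h1 : Perf s₁) (h2 : Perf s₂) (v : L)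
    (hv : IsNilpotent (adm L v : Module.End ℂ L)) :
    ∃ θ : Module.End ℂ L, ∃ m : ℕ, (adm L v : Module.End ℂ L) ^ (m + 2) = 0 ∧
      (θ = ∑ k ∈ Finset.range (m + 2), ((k.factorial : ℂ)⁻¹ • (adm L v : Module.End ℂ L) ^ k)) ∧
      (∀ x y, θ ⁅x, y⁆ = ⁅θ x, θ y⁆) ∧ Function.Surjective θ ∧
      ∀ x : L, ∃ y z, y ∈ s₁ ∧ z ∈ s₂ ∧ y + θ z = x := by
  obtain ⟨m, hm⟩ := hv
  replace hm : (adm L v : Module.End ℂ L) ^ (m + 2) = 0 := by rw [pow_add, hm, zero_mul]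
  obtain ⟨θ, hθ, hadd, hlie⟩ := exists_exp v _ hm
  let N : ℕ → Module.End ℂ L := fun k =>
    (((k + 1).factorial : ℂ)⁻¹ • (adm L v : Module.End ℂ L) ^ (k + 1))
  have hθ1 : ∀ t, θ t = 1 + t • ∑ k ∈ Finset.range (m + 1), t ^ k • N k := by
    intro t
    rw [hθ, Finset.sum_range_succ', add_comm, Finset.smul_sum]
    congr 1
    · simp
    · refine Finset.sum_congr rfl fun k _ => ?_
      rw [smul_smul t, ← pow_succ']
  have hθ0 : θ 0 = 1 := by rw [hθ1]; simp
  -- `1 + (θ t - 1) R`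
  have hR : ∀ (R : Module.End ℂ L) (t : ℂ), 1 + (θ t - 1) * R =
      1 + t • ∑ k ∈ Finset.range (m + 1), t ^ k • (N k * R) := by
    intro R t
    rw [hθ1, add_sub_cancel_left, smul_mul_assoc, Finset.sum_mul]
    simp only [smul_mul_assoc]
  have hPQ : P + Q = 1 := by ext x; simp [d.add]
  have hD : ∀ t, P + θ t * Q = 1 + (θ t - 1) * Q := by
    intro t
    rw [sub_mul, one_mul, ← hPQ]; abel
  obtain ⟨F, hF, hF0, -⟩ := det_poly (fun k => N k * Q) m
  replace hF : ∀ t, F.eval t = LinearMap.det (P + θ t * Q) := fun t => by rw [hF, hD, hR]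
  have key : ∀ t, F.eval t ≠ 0 → F.derivative.eval t = 0 := by
    intro t ht
    rw [hF] at ht
    let D : L ≃ₗ[ℂ] L := LinearEquiv.ofIsUnitDet (f := P + θ t * Q) (v := Module.finBasis ℂ L)
      (v' := Module.finBasis ℂ L) (by
        rw [LinearMap.det_toMatrix]; exact isUnit_iff_ne_zero.2 ht)
    have hDa : ∀ x, D x = P x + θ t (Q x) := fun x => rfl
    let S : LieSubalgebra ℂ L :=
      { s₂.toSubmodule.map (θ t) with
        lie_mem' := by
          rintro _ _ ⟨x, hx, rfl⟩ ⟨y, hy, rfl⟩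
          exact ⟨⁅x, y⁆, s₂.lie_mem hx hy, hlie t x y⟩ }
    have hS : ∀ x, x ∈ S ↔ ∃ y ∈ s₂, θ t y = x := fun x => Iff.rfl
    have hSp : Perf S := by
      intro p hp x
      obtain ⟨x, y, hy, rfl⟩ := x
      let g : s₂ →ₗ[ℂ] S :=
        { toFun := fun y => ⟨θ t y, ⟨y, y.2, rfl⟩⟩
          map_add' := fun a b => Subtype.ext (by simp)
          map_smul' := fun a b => Subtype.ext (by simp) }
      refine h2 (p.comap g) (fun a b => ?_) ⟨y, hy⟩
      have hg : g ⁅a, b⁆ = ⁅g a, g b⁆ := Subtype.ext (hlie t a b)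
      rw [Submodule.mem_comap, hg]
      exact hp _ _
    have d' : Dec s₁ S (P ∘ₗ D.symm.toLinearMap) ((θ t * Q) ∘ₗ D.symm.toLinearMap) := by
      refine ⟨fun x => ?_, fun x => d.memP _, fun x => ⟨_, d.memQ (D.symm x), rfl⟩, fun x hx => ?_, ?_⟩
      · exact (hDa (D.symm x)).symm.trans (D.apply_symm_apply x)
      · have : D x = x := by rw [hDa, d.P1 x hx, d.Q1 x hx, map_zero, add_zero]
        have h' : D.symm x = x := by rw [LinearEquiv.symm_apply_eq, this]
        simp [h', d.P1 x hx]
      · rintro _ ⟨y, hy, rfl⟩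
        have : D y = θ t y := by rw [hDa, d.P2 y hy, d.Q2 y hy, zero_add]
        have h' : D.symm (θ t y) = y := by rw [LinearEquiv.symm_apply_eq, this]
        simp [h', d.P2 y hy]
    obtain ⟨G, hG, hG0, hG1⟩ := det_poly (fun k => N k * ((θ t * Q) ∘ₗ D.symm.toLinearMap)) m
    have htr := d'.trace_Q h1 hSp v
    have hN0 : N 0 = adm L v := by simp [N]
    rw [hN0, htr] at hG1
    have hFG : F.comp (Polynomial.X + Polynomial.C t) = Polynomial.C (F.eval t) * G := by
      refine Polynomial.funext fun h => ?_
      rw [Polynomial.eval_comp, Polynomial.eval_mul, Polynomial.eval_C, hF, hG, ← hR, hF, mul_comm,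
        ← LinearMap.det_comp]
      simp only [Polynomial.eval_add, Polynomial.eval_X, Polynomial.eval_C]
      congr 1
      rw [hadd]
      ext x
      have e : (θ t * Q ∘ₗ D.symm.toLinearMap) ((P + θ t * Q) x) = θ t (Q x) := by
        have : (P + θ t * Q) x = D x := rfl
        rw [this]
        simp
      have e1 : ((1 + (θ h - 1) * (θ t * Q ∘ₗ D.symm.toLinearMap)) ∘ₗ (P + θ t * Q)) x =
        (P + θ t * Q) x + (θ h - 1) ((θ t * Q ∘ₗ D.symm.toLinearMap) ((P + θ t * Q) x)) := rfl
      have e2 : (((θ t * Q) ∘ₗ D.symm.toLinearMap) : L →ₗ[ℂ] L) = θ t * Q ∘ₗ D.symm.toLinearMap := rfl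
      rw [e2, e1, e]
      simp
    have hder := congrArg (fun p => Polynomial.eval 0 (Polynomial.derivative p)) hFG
    simpa [Polynomial.derivative_comp, hG1] using hder
  have hprod : F * F.derivative = 0 := by
    refine Polynomial.funext fun t => ?_
    rw [Polynomial.eval_mul, Polynomial.eval_zero]
    by_cases h : F.eval t = 0
    · rw [h, zero_mul]
    · rw [key t h, mul_zero]
  have hFne : F ≠ 0 := by
    rintro rfl
    simp at hF0
  have hder : F.derivative = 0 := (mul_eq_zero.1 hprod).resolve_left hFne
  have hFC := Polynomial.eq_C_of_derivative_eq_zero hder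
  have hdet : LinearMap.det (P + θ 1 * Q) ≠ 0 := by
    rw [← hF, hFC, Polynomial.eval_C]
    rw [hFC, Polynomial.eval_C] at hF0
    rw [hF0]; exact one_ne_zero
  refine ⟨θ 1, m, hm, ?_, hlie 1, fun x => ⟨θ (-1) x, ?_⟩, fun x => ?_⟩
  · rw [hθ]; simp
  · rw [← Module.End.mul_apply, ← hadd, add_neg_cancel, hθ0]; rfl
  · have hsurj : Function.Surjective (P + θ 1 * Q) :=
      LinearMap.range_eq_top.1 (LinearMap.range_eq_top.2
        ((LinearMap.equivOfDetNeZero (P + θ 1 * Q) hdet).surjective))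
    obtain ⟨w, hw⟩ := hsurj x
    exact ⟨P w, Q w, d.memP w, d.memQ w, hw⟩

end
end SDS

namespace SDS

section
variable {L : Type*} [LieRing L] [LieAlgebra ℂ L] [Module.Finite ℂ L]

theorem quot_radical_trivial :
    LieAlgebra.HasTrivialRadical ℂ (L ⧸ LieAlgebra.radical ℂ L) := by
  rw [LieAlgebra.hasTrivialRadical_iff_no_abelian_ideals]
  intro J hJ
  let mk : L →ₗ⁅ℂ⁆ (L ⧸ LieAlgebra.radical ℂ L) :=
    { toLinearMap := (LieSubmodule.Quotient.mk' (LieAlgebra.radical ℂ L) : L →ₗ[ℂ] _)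
      map_lie' := fun {x y} => LieSubmodule.Quotient.mk_bracket _ x y }
  have hmk : ∀ x, mk x = 0 ↔ x ∈ LieAlgebra.radical ℂ L := fun x =>
    LieSubmodule.Quotient.mk_eq_zero'
  let J' := J.comap mk
  have h1 : LieAlgebra.derivedSeriesOfIdeal ℂ L 1 J' ≤ LieAlgebra.radical ℂ L := by
    rw [LieAlgebra.derivedSeriesOfIdeal_succ, LieAlgebra.derivedSeriesOfIdeal_zero,
      LieSubmodule.lie_le_iff]
    intro x hx y hy
    have hx' : mk x ∈ J := hx
    have hy' : mk y ∈ J := hy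
    rw [← hmk, LieHom.map_lie]
    have := hJ.trivial ⟨mk x, hx'⟩ ⟨mk y, hy'⟩
    exact congrArg Subtype.val this
  obtain ⟨k, hk⟩ := LieAlgebra.IsSolvable.solvable ℂ (LieAlgebra.radical ℂ L)
  rw [LieIdeal.derivedSeries_eq_bot_iff] at hk
  have h2 : LieAlgebra.derivedSeriesOfIdeal ℂ L (k + 1) J' = ⊥ := by
    rw [LieAlgebra.derivedSeriesOfIdeal_add, eq_bot_iff, ← hk]
    exact LieAlgebra.derivedSeriesOfIdeal_mono h1 k
  have h3 : LieAlgebra.IsSolvable J' :=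
    LieAlgebra.IsSolvable.mk (R := ℂ) ((LieIdeal.derivedSeries_eq_bot_iff J' (k + 1)).2 h2)
  have h4 := (LieAlgebra.LieIdeal.solvable_iff_le_radical ℂ L J').1 h3
  rw [LieSubmodule.eq_bot_iff]
  intro x hx
  obtain ⟨y, rfl⟩ := LieSubmodule.Quotient.surjective_mk' _ x
  have : y ∈ J' := hx
  exact (hmk y).2 (h4 this)

section
variable {V : Type*} [AddCommGroup V] [Module ℂ V] [Module.Finite ℂ V]

theorem exists_quot_rep {ρ : L →ₗ[ℂ] V →ₗ[ℂ] V} (h : IsRep ρ)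
    (h0 : ∀ x ∈ LieAlgebra.radical ℂ L, ρ x = 0) :
    ∃ σ : (L ⧸ LieAlgebra.radical ℂ L) →ₗ[ℂ] V →ₗ[ℂ] V, IsRep σ ∧
      ∀ x, σ (LieSubmodule.Quotient.mk x) = ρ x := by
  let σ : (L ⧸ LieAlgebra.radical ℂ L) →ₗ[ℂ] V →ₗ[ℂ] V :=
    Submodule.liftQ (LieAlgebra.radical ℂ L).toSubmodule ρ h0
  refine ⟨σ, ?_, fun x => rfl⟩
  intro x y v
  obtain ⟨x, rfl⟩ := LieSubmodule.Quotient.surjective_mk' _ x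
  obtain ⟨y, rfl⟩ := LieSubmodule.Quotient.surjective_mk' _ y
  exact h x y v

theorem RSpan_quot {ρ : L →ₗ[ℂ] V →ₗ[ℂ] V}
    {σ : (L ⧸ LieAlgebra.radical ℂ L) →ₗ[ℂ] V →ₗ[ℂ] V}
    (h : ∀ x, σ (LieSubmodule.Quotient.mk x) = ρ x) (U : Submodule ℂ V) :
    RSpan σ U = RSpan ρ U := by
  unfold RSpan
  congr 1
  ext m
  constructor
  · rintro ⟨x, u, hu, rfl⟩
    obtain ⟨x, rfl⟩ := LieSubmodule.Quotient.surjective_mk' _ x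
    exact ⟨x, u, hu, by rw [← h]; rfl⟩
  · rintro ⟨x, u, hu, rfl⟩
    exact ⟨_, u, hu, by rw [← h]⟩

theorem weylR_inter {ρ : L →ₗ[ℂ] V →ₗ[ℂ] V} (h : IsRep ρ)
    (h0 : ∀ x ∈ LieAlgebra.radical ℂ L, ρ x = 0) (v : V) (hv : ∀ x, ρ x v = 0)
    (hvs : v ∈ RSpan ρ ⊤) : v = 0 := by
  obtain ⟨σ, hσ, hρ⟩ := exists_quot_rep h h0
  have := quot_radical_trivial (L := L)
  rw [← RSpan_quot hρ] at hvs
  refine weyl_inter hσ v (fun x => ?_) hvs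
  obtain ⟨x, rfl⟩ := LieSubmodule.Quotient.surjective_mk' _ x
  exact (congrArg (fun f => f v) (hρ x)).trans (hv x)

theorem weylR_sum {ρ : L →ₗ[ℂ] V →ₗ[ℂ] V} (h : IsRep ρ)
    (h0 : ∀ x ∈ LieAlgebra.radical ℂ L, ρ x = 0) (U : Submodule ℂ V)
    (hU : ∀ x, ∀ u ∈ U, ρ x u ∈ U) (v : V) (hv : v ∈ U) :
    ∃ a b, v = a + b ∧ a ∈ U ∧ (∀ x, ρ x a = 0) ∧ b ∈ RSpan ρ U := by
  obtain ⟨σ, hσ, hρ⟩ := exists_quot_rep h h0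
  have := quot_radical_trivial (L := L)
  rw [← RSpan_quot hρ]
  obtain ⟨a, b, h1, h2, h3, h4⟩ := weyl_sum hσ U (fun x u hu => by
    obtain ⟨x, rfl⟩ := LieSubmodule.Quotient.surjective_mk' _ x
    have := hU x u hu
    rw [← hρ] at this
    exact this) v hv
  exact ⟨a, b, h1, h2, fun x => by rw [← hρ]; exact h3 _, h4⟩

end

/-- Lemma A. -/
theorem radical_eq_lie (h : Perf L) :
    ⁅(⊤ : LieIdeal ℂ L), LieAlgebra.radical ℂ L⁆ = LieAlgebra.radical ℂ L := by
  refine le_antisymm (LieSubmodule.lie_le_right _ _) ?_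
  set I := ⁅(⊤ : LieIdeal ℂ L), LieAlgebra.radical ℂ L⁆ with hI
  let ρ : L →ₗ[ℂ] (L ⧸ I) →ₗ[ℂ] (L ⧸ I) := (LieModule.toEnd ℂ L (L ⧸ I) : L →ₗ[ℂ] _)
  have hρ : ∀ x y : L, ρ x (LieSubmodule.Quotient.mk y : L ⧸ I) = LieSubmodule.Quotient.mk ⁅x, y⁆ :=
    fun x y => rfl
  have hrep : IsRep ρ := fun x y z => lie_lie x y z
  have h0 : ∀ x ∈ LieAlgebra.radical ℂ L, ρ x = 0 := by
    intro x hx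
    ext y
    obtain ⟨y, rfl⟩ := LieSubmodule.Quotient.surjective_mk' _ y
    refine (LieSubmodule.Quotient.mk_eq_zero' (N := I)).2 ?_
    show ⁅x, y⁆ ∈ I
    rw [← lie_skew]
    exact I.neg_mem (LieSubmodule.lie_mem_lie (LieSubmodule.mem_top _) hx)
  intro x hx
  rw [← LieSubmodule.Quotient.mk_eq_zero' (N := I)]
  refine weylR_inter hrep h0 _ (fun y => ?_) ?_
  · rw [hρ]
    exact (LieSubmodule.Quotient.mk_eq_zero' (N := I)).2
      (LieSubmodule.lie_mem_lie (LieSubmodule.mem_top _) hx)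
  · refine h ((RSpan ρ ⊤).comap (LieSubmodule.Quotient.mk' I : L →ₗ[ℂ] (L ⧸ I))) (fun a b => ?_) x
    exact Submodule.subset_span ⟨a, LieSubmodule.Quotient.mk b, trivial, rfl⟩

end
end SDS

namespace SDS

section
variable {L : Type*} [LieRing L] [LieAlgebra ℂ L] [Module.Finite ℂ L]

theorem nilp_aux (h : ⁅(⊤ : LieIdeal ℂ L), LieAlgebra.radical ℂ L⁆ = LieAlgebra.radical ℂ L)
    (x : L) (hx : x ∈ LieAlgebra.radical ℂ L) (n : ℕ) :
    ∀ (M : Type*) [AddCommGroup M] [Module ℂ M] [Module.Finite ℂ M] [LieRingModule L M]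
      [LieModule ℂ L M], Module.finrank ℂ M = n → IsNilpotent (LieModule.toEnd ℂ L M x) := by
  induction n using Nat.strong_induction_on with
  | _ n ih =>
  intro M _ _ _ _ _ hn
  rcases subsingleton_or_nontrivial M with hs | hs
  · exact ⟨1, by ext m; exact Subsingleton.elim _ _⟩
  obtain ⟨χ, hχ⟩ : ∃ χ : Module.Dual ℂ (LieAlgebra.radical ℂ L), Nontrivial (LieModule.weightSpace M χ) :=
    LieModule.exists_nontrivial_weightSpace_of_isSolvable ℂ (LieAlgebra.radical ℂ L) M
  let N : LieSubmodule ℂ L M := LieModule.weightSpaceOfIsLieTower ℂ M χ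
  replace hχ : Nontrivial N := hχ
  have hN : ∀ m ∈ N, ∀ y : LieAlgebra.radical ℂ L, ⁅(y : L), m⁆ = χ y • m := by
    intro m hm
    have : m ∈ LieModule.weightSpace M χ := hm
    rw [LieModule.mem_weightSpace] at this
    exact this
  let p : Submodule ℂ L :=
    { carrier := {x | ∀ m ∈ N, ⁅x, m⁆ = 0}
      zero_mem' := fun v _ => zero_lie v
      add_mem' := fun {x y} hx hy v hv => by rw [add_lie, hx v hv, hy v hv, add_zero]
      smul_mem' := fun c x hx v hv => by rw [smul_lie, hx v hv, smul_zero] }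
  have hp : ∀ y ∈ LieAlgebra.radical ℂ L, ∀ m ∈ N, ⁅y, m⁆ = 0 := by
    intro y hy
    rw [← h, ← LieSubmodule.mem_toSubmodule, LieSubmodule.lieIdeal_oper_eq_linear_span'] at hy
    have : Submodule.span ℂ {m : L | ∃ x ∈ (⊤ : LieIdeal ℂ L), ∃ n ∈ LieAlgebra.radical ℂ L, ⁅x, n⁆ = m} ≤ p := by
      rw [Submodule.span_le]
      rintro _ ⟨a, -, b, hb, rfl⟩ m hm
      have hab : ⁅a, b⁆ ∈ LieAlgebra.radical ℂ L := (LieAlgebra.radical ℂ L).lie_mem hb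
      have e1 : LieModule.toEnd ℂ L N ⁅a, b⁆ = χ ⟨_, hab⟩ • LinearMap.id := by
        ext m
        exact hN m m.2 ⟨_, hab⟩
      have e2 : LinearMap.trace ℂ N (LieModule.toEnd ℂ L N ⁅a, b⁆) = 0 := by simp
      rw [e1, map_smul, LinearMap.trace_id, smul_eq_mul, mul_eq_zero] at e2
      have hf : (Module.finrank ℂ N : ℂ) ≠ 0 := by
        exact_mod_cast (Module.finrank_pos (R := ℂ) (M := N)).ne'
      have e3 := e2.resolve_right hf
      have e4 := hN m hm ⟨_, hab⟩
      rw [e3, zero_smul] at e4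
      exact e4
    exact this hy
  have hlt : Module.finrank ℂ (M ⧸ N) < n := by
    have h1 := Submodule.finrank_quotient_add_finrank N.toSubmodule
    have h2 : 0 < Module.finrank ℂ N := Module.finrank_pos
    have h3 : Module.finrank ℂ (M ⧸ N) = Module.finrank ℂ (M ⧸ N.toSubmodule) := rfl
    have h4 : Module.finrank ℂ N = Module.finrank ℂ N.toSubmodule := rfl
    omega
  have hfin : Module.Finite ℂ (M ⧸ N) := inferInstanceAs (Module.Finite ℂ (M ⧸ N.toSubmodule))
  obtain ⟨k, hk⟩ := ih _ hlt (M ⧸ N) rfl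
  refine ⟨k + 1, ?_⟩
  have hmk : ∀ (k : ℕ) (m : M), (LieSubmodule.Quotient.mk ((LieModule.toEnd ℂ L M x ^ k) m) : M ⧸ N) =
      (LieModule.toEnd ℂ L (M ⧸ N) x ^ k) (LieSubmodule.Quotient.mk m) := by
    intro k
    induction k with
    | zero => intro m; rfl
    | succ k ihk => intro m; rw [pow_succ, pow_succ, Module.End.mul_apply, Module.End.mul_apply, ihk]; rfl
  ext m
  rw [pow_succ', Module.End.mul_apply]
  refine hp x hx _ ?_
  rw [← LieSubmodule.Quotient.mk_eq_zero' (N := N), hmk, hk]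
  rfl

theorem ad_nilpotent (h : Perf L) (x : L) (hx : x ∈ LieAlgebra.radical ℂ L) :
    IsNilpotent (adm L x : Module.End ℂ L) :=
  nilp_aux (radical_eq_lie h) x hx _ L rfl

end
end SDS

namespace SDS

section
variable {s V W : Type*} [LieRing s] [LieAlgebra ℂ s] [AddCommGroup V] [Module ℂ V]
  [AddCommGroup W] [Module ℂ W]

/-- The representation on `Hom(V, W)`. -/
def homRep (σ : s →ₗ[ℂ] V →ₗ[ℂ] V) (τ : s →ₗ[ℂ] W →ₗ[ℂ] W) :
    s →ₗ[ℂ] (V →ₗ[ℂ] W) →ₗ[ℂ] (V →ₗ[ℂ] W) :=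
  LinearMap.mk₂ ℂ (fun x φ => τ x ∘ₗ φ - φ ∘ₗ σ x)
    (fun x y φ => by ext v; simp; abel) (fun c x φ => by ext v; simp [smul_sub])
    (fun x φ ψ => by ext v; simp; abel) (fun c x φ => by ext v; simp [smul_sub])

@[simp] theorem homRep_apply (σ : s →ₗ[ℂ] V →ₗ[ℂ] V) (τ : s →ₗ[ℂ] W →ₗ[ℂ] W) (x : s)
    (φ : V →ₗ[ℂ] W) (v : V) : homRep σ τ x φ v = τ x (φ v) - φ (σ x v) := rfl

theorem homRep_isRep {σ : s →ₗ[ℂ] V →ₗ[ℂ] V} {τ : s →ₗ[ℂ] W →ₗ[ℂ] W} (hσ : IsRep σ) (hτ : IsRep τ) :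
    IsRep (homRep σ τ) := by
  intro x y φ
  ext v
  simp only [homRep_apply, LinearMap.sub_apply, hσ x y, hτ x y, map_sub]
  abel

/-- Restriction of a representation to a stable subspace. -/
def subRep (ρ : s →ₗ[ℂ] V →ₗ[ℂ] V) (U : Submodule ℂ V) (hU : ∀ x, ∀ u ∈ U, ρ x u ∈ U) :
    s →ₗ[ℂ] U →ₗ[ℂ] U where
  toFun x := (ρ x).restrict (hU x)
  map_add' x y := by ext u; simp
  map_smul' c x := by ext u; simp

theorem subRep_coe (ρ : s →ₗ[ℂ] V →ₗ[ℂ] V) (U : Submodule ℂ V) (hU : ∀ x, ∀ u ∈ U, ρ x u ∈ U)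
    (x : s) (u : U) : (subRep ρ U hU x u : V) = ρ x u := rfl

theorem subRep_isRep {ρ : s →ₗ[ℂ] V →ₗ[ℂ] V} (h : IsRep ρ) (U : Submodule ℂ V)
    (hU : ∀ x, ∀ u ∈ U, ρ x u ∈ U) : IsRep (subRep ρ U hU) := by
  intro x y u
  ext
  exact h x y u

/-- Quotient of a representation by a stable subspace. -/
def quotRep (ρ : s →ₗ[ℂ] V →ₗ[ℂ] V) (U : Submodule ℂ V) (hU : ∀ x, ∀ u ∈ U, ρ x u ∈ U) :
    s →ₗ[ℂ] (V ⧸ U) →ₗ[ℂ] (V ⧸ U) where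
  toFun x := U.mapQ U (ρ x) (hU x)
  map_add' x y := by ext u; simp
  map_smul' c x := by ext u; simp

theorem quotRep_mk (ρ : s →ₗ[ℂ] V →ₗ[ℂ] V) (U : Submodule ℂ V) (hU : ∀ x, ∀ u ∈ U, ρ x u ∈ U)
    (x : s) (v : V) : quotRep ρ U hU x (U.mkQ v) = U.mkQ (ρ x v) := rfl

theorem quotRep_isRep {ρ : s →ₗ[ℂ] V →ₗ[ℂ] V} (h : IsRep ρ) (U : Submodule ℂ V)
    (hU : ∀ x, ∀ u ∈ U, ρ x u ∈ U) : IsRep (quotRep ρ U hU) := by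
  intro x y u
  obtain ⟨u, rfl⟩ := U.mkQ_surjective u
  rw [quotRep_mk, quotRep_mk, quotRep_mk, quotRep_mk, quotRep_mk, h x y u, map_sub]

/-- Subquotient version of complete reducibility: if the radical maps `M` into `N ≤ M`, then every
element of `M` is the sum of an element moved into `N` and an element of `L·M + N`. -/
theorem weylR_subquot {L : Type*} [LieRing L] [LieAlgebra ℂ L] [Module.Finite ℂ L]
    [Module.Finite ℂ V] {ρ : L →ₗ[ℂ] V →ₗ[ℂ] V} (h : IsRep ρ) (M N : Submodule ℂ V)
    (hNM : N ≤ M) (hM : ∀ x, ∀ u ∈ M, ρ x u ∈ M) (hN : ∀ x, ∀ u ∈ N, ρ x u ∈ N)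
    (h0 : ∀ x ∈ LieAlgebra.radical ℂ L, ∀ u ∈ M, ρ x u ∈ N) (v : V) (hv : v ∈ M) :
    ∃ a b, v = a + b ∧ a ∈ M ∧ (∀ x, ρ x a ∈ N) ∧ b ∈ RSpan ρ M ⊔ N := by
  let N' : Submodule ℂ M := N.comap M.subtype
  have hN' : ∀ x, ∀ u ∈ N', subRep ρ M hM x u ∈ N' := fun x u hu => hN x u hu
  let σ := quotRep (subRep ρ M hM) N' hN'
  have hσ : IsRep σ := quotRep_isRep (subRep_isRep h M hM) N' hN'
  have hσ0 : ∀ x ∈ LieAlgebra.radical ℂ L, σ x = 0 := by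
    intro x hx
    ext u
    show σ x (N'.mkQ u) = 0
    rw [quotRep_mk, Submodule.mkQ_apply, Submodule.Quotient.mk_eq_zero]
    exact h0 x hx u u.2
  obtain ⟨a, b, h1, -, h3, h4⟩ := weylR_sum hσ hσ0 ⊤ (fun _ _ _ => trivial) (N'.mkQ ⟨v, hv⟩) trivial
  obtain ⟨a, rfl⟩ := N'.mkQ_surjective a
  refine ⟨a, v - a, by simp, a.2, fun x => ?_, ?_⟩
  · have := h3 x
    rw [quotRep_mk, Submodule.mkQ_apply, Submodule.Quotient.mk_eq_zero] at this
    exact this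
  · have hb : b = N'.mkQ (⟨v, hv⟩ - a) := by rw [map_sub, h1]; simp
    have hle : RSpan σ ⊤ ≤ ((RSpan ρ M ⊔ N).comap M.subtype).map N'.mkQ := by
      rw [RSpan, Submodule.span_le]
      rintro _ ⟨x, u, -, rfl⟩
      obtain ⟨u, rfl⟩ := N'.mkQ_surjective u
      refine ⟨subRep ρ M hM x u, ?_, rfl⟩
      exact Submodule.mem_sup_left (Submodule.subset_span ⟨x, u, u.2, rfl⟩)
    obtain ⟨c, hc, hcb⟩ := hle h4
    rw [hb, ← sub_eq_zero, ← map_sub, Submodule.mkQ_apply, Submodule.Quotient.mk_eq_zero] at hcb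
    have hcb' : (c : V) - (v - a) ∈ N := hcb
    have hc' : (c : V) ∈ RSpan ρ M ⊔ N := hc
    have := (RSpan ρ M ⊔ N).sub_mem hc' (Submodule.mem_sup_right hcb')
    simpa using this

end

end SDS

namespace SDS

section
variable {L : Type*} [LieRing L] [LieAlgebra ℂ L] [Module.Finite ℂ L]
  {W : Type*} [AddCommGroup W] [Module ℂ W] [Module.Finite ℂ W]

theorem exists_phi (π : L →ₗ[ℂ] W) (τ : L →ₗ[ℂ] W →ₗ[ℂ] W) (hτ : IsRep τ)
    (hπ : ∀ x y, π ⁅x, y⁆ = τ x (π y))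
    (hr : ∀ x ∈ LieAlgebra.radical ℂ L, ∀ y ∈ LieAlgebra.radical ℂ L, π ⁅x, y⁆ = 0) :
    ∃ φ : L →ₗ[ℂ] W, (∀ y, ∃ r ∈ LieAlgebra.radical ℂ L, φ y = π r) ∧
      (∀ y ∈ LieAlgebra.radical ℂ L, φ y = π y) ∧
      ∀ x, ∃ v ∈ LieAlgebra.radical ℂ L, ∀ y, τ x (φ y) - φ ⁅x, y⁆ = π ⁅v, y⁆ := by
  set r := LieAlgebra.radical ℂ L with hrdef
  let ρ := homRep (adm L) τ
  have hρ : IsRep ρ := homRep_isRep adm_isRep hτ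
  let M : Submodule ℂ (L →ₗ[ℂ] W) :=
    { carrier := {φ | (∀ y, ∃ z ∈ r, φ y = π z) ∧ ∃ c : ℂ, ∀ y ∈ r, φ y = c • π y}
      zero_mem' := ⟨fun y => ⟨0, r.zero_mem, by simp⟩, 0, by simp⟩
      add_mem' := by
        rintro φ ψ ⟨h1, c, hc⟩ ⟨h2, e, he⟩
        refine ⟨fun y => ?_, c + e, fun y hy => ?_⟩
        · obtain ⟨z, hz, e1⟩ := h1 y
          obtain ⟨w, hw, e2⟩ := h2 y
          exact ⟨z + w, r.add_mem hz hw, by simp [e1, e2]⟩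
        · simp [hc y hy, he y hy, add_smul]
      smul_mem' := by
        rintro k φ ⟨h1, c, hc⟩
        refine ⟨fun y => ?_, k * c, fun y hy => ?_⟩
        · obtain ⟨z, hz, e1⟩ := h1 y
          exact ⟨k • z, r.smul_mem k hz, by simp [e1]⟩
        · simp [hc y hy, mul_smul] }
  let N : Submodule ℂ (L →ₗ[ℂ] W) :=
    { carrier := {φ | ∃ v ∈ r, ∀ y, φ y = π ⁅v, y⁆}
      zero_mem' := ⟨0, r.zero_mem, by simp⟩
      add_mem' := by
        rintro φ ψ ⟨v, hv, h1⟩ ⟨w, hw, h2⟩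
        exact ⟨v + w, r.add_mem hv hw, by simp [h1, h2]⟩
      smul_mem' := by
        rintro k φ ⟨v, hv, h1⟩
        exact ⟨k • v, r.smul_mem k hv, by simp [h1]⟩ }
  have hlr : ∀ x ∈ r, ∀ y, ⁅x, y⁆ ∈ r := by
    intro x hx y
    rw [← lie_skew]
    exact r.neg_mem (r.lie_mem hx)
  have hNM : N ≤ M := by
    rintro φ ⟨v, hv, h⟩
    refine ⟨fun y => ⟨⁅v, y⁆, hlr v hv y, h y⟩, 0, fun y hy => ?_⟩
    rw [h, hr v hv y hy, zero_smul]
  have hM0 : ∀ x, ∀ u ∈ M, ρ x u ∈ M ∧ ∀ y ∈ r, ρ x u y = 0 := by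
    rintro x u ⟨h1, c, hc⟩
    have h0 : ∀ y ∈ r, ρ x u y = 0 := by
      intro y hy
      show τ x (u y) - u ⁅x, y⁆ = 0
      rw [hc y hy, hc _ (r.lie_mem hy), map_smul, hπ, sub_self]
    refine ⟨⟨fun y => ?_, 0, fun y hy => by rw [h0 y hy, zero_smul]⟩, h0⟩
    obtain ⟨z, hz, e1⟩ := h1 y
    obtain ⟨w, hw, e2⟩ := h1 ⁅x, y⁆
    refine ⟨⁅x, z⁆ - w, r.sub_mem (r.lie_mem hz) hw, ?_⟩
    show τ x (u y) - u ⁅x, y⁆ = _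
    rw [e1, e2, map_sub, hπ]
  have hN : ∀ x, ∀ u ∈ N, ρ x u ∈ N := by
    rintro x u ⟨v, hv, h⟩
    refine ⟨⁅x, v⁆, r.lie_mem hv, fun y => ?_⟩
    show τ x (u y) - u ⁅x, y⁆ = _
    rw [h, h, ← hπ, lie_lie, map_sub]
  have hrM : ∀ x ∈ r, ∀ u ∈ M, ρ x u ∈ N := by
    rintro x hx u ⟨h1, c, hc⟩
    refine ⟨-(c • x), r.neg_mem (r.smul_mem c hx), fun y => ?_⟩
    show τ x (u y) - u ⁅x, y⁆ = _
    obtain ⟨z, hz, e1⟩ := h1 y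
    rw [e1, ← hπ, hr x hx z hz, hc _ (hlr x hx y)]
    simp
  obtain ⟨p, hp⟩ := r.toSubmodule.exists_isCompl
  let φ0 : L →ₗ[ℂ] W := π ∘ₗ r.toSubmodule.subtype ∘ₗ Submodule.projectionOnto _ _ hp
  have hφ0 : ∀ y ∈ r, φ0 y = π y := by
    intro y hy
    have : Submodule.projectionOnto _ _ hp y = ⟨y, hy⟩ :=
      Submodule.projectionOnto_apply_left hp ⟨y, hy⟩
    show π (Submodule.projectionOnto _ _ hp y : L) = _
    rw [this]
  have hφ0M : φ0 ∈ M := ⟨fun y => ⟨_, (Submodule.projectionOnto _ _ hp y).2, rfl⟩, 1,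
    fun y hy => by rw [hφ0 y hy, one_smul]⟩
  obtain ⟨a, b, h1, h2, h3, h4⟩ := weylR_subquot hρ M N hNM (fun x u hu => (hM0 x u hu).1) hN hrM φ0 hφ0M
  refine ⟨a, h2.1, fun y hy => ?_, h3⟩
  let Z : Submodule ℂ (L →ₗ[ℂ] W) :=
    { carrier := {φ | ∀ y ∈ r, φ y = 0}
      zero_mem' := by simp
      add_mem' := by
        intro φ ψ h1 h2 y hy
        simp [h1 y hy, h2 y hy]
      smul_mem' := by
        intro k φ h1 y hy
        simp [h1 y hy] }
  have hb : b ∈ Z := by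
    have : RSpan ρ M ⊔ N ≤ Z := by
      refine sup_le ?_ ?_
      · rw [RSpan, Submodule.span_le]
        rintro _ ⟨x, u, hu, rfl⟩
        exact (hM0 x u hu).2
      · rintro φ ⟨v, hv, h⟩ y hy
        rw [h, hr v hv y hy]
    exact this h4
  have := hφ0 y hy
  rw [h1, LinearMap.add_apply, hb y hy, add_zero] at this
  exact this

theorem exists_vs (π : L →ₗ[ℂ] W) (τ : L →ₗ[ℂ] W →ₗ[ℂ] W) (hτ : IsRep τ)
    (hπ : ∀ x y, π ⁅x, y⁆ = τ x (π y)) (φ : L →ₗ[ℂ] W)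
    (hφ : ∀ x, ∃ v ∈ LieAlgebra.radical ℂ L, ∀ y, τ x (φ y) - φ ⁅x, y⁆ = π ⁅v, y⁆)
    (s : LieSubalgebra ℂ L) [LieAlgebra.IsKilling ℂ s] :
    ∃ v ∈ LieAlgebra.radical ℂ L, ∀ x ∈ s, ∀ y,
      τ x (φ y + π ⁅v, y⁆) = φ ⁅x, y⁆ + π ⁅v, ⁅x, y⁆⁆ := by
  set r := LieAlgebra.radical ℂ L with hrdef
  let ρ := (homRep (adm L) τ) ∘ₗ s.toSubmodule.subtype
  have hρ : IsRep (s := s) ρ := fun x y v => homRep_isRep adm_isRep hτ x y v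
  let N : Submodule ℂ (L →ₗ[ℂ] W) :=
    { carrier := {φ | ∃ v ∈ r, ∀ y, φ y = π ⁅v, y⁆}
      zero_mem' := ⟨0, r.zero_mem, by simp⟩
      add_mem' := by
        rintro φ ψ ⟨v, hv, h1⟩ ⟨w, hw, h2⟩
        exact ⟨v + w, r.add_mem hv hw, by simp [h1, h2]⟩
      smul_mem' := by
        rintro k φ ⟨v, hv, h1⟩
        exact ⟨k • v, r.smul_mem k hv, by simp [h1]⟩ }
  have hN : ∀ x, ∀ u ∈ N, ρ x u ∈ N := by
    rintro x u ⟨v, hv, h⟩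
    refine ⟨⁅(x : L), v⁆, r.lie_mem hv, fun y => ?_⟩
    show τ x (u y) - u ⁅(x : L), y⁆ = _
    rw [h, h, ← hπ, lie_lie, map_sub]
  have hU : ∀ x, ∀ u ∈ (ℂ ∙ φ) ⊔ N, ρ x u ∈ N := by
    intro x u hu
    obtain ⟨a, ha, b, hb, rfl⟩ := Submodule.mem_sup.1 hu
    obtain ⟨c, rfl⟩ := Submodule.mem_span_singleton.1 ha
    rw [map_add, map_smul]
    refine N.add_mem (N.smul_mem _ ?_) (hN x b hb)
    exact hφ x
  obtain ⟨a, b, h1, -, h3, h4⟩ := weyl_sum (s := s) hρ ((ℂ ∙ φ) ⊔ N)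
    (fun x u hu => Submodule.mem_sup_right (hU x u hu)) φ
    (Submodule.mem_sup_left (Submodule.mem_span_singleton_self φ))
  have hb : b ∈ N := by
    have : RSpan (s := s) ρ ((ℂ ∙ φ) ⊔ N) ≤ N := by
      rw [RSpan, Submodule.span_le]
      rintro _ ⟨x, u, hu, rfl⟩
      exact hU x u hu
    exact this h4
  obtain ⟨v, hv, hbv⟩ := hb
  refine ⟨-v, r.neg_mem hv, fun x hx y => ?_⟩
  have ha : ∀ y, a y = φ y + π ⁅-v, y⁆ := by
    intro y
    rw [h1, LinearMap.add_apply, hbv, neg_lie, map_neg]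
    abel
  have := h3 ⟨x, hx⟩
  have := congrArg (fun f => f y) this
  change τ x (a y) - a ⁅x, y⁆ = 0 at this
  rw [ha, ha, sub_eq_zero] at this
  exact this

theorem part1_aux {s₁ s₂ : LieSubalgebra ℂ L} {P Q : L →ₗ[ℂ] L} (d : Dec s₁ s₂ P Q)
    [LieAlgebra.IsKilling ℂ s₁] [LieAlgebra.IsKilling ℂ s₂]
    (π : L →ₗ[ℂ] W) (τ : L →ₗ[ℂ] W →ₗ[ℂ] W) (hτ : IsRep τ)
    (hπ : ∀ x y, π ⁅x, y⁆ = τ x (π y))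
    (hr : ∀ x ∈ LieAlgebra.radical ℂ L, ∀ y ∈ LieAlgebra.radical ℂ L, π ⁅x, y⁆ = 0) :
    ∀ x ∈ LieAlgebra.radical ℂ L, ∀ y, π ⁅x, y⁆ = 0 := by
  obtain ⟨φ, f1, f2, f3⟩ := exists_phi π τ hτ hπ hr
  obtain ⟨v₁, hv₁, g1⟩ := exists_vs π τ hτ hπ φ f3 s₁
  obtain ⟨v₂, hv₂, g2⟩ := exists_vs π τ hτ hπ φ f3 s₂
  have p1 := perf_of_isKilling s₁
  have p2 := perf_of_isKilling s₂
  have p := d.perf p1 p2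
  set r := LieAlgebra.radical ℂ L with hrdef
  have hlr : ∀ x ∈ r, ∀ y, ⁅x, y⁆ ∈ r := by
    intro x hx y
    rw [← lie_skew]
    exact r.neg_mem (r.lie_mem hx)
  obtain ⟨v, hvd⟩ : ∃ v, v = v₂ - v₁ := ⟨_, rfl⟩
  have hv : v ∈ r := by rw [hvd]; exact r.sub_mem hv₂ hv₁
  obtain ⟨θ, m, -, hθ, hlie, hsurj, hdec⟩ := det_const d p1 p2 v (ad_nilpotent p v hv)
  let φ₁ : L →ₗ[ℂ] W := φ + π ∘ₗ adm L v₁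
  have e1 : ∀ y, φ₁ y = φ y + π ⁅v₁, y⁆ := fun y => rfl
  have hpow : ∀ k y, ((adm L v : Module.End ℂ L) ^ (k + 1)) y ∈ r := by
    intro k y
    rw [pow_succ', Module.End.mul_apply]
    exact hlr v hv _
  have hθr : ∀ y, ∃ z ∈ r, θ y = y + ⁅v, y⁆ + ⁅v, z⁆ ∧ True := by
    intro y
    refine ⟨∑ k ∈ Finset.range m, (((k + 2).factorial : ℂ)⁻¹ • ((adm L v : Module.End ℂ L) ^ (k + 1)) y), ?_, ?_, trivial⟩
    · exact r.toSubmodule.sum_mem fun k _ => r.smul_mem _ (hpow k y)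
    · have : ⁅v, ∑ k ∈ Finset.range m, (((k + 2).factorial : ℂ)⁻¹ • ((adm L v : Module.End ℂ L) ^ (k + 1)) y)⁆
        = ∑ k ∈ Finset.range m, (((k + 2).factorial : ℂ)⁻¹ • ((adm L v : Module.End ℂ L) ^ (k + 2)) y) := by
        rw [← adm_apply, map_sum]
        refine Finset.sum_congr rfl fun k _ => ?_
        rw [map_smul, pow_succ' _ (k + 1), Module.End.mul_apply]
      rw [this, hθ, Finset.sum_range_succ', Finset.sum_range_succ']
      simp
      abel
  have hφ₁r : ∀ y ∈ r, φ₁ y = π y := by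
    intro y hy
    rw [e1, f2 y hy, hr v₁ hv₁ y hy, add_zero]
  have e2 : ∀ y, φ₁ (θ y) = φ y + π ⁅v₂, y⁆ := by
    intro y
    obtain ⟨z, hz, h, -⟩ := hθr y
    rw [h, map_add, map_add, hφ₁r _ (hlr v hv _), hφ₁r _ (hlr v hv _), hr v hv z hz, e1, hvd]
    simp
  let p' : Submodule ℂ L :=
    { carrier := {x | ∀ y, τ x (φ₁ y) = φ₁ ⁅x, y⁆}
      zero_mem' := by simp
      add_mem' := by
        intro a b ha hb y
        simp [ha y, hb y]
      smul_mem' := by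
        intro c a ha y
        simp [ha y] }
  have q1 : ∀ x ∈ s₁, x ∈ p' := fun x hx y => g1 x hx y
  have q2 : ∀ x ∈ s₂, θ x ∈ p' := by
    intro x hx y
    obtain ⟨y, rfl⟩ := hsurj y
    rw [← hlie, e2, e2, ← g2 x hx y]
    obtain ⟨z, hz, h⟩ := f1 y
    obtain ⟨w, hw, h', -⟩ := hθr x
    rw [h, ← map_add, ← hπ, ← hπ, h', add_lie, add_lie, map_add, map_add]
    have hz' := r.add_mem hz (hlr v₂ hv₂ y)
    rw [hr _ (hlr v hv x) _ hz', hr _ (hlr v hv w) _ hz', add_zero, add_zero]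
  have q : ∀ x, x ∈ p' := by
    intro x
    obtain ⟨y, z, hy, hz, rfl⟩ := hdec x
    exact p'.add_mem (q1 y hy) (q2 z hz)
  intro x hx y
  have := q x y
  rw [hφ₁r _ (hlr x hx y), e1] at this
  obtain ⟨z, hz, h⟩ := f1 y
  rw [← this, h, ← map_add, ← hπ, hr x hx _ (r.add_mem hz (hlr v₁ hv₁ y))]

end

section
variable {L : Type*} [LieRing L] [LieAlgebra ℂ L] [Module.Finite ℂ L]

theorem part1 {s₁ s₂ : LieSubalgebra ℂ L} {P Q : L →ₗ[ℂ] L} (d : Dec s₁ s₂ P Q)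
    [LieAlgebra.IsKilling ℂ s₁] [LieAlgebra.IsKilling ℂ s₂] :
    LieAlgebra.HasTrivialRadical ℂ L := by
  have p := d.perf (perf_of_isKilling s₁) (perf_of_isKilling s₂)
  have hA := radical_eq_lie p
  set r := LieAlgebra.radical ℂ L with hrdef
  let I : LieIdeal ℂ L := ⁅r, r⁆
  have key := part1_aux d (LieSubmodule.Quotient.mk' I : L →ₗ[ℂ] (L ⧸ I))
    (LieModule.toEnd ℂ L (L ⧸ I) : L →ₗ[ℂ] _) (fun x y z => lie_lie x y z)
    (fun x y => rfl) (fun x hx y hy => (LieSubmodule.Quotient.mk_eq_zero' (N := I)).2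
      (LieSubmodule.lie_mem_lie hx hy))
  have hle : r ≤ ⁅r, r⁆ := by
    conv_lhs => rw [← hA]
    rw [LieSubmodule.lie_le_iff]
    intro x _ y hy
    have := (LieSubmodule.Quotient.mk_eq_zero' (N := I)).1 (key y hy x)
    rw [← lie_skew]
    exact I.neg_mem this
  have hall : ∀ k, r ≤ LieAlgebra.derivedSeriesOfIdeal ℂ L k r := by
    intro k
    induction k with
    | zero => simp
    | succ k ih =>
      rw [LieAlgebra.derivedSeriesOfIdeal_succ]
      exact hle.trans (LieSubmodule.mono_lie ih ih)
  obtain ⟨k, hk⟩ := LieAlgebra.IsSolvable.solvable ℂ r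
  rw [LieIdeal.derivedSeries_eq_bot_iff] at hk
  have := hall k
  rw [hk] at this
  exact ⟨le_bot_iff.1 this⟩

end
end SDS

namespace SDS

section
variable (L : Type*) [LieRing L] [LieAlgebra ℂ L]

/-- Bilinear forms. -/
abbrev F2 := L →ₗ[ℂ] L →ₗ[ℂ] ℂ
/-- Trilinear forms. -/
abbrev F3 := L →ₗ[ℂ] L →ₗ[ℂ] L →ₗ[ℂ] ℂ
/-- Quadrilinear forms. -/
abbrev F4 := L →ₗ[ℂ] L →ₗ[ℂ] L →ₗ[ℂ] L →ₗ[ℂ] ℂ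

instance instF3 : AddCommGroup (F3 L) := LinearMap.addCommGroup (N₂ := F2 L)
instance instF4 : AddCommGroup (F4 L) := LinearMap.addCommGroup (N₂ := F3 L)
instance instF3f [Module.Finite ℂ L] : Module.Finite ℂ (F3 L) := Module.Finite.linearMap ℂ ℂ L (F2 L)
instance instF4f [Module.Finite ℂ L] : Module.Finite ℂ (F4 L) := Module.Finite.linearMap ℂ ℂ L (F3 L)

/-- Coadjoint action. -/
def rep1 : L →ₗ[ℂ] (L →ₗ[ℂ] ℂ) →ₗ[ℂ] (L →ₗ[ℂ] ℂ) := homRep (adm L) 0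
/-- Action on bilinear forms. -/
def rep2 : L →ₗ[ℂ] F2 L →ₗ[ℂ] F2 L := homRep (adm L) (rep1 L)
/-- Action on trilinear forms. -/
def rep3 : L →ₗ[ℂ] F3 L →ₗ[ℂ] F3 L := homRep (W := F2 L) (adm L) (rep2 L)
/-- Action on quadrilinear forms. -/
def rep4 : L →ₗ[ℂ] F4 L →ₗ[ℂ] F4 L := homRep (W := F3 L) (adm L) (rep3 L)

variable {L}

theorem rep1_isRep : IsRep (rep1 L) := homRep_isRep adm_isRep (fun x y v => by simp)
theorem rep2_isRep : IsRep (rep2 L) := homRep_isRep adm_isRep rep1_isRep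
theorem rep3_isRep : IsRep (V := F3 L) (rep3 L) := homRep_isRep (W := F2 L) adm_isRep rep2_isRep
theorem rep4_isRep : IsRep (V := F4 L) (rep4 L) := homRep_isRep (W := F3 L) adm_isRep rep3_isRep

theorem rep1_apply (x : L) (f : L →ₗ[ℂ] ℂ) (a : L) : rep1 L x f a = - f ⁅x, a⁆ := by
  simp [rep1]
theorem rep2_apply (x : L) (f : F2 L) (a b : L) :
    rep2 L x f a b = - f ⁅x, a⁆ b - f a ⁅x, b⁆ := by
  simp [rep2, rep1_apply]; ring
theorem rep3_apply (x : L) (f : F3 L) (a b c : L) :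
    rep3 L x f a b c = - f ⁅x, a⁆ b c - f a ⁅x, b⁆ c - f a b ⁅x, c⁆ := by
  simp [rep3, rep2_apply]; ring
theorem rep4_apply (x : L) (f : F4 L) (a b c e : L) :
    rep4 L x f a b c e = - f ⁅x, a⁆ b c e - f a ⁅x, b⁆ c e - f a b ⁅x, c⁆ e - f a b c ⁅x, e⁆ := by
  simp [rep4, rep3_apply]; ring

/-- The differential of bilinear forms. -/
def d2 : F2 L →ₗ[ℂ] F3 L where
  toFun f := LinearMap.mk₂ ℂ (fun x y =>
      ({ toFun := fun z => - f ⁅x, y⁆ z + f ⁅x, z⁆ y - f ⁅y, z⁆ x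
         map_add' := fun a b => by simp; ring
         map_smul' := fun a b => by simp; ring } : L →ₗ[ℂ] ℂ))
    (fun a b c => by ext; simp; ring) (fun a b c => by ext; simp; ring)
    (fun a b c => by ext; simp; ring) (fun a b c => by ext; simp; ring)
  map_add' f g := by ext; simp; ring
  map_smul' k f := by ext; simp; ring

theorem d2_apply (f : F2 L) (x y z : L) :
    d2 f x y z = - f ⁅x, y⁆ z + f ⁅x, z⁆ y - f ⁅y, z⁆ x := rfl

/-- The differential of trilinear forms. -/
def d3 : F3 L →ₗ[ℂ] F4 L where
  toFun f := LinearMap.mk₂ ℂ (fun x y => LinearMap.mk₂ ℂ (fun z w =>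
      - f ⁅x, y⁆ z w + f ⁅x, z⁆ y w - f ⁅x, w⁆ y z - f ⁅y, z⁆ x w + f ⁅y, w⁆ x z - f ⁅z, w⁆ x y)
        (fun a b c => by simp; ring) (fun a b c => by simp; ring)
        (fun a b c => by simp; ring) (fun a b c => by simp; ring))
    (fun a b c => by ext; simp; ring) (fun a b c => by ext; simp; ring)
    (fun a b c => by ext; simp; ring) (fun a b c => by ext; simp; ring)
  map_add' f g := by ext; simp; ring
  map_smul' k f := by ext; simp; ring

theorem d3_apply (f : F3 L) (x y z w : L) :
    d3 f x y z w = - f ⁅x, y⁆ z w + f ⁅x, z⁆ y w - f ⁅x, w⁆ y z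
      - f ⁅y, z⁆ x w + f ⁅y, w⁆ x z - f ⁅z, w⁆ x y := rfl

/-- Exterior product of a linear form with a trilinear form. -/
def wed (c : L →ₗ[ℂ] ℂ) (f : F3 L) : F4 L :=
  LinearMap.mk₂ ℂ (fun x y => LinearMap.mk₂ ℂ (fun z w =>
      c x * f y z w - c y * f x z w + c z * f x y w - c w * f x y z)
        (fun a b c => by simp; ring) (fun a b c => by simp; ring)
        (fun a b c => by simp; ring) (fun a b c => by simp; ring))
    (fun a b c => by ext; simp; ring) (fun a b c => by ext; simp; ring)
    (fun a b c => by ext; simp; ring) (fun a b c => by ext; simp; ring)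

theorem wed_apply (c : L →ₗ[ℂ] ℂ) (f : F3 L) (x y z w : L) :
    wed c f x y z w = c x * f y z w - c y * f x z w + c z * f x y w - c w * f x y z := rfl

theorem d2_rep (x : L) (f : F2 L) : d2 (rep2 L x f) = rep3 L x (d2 f) := by
  ext a b c
  simp only [d2_apply, rep3_apply, rep2_apply, leibniz_lie x, map_add, LinearMap.add_apply]
  ring

theorem d3_rep (x : L) (f : F3 L) : d3 (rep3 L x f) = rep4 L x (d3 f) := by
  ext a b c e
  simp only [d3_apply, rep4_apply, rep3_apply, leibniz_lie x, map_add, LinearMap.add_apply]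
  ring

variable (L) in
/-- Skew bilinear forms. -/
def Sk2 : Submodule ℂ (F2 L) where
  carrier := {f | ∀ x y, f x y = - f y x}
  zero_mem' := by simp
  add_mem' := by
    intro f g hf hg x y
    simp only [LinearMap.add_apply, hf x y, hg x y]; ring
  smul_mem' := by
    intro c f hf x y
    simp only [LinearMap.smul_apply, hf x y, smul_neg]

variable (L) in
/-- Skew trilinear forms. -/
def Sk3 : Submodule ℂ (F3 L) where
  carrier := {f | (∀ x y z, f x y z = - f y x z) ∧ ∀ x y z, f x y z = - f x z y}
  zero_mem' := by simp
  add_mem' := by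
    rintro f g ⟨hf, hf'⟩ ⟨hg, hg'⟩
    refine ⟨fun x y z => ?_, fun x y z => ?_⟩
    · simp only [LinearMap.add_apply, hf x y, hg x y]; ring
    · simp only [LinearMap.add_apply, hf' x y, hg' x y]; ring
  smul_mem' := by
    rintro c f ⟨hf, hf'⟩
    refine ⟨fun x y z => ?_, fun x y z => ?_⟩
    · simp only [LinearMap.smul_apply, hf x y, smul_neg]
    · simp only [LinearMap.smul_apply, hf' x y, smul_neg]

theorem rep2_Sk2 (x : L) (f : F2 L) (hf : f ∈ Sk2 L) : rep2 L x f ∈ Sk2 L := by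
  intro a b
  rw [rep2_apply, rep2_apply, hf ⁅x, a⁆ b, hf a ⁅x, b⁆]; ring

theorem rep3_Sk3 (x : L) (f : F3 L) (hf : f ∈ Sk3 L) : rep3 L x f ∈ Sk3 L := by
  obtain ⟨h1, h2⟩ := hf
  refine ⟨fun a b c => ?_, fun a b c => ?_⟩
  · rw [rep3_apply, rep3_apply, h1 ⁅x, a⁆ b c, h1 a ⁅x, b⁆ c, h1 a b]; ring
  · rw [rep3_apply, rep3_apply, h2 ⁅x, a⁆ b c, h2 a ⁅x, b⁆ c, h2 a b]; ring

/-- Cartan formula on closed forms. -/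
theorem cartan3 (f : F3 L) (hf : f ∈ Sk3 L) (hd : d3 f = 0) (x : L) : rep3 L x f = d2 (f x) := by
  ext y z w
  have h := congrArg (fun g : F4 L => g x y z w) hd
  simp only [d3_apply, LinearMap.zero_apply] at h
  obtain ⟨h1, h2⟩ := hf
  rw [rep3_apply, d2_apply, h1 x ⁅y, z⁆ w, h1 x ⁅y, w⁆ z, h1 x ⁅z, w⁆ y, h1 y ⁅x, z⁆ w, h2 y z ⁅x, w⁆,
    h1 y ⁅x, w⁆ z]
  linear_combination h + h2 ⁅z, w⁆ x y - h2 ⁅z, w⁆ x y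

theorem cartan2 (f : F2 L) (hf : f ∈ Sk2 L) (hd : d2 f = 0) (x y z : L) :
    rep2 L x f y z = f ⁅y, z⁆ x := by
  have h := congrArg (fun g : F3 L => g x y z) hd
  simp only [d2_apply, LinearMap.zero_apply] at h
  rw [rep2_apply, hf y ⁅x, z⁆]
  linear_combination h

theorem inv_skew_zero (hp : Perf L) (f : F2 L) (hf : f ∈ Sk2 L) (hi : ∀ x, rep2 L x f = 0) : f = 0 := by
  have key : ∀ x y z, f ⁅x, y⁆ z = - f ⁅y, z⁆ x := by
    intro x y z
    have h := congrArg (fun g : F2 L => g x z) (hi y)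
    simp only [rep2_apply, LinearMap.zero_apply] at h
    rw [hf x ⁅y, z⁆, ← lie_skew y x, map_neg, LinearMap.neg_apply] at h
    linear_combination h
  ext a b
  refine hp (LinearMap.ker (f.flip b)) (fun x y => ?_) a
  rw [LinearMap.mem_ker, LinearMap.flip_apply]
  have h1 := key x y b
  have h2 := key y b x
  have h3 := key b x y
  have : (2 : ℂ) * f ⁅x, y⁆ b = 0 := by linear_combination h1 - h2 + h3
  simpa using this

end
end SDS

namespace SDS

section
variable {L : Type*} [LieRing L] [LieAlgebra ℂ L]

/-- The span of `s·U`. -/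
def SSpan {V : Type*} [AddCommGroup V] [Module ℂ V] (ρ : L →ₗ[ℂ] V →ₗ[ℂ] V) (s : LieSubalgebra ℂ L)
    (U : Submodule ℂ V) : Submodule ℂ V :=
  Submodule.span ℂ {m | ∃ x ∈ s, ∃ u ∈ U, ρ x u = m}

theorem SSpan_le {V : Type*} [AddCommGroup V] [Module ℂ V] {ρ : L →ₗ[ℂ] V →ₗ[ℂ] V}
    {s : LieSubalgebra ℂ L} {U U' : Submodule ℂ V} (h : ∀ x ∈ s, ∀ u ∈ U, ρ x u ∈ U') :
    SSpan ρ s U ≤ U' := by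
  rw [SSpan, Submodule.span_le]
  rintro _ ⟨x, hx, u, hu, rfl⟩
  exact h x hx u hu

theorem mem_SSpan {V : Type*} [AddCommGroup V] [Module ℂ V] {ρ : L →ₗ[ℂ] V →ₗ[ℂ] V}
    {s : LieSubalgebra ℂ L} {U : Submodule ℂ V} {x : L} (hx : x ∈ s) {u : V} (hu : u ∈ U) :
    ρ x u ∈ SSpan ρ s U := Submodule.subset_span ⟨x, hx, u, hu, rfl⟩

variable [Module.Finite ℂ L]

theorem sub_inter {V : Type*} [AddCommGroup V] [Module ℂ V] [Module.Finite ℂ V]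
    {ρ : L →ₗ[ℂ] V →ₗ[ℂ] V} (hρ : IsRep ρ) (s : LieSubalgebra ℂ L) [LieAlgebra.IsKilling ℂ s]
    (v : V) (hv : ∀ x ∈ s, ρ x v = 0) (hvs : v ∈ SSpan ρ s ⊤) : v = 0 := by
  let σ := ρ ∘ₗ s.toSubmodule.subtype
  have hσ : IsRep (s := s) σ := fun x y v => hρ x y v
  refine weyl_inter (s := s) hσ v (fun x => hv x x.2) ?_
  refine SSpan_le (fun x hx u _ => ?_) hvs
  exact Submodule.subset_span ⟨⟨x, hx⟩, u, trivial, rfl⟩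

theorem sub_sum {V : Type*} [AddCommGroup V] [Module ℂ V] [Module.Finite ℂ V]
    {ρ : L →ₗ[ℂ] V →ₗ[ℂ] V} (hρ : IsRep ρ) (s : LieSubalgebra ℂ L) [LieAlgebra.IsKilling ℂ s]
    (U : Submodule ℂ V) (hU : ∀ x ∈ s, ∀ u ∈ U, ρ x u ∈ U) (v : V) (hv : v ∈ U) :
    ∃ a b, v = a + b ∧ a ∈ U ∧ (∀ x ∈ s, ρ x a = 0) ∧ b ∈ SSpan ρ s U := by
  let σ := ρ ∘ₗ s.toSubmodule.subtype
  have hσ : IsRep (s := s) σ := fun x y v => hρ x y v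
  obtain ⟨a, b, h1, h2, h3, h4⟩ := weyl_sum (s := s) hσ U (fun x u hu => hU x x.2 u hu) v hv
  refine ⟨a, b, h1, h2, fun x hx => h3 ⟨x, hx⟩, ?_⟩
  have : RSpan (s := s) σ U ≤ SSpan ρ s U := by
    rw [RSpan, Submodule.span_le]
    rintro _ ⟨x, u, hu, rfl⟩
    exact mem_SSpan x.2 hu
  exact this h4

theorem rep4_wed (b : L) (c : L →ₗ[ℂ] ℂ) (f : F3 L) (x y z w : L) :
    rep4 L b (wed c f) x y z w =
      (-(c ⁅b, x⁆ * f y z w) + c ⁅b, y⁆ * f x z w - c ⁅b, z⁆ * f x y w + c ⁅b, w⁆ * f x y z) +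
      (c x * rep3 L b f y z w - c y * rep3 L b f x z w + c z * rep3 L b f x y w
        - c w * rep3 L b f x y z) := by
  simp only [rep4_apply, rep3_apply, wed_apply]; ring

theorem E_mem (s : LieSubalgebra ℂ L) (A : L →ₗ[ℂ] L) (hA : ∀ x, A x ∈ s)
    (ht : ∀ u, LinearMap.trace ℂ L (adm L u * A) = 0) (f : F3 L) (g : F4 L)
    (hg : ∀ x y z w, g x y z w = rep3 L (A x) f y z w - rep3 L (A y) f x z w
      + rep3 L (A z) f x y w - rep3 L (A w) f x y z) : g ∈ SSpan (rep4 L) s ⊤ := by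
  let e := Module.finBasis ℂ L
  have hc : ∀ u, ∑ i, e.coord i ⁅A (e i), u⁆ = 0 := by
    intro u
    have h1 := ht u
    rw [LinearMap.trace_eq_matrix_trace ℂ e, Matrix.trace] at h1
    rw [← neg_eq_zero, ← Finset.sum_neg_distrib, ← h1]
    refine Finset.sum_congr rfl fun i _ => ?_
    rw [Matrix.diag_apply, LinearMap.toMatrix_apply, ← map_neg, lie_skew]
    rfl
  have hA' : ∀ x y z w, ∑ i, e.coord i x * rep3 L (A (e i)) f y z w = rep3 L (A x) f y z w := by
    intro x y z w
    have hx : A x = ∑ i, e.coord i x • A (e i) := by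
      conv_lhs => rw [← e.sum_repr x]
      rw [map_sum]
      simp only [map_smul, Module.Basis.coord_apply]
    rw [hx, map_sum]
    simp only [LinearMap.sum_apply, map_smul, LinearMap.smul_apply, smul_eq_mul]
  have : g = ∑ i, rep4 L (A (e i)) (wed (e.coord i) f) := by
    ext x y z w
    simp only [LinearMap.sum_apply, rep4_wed, Finset.sum_add_distrib, Finset.sum_sub_distrib,
      Finset.sum_neg_distrib, ← Finset.sum_mul, hc, hA', hg]
    ring
  rw [this]
  exact Submodule.sum_mem _ fun i _ => mem_SSpan (hA _) trivial

theorem d3_E (P A : L →ₗ[ℂ] L) (f : F3 L) (hf : f ∈ Sk3 L) (ε : ℂ)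
    (h : ∀ x y z w, f ⁅x, y⁆ z w = ε * f ⁅P x, P y⁆ z w + f ⁅A x, y⁆ z w - f ⁅A y, x⁆ z w)
    (hP : ∀ u z w, f u z w = f u (P z) (P w)) (x y z w : L)
    (hd : d3 f (P x) (P y) (P z) (P w) = 0) :
    d3 f x y z w = rep3 L (A x) f y z w - rep3 L (A y) f x z w
      + rep3 L (A z) f x y w - rep3 L (A w) f x y z := by
  rw [d3_apply] at hd
  obtain ⟨h1, h2⟩ := hf
  have h3 : ∀ a b c, f a b c = f c a b := fun a b c => by rw [h1 c a b, h2 a c b, neg_neg]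
  have hP' : ∀ a b z w, f ⁅P a, P b⁆ (P z) (P w) = f ⁅P a, P b⁆ z w := fun a b z w => (hP _ _ _).symm
  simp only [hP'] at hd
  simp only [rep3_apply, d3_apply]
  rw [h x y, h x z, h x w, h y z, h y w, h z w]
  rw [h1 y ⁅A x, z⁆ w, h1 x ⁅A y, z⁆ w, h1 x ⁅A z, y⁆ w, h1 x ⁅A w, y⁆ z,
    h3 y z ⁅A x, w⁆, h3 x z ⁅A y, w⁆, h3 x y ⁅A z, w⁆, h3 x y ⁅A w, z⁆]
  linear_combination ε * hd

/-- Projection to closed invariant forms. -/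
theorem closed_proj (s : LieSubalgebra ℂ L) [LieAlgebra.IsKilling ℂ s] (f : F3 L) (hf : f ∈ Sk3 L)
    (hd : d3 f ∈ SSpan (rep4 L) s ⊤) :
    ∃ ζ η, f = ζ + η ∧ ζ ∈ Sk3 L ∧ d3 ζ = 0 ∧ (∀ x ∈ s, rep3 L x ζ = 0) ∧
      η ∈ SSpan (rep3 L) s (Sk3 L) := by
  obtain ⟨ζ, η, h1, h2, h3, h4⟩ := sub_sum (V := F3 L) rep3_isRep s (Sk3 L)
    (fun x _ u hu => rep3_Sk3 x u hu) f hf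
  refine ⟨ζ, η, h1, h2, ?_, h3, h4⟩
  refine sub_inter (V := F4 L) rep4_isRep s _ (fun x hx => ?_) ?_
  · rw [← d3_rep, h3 x hx, map_zero]
  · have : d3 ζ = d3 f - d3 η := by rw [h1, map_add]; simp
    rw [this]
    refine Submodule.sub_mem _ hd ?_
    have : SSpan (rep3 L) s (Sk3 L) ≤ (SSpan (rep4 L) s ⊤).comap d3 := by
      refine SSpan_le fun x hx u _ => ?_
      rw [Submodule.mem_comap, d3_rep]
      exact mem_SSpan hx trivial
    exact this h4

variable [LieAlgebra.IsKilling ℂ L]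

theorem d2_inv_zero (α : F2 L) (hα : α ∈ Sk2 L) (hi : ∀ x, rep3 L x (d2 α) = 0) : d2 α = 0 := by
  obtain ⟨a, b, h1, h2, h3, h4⟩ := weyl_sum rep2_isRep (Sk2 L) rep2_Sk2 α hα
  have ha := inv_skew_zero (perf_of_isKilling L) a h2 h3
  rw [ha, zero_add] at h1
  refine weyl_inter (V := F3 L) rep3_isRep _ hi ?_
  have : RSpan (rep2 L) (Sk2 L) ≤ (RSpan (V := F3 L) (rep3 L) ⊤).comap d2 := by
    rw [RSpan, Submodule.span_le]
    rintro _ ⟨x, u, hu, rfl⟩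
    show d2 (rep2 L x u) ∈ RSpan (V := F3 L) (rep3 L) ⊤
    rw [d2_rep]
    exact Submodule.subset_span ⟨x, _, trivial, rfl⟩
  rw [h1]
  exact this h4

theorem closed2_exact (f : F2 L) (hf : f ∈ Sk2 L) (hd : d2 f = 0) :
    ∃ c : L →ₗ[ℂ] ℂ, ∀ x y, f x y = c ⁅x, y⁆ := by
  let Z : Submodule ℂ (F2 L) := Sk2 L ⊓ LinearMap.ker d2
  obtain ⟨a, b, h1, h2, h3, h4⟩ := weyl_sum rep2_isRep Z (fun x u hu =>
    ⟨rep2_Sk2 x u hu.1, LinearMap.mem_ker.2 (by rw [d2_rep, LinearMap.mem_ker.1 hu.2, map_zero])⟩) f ⟨hf, hd⟩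
  have ha := inv_skew_zero (perf_of_isKilling L) a h2.1 h3
  rw [ha, zero_add] at h1
  let E : Submodule ℂ (F2 L) :=
    { carrier := {f | ∃ c : L →ₗ[ℂ] ℂ, ∀ x y, f x y = c ⁅x, y⁆}
      zero_mem' := ⟨0, by simp⟩
      add_mem' := by
        rintro f g ⟨c, hc⟩ ⟨c', hc'⟩
        exact ⟨c + c', by simp [hc, hc']⟩
      smul_mem' := by
        rintro k f ⟨c, hc⟩
        exact ⟨k • c, by simp [hc]⟩ }
  have : RSpan (rep2 L) Z ≤ E := by
    rw [RSpan, Submodule.span_le]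
    rintro _ ⟨x, u, hu, rfl⟩
    exact ⟨u.flip x, fun y z => cartan2 u hu.1 hu.2 x y z⟩
  rw [h1]
  exact this h4

/-- Decomposition of a closed form. -/
theorem closed3_decomp (f : F3 L) (hf : f ∈ Sk3 L) (hd : d3 f = 0) :
    ∃ Ω b, f = Ω + b ∧ Ω ∈ Sk3 L ∧ d3 Ω = 0 ∧ (∀ x, rep3 L x Ω = 0) ∧
      b ∈ RSpan (V := F3 L) (rep3 L) ⊤ ∧ ∃ α ∈ Sk2 L, b = d2 α := by
  let Z : Submodule ℂ (F3 L) := Sk3 L ⊓ LinearMap.ker d3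
  obtain ⟨a, b, h1, h2, h3, h4⟩ := weyl_sum (V := F3 L) rep3_isRep Z (fun x u hu =>
    ⟨rep3_Sk3 x u hu.1, LinearMap.mem_ker.2 (by rw [d3_rep, LinearMap.mem_ker.1 hu.2, map_zero])⟩) f ⟨hf, hd⟩
  refine ⟨a, b, h1, h2.1, h2.2, h3, ?_, ?_⟩
  · exact Submodule.span_mono (by rintro _ ⟨x, u, hu, rfl⟩; exact ⟨x, u, trivial, rfl⟩) h4
  · have : RSpan (V := F3 L) (rep3 L) Z ≤ (Sk2 L).map d2 := by
      rw [RSpan, Submodule.span_le]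
      rintro _ ⟨x, u, hu, rfl⟩
      exact ⟨u x, fun y z => hu.1.2 x y z, (cartan3 u hu.1 hu.2 x).symm⟩
    obtain ⟨α, hα, h⟩ := this h4
    exact ⟨α, hα, h.symm⟩

end
end SDS

namespace SDS

section
variable {L K : Type*} [LieRing L] [LieAlgebra ℂ L] [LieRing K] [LieAlgebra ℂ K]

/-- Pullback of bilinear forms. -/
def pull2 (p : K →ₗ[ℂ] L) : F2 L →ₗ[ℂ] F2 K where
  toFun f := LinearMap.mk₂ ℂ (fun x y => f (p x) (p y))
    (fun a b c => by simp) (fun a b c => by simp)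
    (fun a b c => by simp) (fun a b c => by simp)
  map_add' f g := by ext; simp
  map_smul' k f := by ext; simp

theorem pull2_apply (p : K →ₗ[ℂ] L) (f : F2 L) (x y : K) : pull2 p f x y = f (p x) (p y) := rfl

/-- Pullback of trilinear forms. -/
def pull3 (p : K →ₗ[ℂ] L) : F3 L →ₗ[ℂ] F3 K where
  toFun f := LinearMap.mk₂ ℂ (fun x y => f (p x) (p y) ∘ₗ p)
    (fun a b c => by ext; simp) (fun a b c => by ext; simp)
    (fun a b c => by ext; simp) (fun a b c => by ext; simp)
  map_add' f g := by ext; simp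
  map_smul' k f := by ext; simp

theorem pull3_apply (p : K →ₗ[ℂ] L) (f : F3 L) (x y z : K) :
    pull3 p f x y z = f (p x) (p y) (p z) := rfl

theorem pull3_Sk3 (p : K →ₗ[ℂ] L) (f : F3 L) (hf : f ∈ Sk3 L) : pull3 p f ∈ Sk3 K :=
  ⟨fun _ _ _ => hf.1 _ _ _, fun _ _ _ => hf.2 _ _ _⟩

variable (s : LieSubalgebra ℂ L)

/-- Inclusion of a subalgebra. -/
def inc : s →ₗ[ℂ] L := s.toSubmodule.subtype

theorem inc_apply (x : s) : inc s x = x := rfl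

theorem pull3_rep (x : s) (f : F3 L) : pull3 (inc s) (rep3 L x f) = rep3 s x (pull3 (inc s) f) := by
  ext a b c
  simp only [pull3_apply, rep3_apply, inc_apply, LieSubalgebra.coe_bracket]

theorem pull3_d2 (f : F2 L) : pull3 (inc s) (d2 f) = d2 (pull2 (inc s) f) := by
  ext a b c
  simp only [pull3_apply, pull2_apply, d2_apply, inc_apply, LieSubalgebra.coe_bracket]

variable [Module.Finite ℂ L] [LieAlgebra.IsKilling ℂ s]

theorem res_eq (τ ζ η Ω : F3 L) (α : F2 L) (hτ : ∀ x, rep3 s x (pull3 (inc s) τ) = 0)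
    (h1 : τ = ζ + η) (hζ : ∀ x ∈ s, rep3 L x ζ = 0) (hη : η ∈ SSpan (rep3 L) s (Sk3 L))
    (h2 : ζ = Ω + d2 α) (hΩ : ∀ x, rep3 L x Ω = 0) (hα : α ∈ Sk2 L) :
    pull3 (inc s) Ω = pull3 (inc s) τ := by
  have hζ' : ∀ x, rep3 s x (pull3 (inc s) ζ) = 0 := by
    intro x
    rw [← pull3_rep, hζ x x.2, map_zero]
  have e1 : pull3 (inc s) η = 0 := by
    refine weyl_inter (V := F3 s) rep3_isRep _ (fun x => ?_) ?_
    · have := hτ x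
      rw [h1, map_add, map_add, hζ' x, zero_add] at this
      exact this
    · have : SSpan (rep3 L) s (Sk3 L) ≤ (RSpan (V := F3 s) (rep3 s) ⊤).comap (pull3 (inc s)) := by
        refine SSpan_le fun x hx u _ => ?_
        rw [Submodule.mem_comap, pull3_rep s ⟨x, hx⟩]
        exact Submodule.subset_span ⟨_, _, trivial, rfl⟩
      exact this hη
  have e2 : pull3 (inc s) (d2 α) = 0 := by
    rw [pull3_d2]
    refine d2_inv_zero _ (fun x y => hα _ _) fun x => ?_
    rw [← pull3_d2]
    have := hζ' x
    rw [h2, map_add, map_add, ← pull3_rep s x Ω, hΩ, map_zero, zero_add] at this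
    exact this
  rw [h1, h2, map_add, map_add, e1, e2, add_zero, add_zero]

end

section
variable {K : Type*} [LieRing K] [LieAlgebra ℂ K]

/-- The Cartan form of an invariant bilinear form. -/
def cform (β : F2 K) : F3 K := (adm K).compr₂ β

theorem cform_apply (β : F2 K) (a b c : K) : cform β a b c = β ⁅a, b⁆ c := rfl

theorem cform_rep {β : F2 K} (hi : ∀ x y z, β ⁅x, y⁆ z = β x ⁅y, z⁆) (x : K) :
    rep3 K x (cform β) = 0 := by
  ext a b c
  simp only [rep3_apply, cform_apply, LinearMap.zero_apply]
  have h1 : ⁅⁅x, a⁆, b⁆ = ⁅x, ⁅a, b⁆⁆ - ⁅a, ⁅x, b⁆⁆ := by rw [leibniz_lie x a b]; abel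
  have h2 := hi ⁅a, b⁆ x c
  rw [← lie_skew, map_neg, LinearMap.neg_apply] at h2
  rw [h1, map_sub, LinearMap.sub_apply]
  linear_combination h2

theorem cform_Sk3 {β : F2 K} (hi : ∀ x y z, β ⁅x, y⁆ z = β x ⁅y, z⁆) : cform β ∈ Sk3 K := by
  refine ⟨fun a b c => ?_, fun a b c => ?_⟩
  · rw [cform_apply, cform_apply, ← lie_skew, map_neg, LinearMap.neg_apply]
  · rw [cform_apply, cform_apply, hi, hi, ← lie_skew, map_neg]

theorem cform_d3 {β : F2 K} (hs : ∀ x y, β x y = β y x)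
    (hi : ∀ x y z, β ⁅x, y⁆ z = β x ⁅y, z⁆) : d3 (cform β) = 0 := by
  ext x y z w
  simp only [d3_apply, cform_apply, LinearMap.zero_apply]
  rw [hi ⁅x, y⁆, hi ⁅x, z⁆, hi ⁅x, w⁆, hi ⁅y, z⁆, hi ⁅y, w⁆, hi ⁅z, w⁆,
    hs ⁅y, z⁆, hs ⁅y, w⁆, hs ⁅z, w⁆]
  have h1 : β ⁅x, y⁆ ⁅z, w⁆ = - β ⁅x, w⁆ ⁅y, z⁆ + β ⁅x, z⁆ ⁅y, w⁆ := by
    rw [hi, hi, hi, ← map_neg, ← map_add, leibniz_lie y z w, ← lie_skew ⁅y, z⁆ w]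
  linear_combination (-2) * h1

end

section
variable {L : Type*} [LieRing L] [LieAlgebra ℂ L]

theorem br1 (a b c e : L) : ⁅a + b, c + e⁆ = ⁅a, c⁆ + ⁅b, c + e⁆ - ⁅e, a + b⁆ - ⁅b, e⁆ := by
  rw [← lie_skew e (a + b)]
  simp only [add_lie, lie_add]
  abel

theorem br2 (a b c e : L) : ⁅a + b, c + e⁆ = -⁅a, c⁆ + ⁅a, c + e⁆ - ⁅c, a + b⁆ + ⁅b, e⁆ := by
  rw [← lie_skew c (a + b)]
  simp only [add_lie, lie_add]
  abel

variable [Module.Finite ℂ L] [LieAlgebra.IsKilling ℂ L]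

/-- From an invariant 3-form to an invariant symmetric bilinear form. -/
theorem exists_B (Ω : F3 L) (h : Ω ∈ Sk3 L) (hd : d3 Ω = 0) (hr : ∀ x, rep3 L x Ω = 0) :
    ∃ B : F2 L, (∀ x y, B x y = B y x) ∧ (∀ x y z, B ⁅x, y⁆ z = B x ⁅y, z⁆) ∧
      ∀ x y z, B z ⁅x, y⁆ = Ω x y z := by
  have hp := perf_of_isKilling L
  have hcyc : ∀ a b c, Ω a b c = Ω c a b := fun a b c => by rw [h.1 c a b, h.2 a c b, neg_neg]
  have hex : ∀ z, ∃ c : L →ₗ[ℂ] ℂ, ∀ x y, Ω z x y = c ⁅x, y⁆ := fun z =>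
    closed2_exact (Ω z) (fun x y => h.2 z x y) (by rw [← cartan3 Ω h hd, hr])
  choose c hc using hex
  have hext : ∀ f g : L →ₗ[ℂ] ℂ, (∀ x y : L, f ⁅x, y⁆ = g ⁅x, y⁆) → f = g := by
    intro f g hfg
    ext x
    have := hp (LinearMap.ker (f - g)) (fun x y => by simp [hfg]) x
    simpa [sub_eq_zero] using this
  let B : F2 L :=
    { toFun := c
      map_add' := fun a b => hext _ _ fun x y => by simp [← hc]
      map_smul' := fun k a => hext _ _ fun x y => by simp [← hc] }
  have hB : ∀ x y z, B z ⁅x, y⁆ = Ω x y z := fun x y z => by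
    rw [hcyc x y z]; exact (hc z x y).symm
  have hstar : ∀ x y z, B z ⁅x, y⁆ = B x ⁅y, z⁆ := fun x y z => by
    rw [hB, hB, hcyc y z x]
  have hinv0 : ∀ w z, rep1 L w (B z) = B ⁅w, z⁆ := by
    intro w z
    refine hext _ _ fun x y => ?_
    have := congrArg (fun g : F3 L => g x y z) (hr w)
    simp only [rep3_apply, LinearMap.zero_apply] at this
    rw [rep1_apply, leibniz_lie, map_add, hB, hB, hB]
    linear_combination this
  have hinv : ∀ w z u, B ⁅w, z⁆ u = - B z ⁅w, u⁆ := fun w z u => by rw [← hinv0, rep1_apply]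
  have hinv' : ∀ x y z, B ⁅x, y⁆ z = B x ⁅y, z⁆ := fun x y z => by
    rw [← lie_skew, map_neg, LinearMap.neg_apply, hinv, neg_neg]
  refine ⟨B, fun u z => ?_, hinv', hB⟩
  have := hp (LinearMap.ker (B.flip z - B z)) (fun x y => by
    rw [LinearMap.mem_ker, LinearMap.sub_apply, LinearMap.flip_apply, hstar, hinv', sub_self]) u
  simpa [sub_eq_zero] using this

theorem extend_form {s₁ s₂ : LieSubalgebra ℂ L} {P Q : L →ₗ[ℂ] L} (d : Dec s₁ s₂ P Q)
    [LieAlgebra.IsKilling ℂ s₁] [LieAlgebra.IsKilling ℂ s₂] (β : F2 s₁)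
    (hs : ∀ x y, β x y = β y x) (hi : ∀ x y z, β ⁅x, y⁆ z = β x ⁅y, z⁆) :
    ∃ B : F2 L, (∀ x y, B x y = B y x) ∧ (∀ x y z, B ⁅x, y⁆ z = B x ⁅y, z⁆) ∧
      (∀ x y : s₁, B x y = β x y) ∧ ∀ x y : s₂, B x y = 0 := by
  have p1 := perf_of_isKilling s₁
  have p2 := perf_of_isKilling s₂
  let p : L →ₗ[ℂ] s₁ := P.codRestrict s₁.toSubmodule d.memP
  have hp : ∀ x, (p x : L) = P x := fun x => rfl
  have hp1 : ∀ x : s₁, p x = x := fun x => Subtype.ext (d.P1 x x.2)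
  have hp2 : ∀ x ∈ s₂, p x = 0 := fun x hx => Subtype.ext (d.P2 x hx)
  have hpP : ∀ x, p (P x) = p x := fun x => hp1 (p x)
  have hpb : ∀ x y, p ⁅P x, P y⁆ = ⁅p x, p y⁆ := fun x y => hp1 ⁅p x, p y⁆
  let τ : F3 L := pull3 p (cform β)
  have hτ : ∀ x y z, τ x y z = cform β (p x) (p y) (p z) := fun x y z => rfl
  have hτS : τ ∈ Sk3 L := pull3_Sk3 p _ (cform_Sk3 hi)
  have hτP : ∀ u z w, τ u z w = τ u (P z) (P w) := fun u z w => by rw [hτ, hτ, hpP, hpP]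
  have hτ0 : ∀ a b z w, τ ⁅Q a, Q b⁆ z w = 0 := fun a b z w => by
    rw [hτ, hp2 _ (s₂.lie_mem (d.memQ a) (d.memQ b))]; simp
  have hτd : ∀ x y z w, d3 τ (P x) (P y) (P z) (P w) = 0 := by
    intro x y z w
    have := congrArg (fun g : F4 s₁ => g (p x) (p y) (p z) (p w)) (cform_d3 hs hi)
    simp only [d3_apply, LinearMap.zero_apply] at this
    simp only [d3_apply, hτ, hpb, hpP]
    exact this
  have hQ : d3 τ ∈ SSpan (rep4 L) s₂ ⊤ := by
    refine E_mem s₂ Q d.memQ (d.trace_Q p1 p2) τ _ fun x y z w =>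
      d3_E P Q τ hτS 1 (fun x y z w => ?_) hτP x y z w (hτd x y z w)
    have := br1 (P x) (Q x) (P y) (Q y)
    rw [d.add, d.add] at this
    have := congrArg (fun u => τ u z w) this
    simp only [map_add, map_sub, LinearMap.add_apply, LinearMap.sub_apply, hτ0] at this
    rw [this]; ring
  have hP : d3 τ ∈ SSpan (rep4 L) s₁ ⊤ := by
    refine E_mem s₁ P d.memP (d.symm.trace_Q p2 p1) τ _ fun x y z w =>
      d3_E P P τ hτS (-1) (fun x y z w => ?_) hτP x y z w (hτd x y z w)
    have := br2 (P x) (Q x) (P y) (Q y)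
    rw [d.add, d.add] at this
    have := congrArg (fun u => τ u z w) this
    simp only [map_add, map_sub, map_neg, LinearMap.neg_apply, LinearMap.add_apply,
      LinearMap.sub_apply, hτ0] at this
    rw [this]; ring
  obtain ⟨ζ₁, η₁, a1, a2, a3, a4, a5⟩ := closed_proj s₁ τ hτS hP
  obtain ⟨ζ₂, η₂, b1, b2, b3, b4, b5⟩ := closed_proj s₂ τ hτS hQ
  obtain ⟨Ω₁, c₁, e1, e2, e3, e4, e5, α₁, e6, e7⟩ := closed3_decomp ζ₁ a2 a3
  obtain ⟨Ω₂, c₂, f1, f2, f3, f4, f5, α₂, f6, f7⟩ := closed3_decomp ζ₂ b2 b3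
  have hle : ∀ s : LieSubalgebra ℂ L,
      SSpan (rep3 L) s (Sk3 L) ≤ RSpan (V := F3 L) (rep3 L) ⊤ := fun s =>
    SSpan_le fun x _ u _ => Submodule.subset_span ⟨x, u, trivial, rfl⟩
  have hΩ : Ω₁ = Ω₂ := by
    rw [← sub_eq_zero]
    refine weyl_inter (V := F3 L) rep3_isRep _ (fun x => by rw [map_sub, e4, f4, sub_zero]) ?_
    have : Ω₁ - Ω₂ = (c₂ - c₁) + (η₂ - η₁) := by
      have h1 : Ω₁ + c₁ + η₁ = Ω₂ + c₂ + η₂ := by rw [← e1, ← f1, ← a1, b1]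
      have h2 : Ω₁ = Ω₂ + c₂ + η₂ - η₁ - c₁ := by rw [← h1]; abel
      rw [h2]; abel
    rw [this]
    exact Submodule.add_mem _ (Submodule.sub_mem _ f5 e5)
      (Submodule.sub_mem _ (hle _ b5) (hle _ a5))
  subst hΩ
  have t1 : pull3 (inc s₁) τ = cform β := by
    ext x y z
    rw [pull3_apply, hτ, inc_apply, inc_apply, inc_apply, hp1, hp1, hp1]
  have t2 : pull3 (inc s₂) τ = 0 := by
    ext x y z
    rw [pull3_apply, hτ, inc_apply, inc_apply, inc_apply, hp2 _ x.2]
    simp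
  have r1 := res_eq s₁ τ ζ₁ η₁ Ω₁ α₁ (by rw [t1]; exact cform_rep hi) a1 a4 a5 (by rw [← e7]; exact e1) e4 e6
  have r2 := res_eq s₂ τ ζ₂ η₂ Ω₁ α₂ (by rw [t2]; simp) b1 b4 b5 (by rw [← f7]; exact f1) e4 f6
  rw [t1] at r1
  rw [t2] at r2
  obtain ⟨B, hB1, hB2, hB3⟩ := exists_B Ω₁ e2 e3 e4
  refine ⟨B, hB1, hB2, fun x y => ?_, fun x y => ?_⟩
  · have := p1 (LinearMap.ker (B x ∘ₗ inc s₁ - β x)) (fun a b => ?_) y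
    · simpa [sub_eq_zero, inc_apply] using this
    rw [LinearMap.mem_ker, LinearMap.sub_apply, LinearMap.comp_apply, inc_apply,
      LieSubalgebra.coe_bracket, hB3]
    have := congrArg (fun g : F3 s₁ => g a b x) r1
    simp only [pull3_apply, inc_apply, cform_apply] at this
    rw [this, hs, sub_self]
  · have := p2 (LinearMap.ker (B x ∘ₗ inc s₂)) (fun a b => ?_) y
    · simpa [inc_apply] using this
    rw [LinearMap.mem_ker, LinearMap.comp_apply, inc_apply, LieSubalgebra.coe_bracket, hB3]
    have := congrArg (fun g : F3 s₂ => g a b x) r2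
    simpa only [pull3_apply, inc_apply, LinearMap.zero_apply] using this

end
end SDS

namespace SDS

section
variable {L : Type*} [LieRing L] [LieAlgebra ℂ L]

/-- A decomposition into simple ideals, given by its projections. -/
structure SD {I : Type*} [Fintype I] (p : I → L →ₗ[ℂ] L) : Prop where
  lie : ∀ i (x y : L), p i ⁅x, y⁆ = ⁅p i x, y⁆
  idem : ∀ i x, p i (p i x) = p i x
  orth : ∀ i j, i ≠ j → ∀ x, p i (p j x) = 0
  sum : ∀ x, ∑ i, p i x = x
  kil : ∀ i x y, killingForm ℂ L (p i x) y = killingForm ℂ L x (p i y)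
  ne : ∀ i, ∃ x, p i x ≠ 0
  simple : ∀ i (D : Submodule ℂ L), (∀ y : L, ∀ x ∈ D, ⁅y, x⁆ ∈ D) →
    (∃ x ∈ D, p i x = x ∧ x ≠ 0) → ∀ x, p i x ∈ D

namespace SD
variable {I : Type*} [Fintype I] {p : I → L →ₗ[ℂ] L}

theorem lie' (h : SD p) (i : I) (x y : L) : p i ⁅x, y⁆ = ⁅x, p i y⁆ := by
  rw [← lie_skew, map_neg, h.lie, lie_skew]

theorem hom (h : SD p) (i : I) (x y : L) : p i ⁅x, y⁆ = ⁅p i x, p i y⁆ := by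
  rw [← h.idem, h.lie, h.lie']

theorem cross (h : SD p) (i j : I) (hij : i ≠ j) (x y : L) : ⁅p i x, p j y⁆ = 0 := by
  rw [← h.lie, ← h.lie', h.orth i j hij]

end SD

variable [Module.Finite ℂ L] [LieAlgebra.IsKilling ℂ L]

theorem kf_inv (x y z : L) : killingForm ℂ L ⁅x, y⁆ z = killingForm ℂ L x ⁅y, z⁆ :=
  LieModule.traceForm_apply_lie_apply ℂ L L x y z

theorem kf_comm (x y : L) : killingForm ℂ L x y = killingForm ℂ L y x :=
  LieModule.traceForm_comm ℂ L L x y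

theorem kf_zero (x : L) (h : ∀ y, killingForm ℂ L x y = 0) : x = 0 :=
  (LieAlgebra.IsKilling.killingForm_nondegenerate ℂ L).1 x h

variable (L) in
/-- Simple ideals. -/
abbrev At := {J : LieIdeal ℂ L // IsAtom J}

instance : Finite (At L) :=
  WellFoundedGT.finite_of_sSupIndep (LieAlgebra.IsSemisimple.sSupIndep_isAtom (R := ℂ) (L := L))

noncomputable instance : Fintype (At L) := Fintype.ofFinite _

variable (L) in
theorem exists_SD : ∃ p : At L → L →ₗ[ℂ] L, SD p := by
  have hc : ∀ J : At L, IsCompl J.1.toSubmodule (J.1.killingCompl ℂ L).toSubmodule := fun J =>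
    (LieSubmodule.isCompl_toSubmodule).2 (LieIdeal.isCompl_killingCompl J.1)
  let p : At L → L →ₗ[ℂ] L := fun J => J.1.toSubmodule.subtype ∘ₗ Submodule.projectionOnto _ _ (hc J)
  have hmem : ∀ J x, p J x ∈ J.1 := fun J x => (Submodule.projectionOnto _ _ (hc J) x).2
  have hid : ∀ (J : At L), ∀ x ∈ J.1, p J x = x := fun J x hx =>
    congrArg Subtype.val (Submodule.projectionOnto_apply_left (hc J) ⟨x, hx⟩)
  have hz : ∀ J x, p J x = 0 ↔ x ∈ J.1.killingCompl ℂ L := by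
    intro J x
    rw [← LieSubmodule.mem_toSubmodule, ← Submodule.projectionOnto_apply_eq_zero_iff (hc J)]
    exact ⟨fun h => Subtype.ext h, fun h => congrArg Subtype.val h⟩
  have hidem : ∀ i x, p i (p i x) = p i x := fun i x => hid i _ (hmem i x)
  have hcomp : ∀ J x, x - p J x ∈ J.1.killingCompl ℂ L := fun J x => by
    rw [← hz, map_sub, hidem, sub_self]
  have hlm : ∀ (J : LieIdeal ℂ L) (x y : L), x ∈ J → ⁅x, y⁆ ∈ J := by
    intro J x y hx
    rw [← lie_skew]
    exact J.neg_mem (J.lie_mem hx)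
  have hdisj : ∀ i j : At L, i ≠ j → ∀ x ∈ j.1, x ∈ i.1.killingCompl ℂ L := by
    intro i j hij x hx
    rw [LieIdeal.mem_killingCompl]
    intro y hy
    have hij' : i.1 ⊓ j.1 = ⊥ := by
      rw [← disjoint_iff]
      exact i.2.disjoint_of_ne j.2 (fun h => hij (Subtype.ext h))
    let q : Submodule ℂ i.1 := LinearMap.ker (((killingForm ℂ L).flip x) ∘ₗ i.1.toSubmodule.subtype)
    have : (⟨y, hy⟩ : i.1) ∈ q := by
      refine perf_of_isAtom i.1 i.2 q (fun a b => ?_) ⟨y, hy⟩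
      show killingForm ℂ L ⁅(a : L), (b : L)⁆ x = 0
      rw [kf_inv]
      have hb : ⁅(b : L), x⁆ ∈ i.1 ⊓ j.1 := ⟨hlm _ _ _ b.2, j.1.lie_mem hx⟩
      rw [hij'] at hb
      rw [(LieSubmodule.mem_bot _).1 hb, map_zero]
    exact this
  have horth : ∀ i j, i ≠ j → ∀ x, p i (p j x) = 0 := fun i j hij x =>
    (hz _ _).2 (hdisj i j hij _ (hmem j x))
  refine ⟨p, ?_, hidem, horth, ?_, ?_, ?_, ?_⟩
  · intro J x y
    have h1 : ⁅x, y⁆ = ⁅p J x, y⁆ + ⁅x - p J x, y⁆ := by rw [← add_lie]; simp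
    rw [h1, map_add, hid J _ (hlm _ _ _ (hmem J x)), (hz J _).2 (hlm _ _ _ (hcomp J x)), add_zero]
  · intro x
    rw [← sub_eq_zero, ← neg_eq_zero, neg_sub]
    refine kf_zero _ fun z => ?_
    let K : LieIdeal ℂ L := LieIdeal.killingCompl ℂ L ⊤
    have h1 : ∀ J : At L, x - ∑ i, p i x ∈ J.1.killingCompl ℂ L := by
      intro J
      rw [← hz, map_sub, map_sum, Finset.sum_eq_single J (fun i _ hi => horth J i hi.symm x)
        (by simp), hidem, sub_self]
    generalize x - ∑ i, p i x = y at h1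
    have h2 : sSup {J : LieIdeal ℂ L | IsAtom J} ≤ LieIdeal.killingCompl ℂ L (LieSubmodule.lieSpan ℂ L {y}) := by
      refine sSup_le fun J hJ a ha => ?_
      rw [LieIdeal.mem_killingCompl]
      intro b hb
      have : LieSubmodule.lieSpan ℂ L {y} ≤ J.killingCompl ℂ L := by
        rw [LieSubmodule.lieSpan_le]
        rintro _ rfl
        exact h1 ⟨J, hJ⟩
      have hb' := this hb
      rw [LieIdeal.mem_killingCompl] at hb'
      rw [kf_comm]
      exact hb' a ha
    rw [LieAlgebra.IsSemisimple.sSup_atoms_eq_top] at h2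
    have := h2 (LieSubmodule.mem_top z)
    rw [LieIdeal.mem_killingCompl] at this
    exact this y (LieSubmodule.subset_lieSpan rfl)
  · intro J x y
    have h1 := hcomp J y
    have h2 := hcomp J x
    rw [LieIdeal.mem_killingCompl] at h1 h2
    have h3 := h1 _ (hmem J x)
    have h4 := h2 _ (hmem J y)
    rw [map_sub, sub_eq_zero] at h3 h4
    rw [h3, kf_comm, ← h4, kf_comm]
  · intro J
    by_contra! hh
    refine J.2.1 ((LieSubmodule.eq_bot_iff _).2 fun x hx => ?_)
    rw [← hid J x hx, hh]
  · rintro J D hD ⟨x, hxD, hx, hx0⟩ y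
    let D' : LieIdeal ℂ L := { D with lie_mem := fun {a b} hb => hD a b hb }
    have h1 : J.1 ⊓ D' ≠ ⊥ := by
      intro hb
      refine hx0 ((LieSubmodule.eq_bot_iff _).1 hb x ⟨?_, hxD⟩)
      rw [← hx]
      exact hmem J x
    have h2 : J.1 ≤ D' := by
      rcases J.2.le_iff.1 (inf_le_left : J.1 ⊓ D' ≤ J.1) with h | h
      · exact absurd h h1
      · exact inf_eq_left.1 h
    exact h2 (hmem J y)

theorem SD.scal {I : Type*} [Fintype I] {p : I → L →ₗ[ℂ] L} (h : SD p) (B : F2 L)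
    (hB : ∀ x y z : L, B ⁅x, y⁆ z = B x ⁅y, z⁆) :
    ∃ c : I → ℂ, ∀ x y, B x y = ∑ i, c i * killingForm ℂ L (p i x) y := by
  have hp := perf_of_isKilling L
  have hnd := LieAlgebra.IsKilling.killingForm_nondegenerate ℂ L
  let T : L →ₗ[ℂ] L := (LinearMap.BilinForm.toDual (killingForm ℂ L) hnd).symm.toLinearMap ∘ₗ B
  have hT : ∀ x y, killingForm ℂ L (T x) y = B x y := fun x y =>
    LinearMap.BilinForm.apply_toDual_symm_apply (hB := hnd) (B x) y
  have hTl : ∀ x y : L, T ⁅x, y⁆ = ⁅T x, y⁆ := by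
    intro x y
    rw [← sub_eq_zero]
    refine kf_zero _ fun z => ?_
    rw [map_sub, LinearMap.sub_apply, hT, hB, kf_inv, hT, sub_self]
  have hTr : ∀ x y : L, T ⁅x, y⁆ = ⁅x, T y⁆ := by
    intro x y
    rw [← lie_skew, map_neg, hTl, lie_skew]
  have hTp : ∀ i x, T (p i x) = p i (T x) := by
    intro i x
    have := hp (LinearMap.ker (T ∘ₗ p i - p i ∘ₗ T)) (fun a b => by
      simp only [LinearMap.mem_ker, LinearMap.sub_apply, LinearMap.comp_apply]
      rw [h.lie', hTl, hTl, h.lie', sub_self]) x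
    simpa [sub_eq_zero] using this
  have hc : ∀ i, ∃ c : ℂ, ∀ x, T (p i x) = c • p i x := by
    intro i
    let J := LinearMap.range (p i)
    obtain ⟨x0, hx0⟩ := h.ne i
    have : Nontrivial J := ⟨⟨⟨p i x0, x0, rfl⟩, 0, fun h => hx0 (congrArg Subtype.val h)⟩⟩
    let TJ : Module.End ℂ J := T.restrict (by
      rintro _ ⟨x, rfl⟩
      exact ⟨T x, (hTp i x).symm⟩)
    obtain ⟨c, hc⟩ := Module.End.exists_eigenvalue TJ
    obtain ⟨v, hv⟩ := hc.exists_hasEigenvector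
    have hv1 : T v = c • (v : L) := congrArg Subtype.val hv.apply_eq_smul
    have hv0 : (v : L) ≠ 0 := fun h => hv.2 (Subtype.ext h)
    have hvp : p i v = v := by
      obtain ⟨w, hw⟩ := v.2
      rw [← hw, h.idem]
    refine ⟨c, fun x => ?_⟩
    have := h.simple i (LinearMap.ker (T - c • LinearMap.id)) (fun y x hx => ?_) ⟨v, ?_, hvp, hv0⟩ x
    · simpa [sub_eq_zero] using this
    · have hx' : T x = c • x := by simpa [sub_eq_zero] using hx
      simp [hTr, hx']
    · simp [hv1]
  choose c hc using hc
  refine ⟨c, fun x y => ?_⟩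
  conv_lhs => rw [← h.sum x]
  rw [map_sum, LinearMap.sum_apply]
  refine Finset.sum_congr rfl fun i _ => ?_
  rw [← hT, hc, map_smul]
  rfl

end
end SDS

namespace SDS

theorem hall_of_mul {A I : Type*} [Fintype A] [Fintype I] (N : A → I → ℂ) (M : I → A → ℂ)
    (h1 : ∀ a, ∑ i, N a i * M i a = 1) (h0 : ∀ b a, b ≠ a → ∑ i, N b i * M i a = 0) :
    ∃ σ : A → I, Function.Injective σ ∧ ∀ a, M (σ a) a ≠ 0 := by
  classical
  let t : A → Finset I := fun a => Finset.univ.filter fun i => M i a ≠ 0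
  have key : ∀ S : Finset A, S.card ≤ (S.biUnion t).card := by
    intro S
    let f : (S → ℂ) →ₗ[ℂ] (↥(S.biUnion t) → ℂ) :=
      LinearMap.pi fun i => ∑ a : S, M i a • LinearMap.proj a
    have hf : ∀ v i, f v i = ∑ a : S, M i a * v a := by
      intro v i
      simp [f]
    have hinj : Function.Injective f := by
      rw [injective_iff_map_eq_zero]
      intro v hv
      have hz : ∀ i, ∑ a : S, M i a * v a = 0 := by
        intro i
        by_cases hi : i ∈ S.biUnion t
        · rw [← hf v ⟨i, hi⟩, hv]
          rfl
        · refine Finset.sum_eq_zero fun a _ => ?_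
          have : M i a = 0 := by
            by_contra hne
            exact hi (Finset.mem_biUnion.2 ⟨a, a.2, by simp [t, hne]⟩)
          rw [this, zero_mul]
      funext b
      have h2 : ∑ a : S, (∑ i, N b i * M i a) * v a = 0 := by
        have : ∀ a : S, (∑ i, N b i * M i a) * v a = ∑ i, N b i * (M i a * v a) := by
          intro a
          rw [Finset.sum_mul]
          exact Finset.sum_congr rfl fun i _ => mul_assoc _ _ _
        rw [Finset.sum_congr rfl fun a _ => this a, Finset.sum_comm]
        refine Finset.sum_eq_zero fun i _ => ?_
        rw [← Finset.mul_sum, hz, mul_zero]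
      rw [Finset.sum_eq_single b (fun a _ hab => by
        rw [h0 _ _ (fun h => hab (Subtype.ext h.symm)), zero_mul]) (by simp), h1, one_mul] at h2
      exact h2
    have := LinearMap.finrank_le_finrank_of_injective hinj
    simpa only [Module.finrank_fintype_fun_eq_card, Fintype.card_coe] using this
  obtain ⟨σ, hσ, hm⟩ := (Finset.all_card_le_biUnion_card_iff_exists_injective t).1 key
  exact ⟨σ, hσ, fun a => by simpa [t] using hm a⟩

section
variable {L : Type*} [LieRing L] [LieAlgebra ℂ L] [Module.Finite ℂ L] [LieAlgebra.IsKilling ℂ L]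

theorem half {s₁ s₂ : LieSubalgebra ℂ L} {P Q : L →ₗ[ℂ] L} (d : Dec s₁ s₂ P Q)
    [LieAlgebra.IsKilling ℂ s₁] [LieAlgebra.IsKilling ℂ s₂]
    {I A : Type*} [Fintype I] [Fintype A] {p : I → L →ₗ[ℂ] L} (hp : SD p)
    {q : A → s₁ →ₗ[ℂ] s₁} (hq : SD q) :
    ∃ (x y : A → s₁) (N : A → I → ℂ), (∀ a, q a (x a) = x a) ∧
      (∀ a, ∑ i, N a i * killingForm ℂ L (p i (x a)) (y a) = 1) ∧
      (∀ b a, b ≠ a → ∑ i, N b i * killingForm ℂ L (p i (x a)) (y a) = 0) ∧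
      ∀ b, ∀ u v : s₂, ∑ i, N b i * killingForm ℂ L (p i u) v = 0 := by
  have hxy : ∀ a, ∃ x y : s₁, q a x = x ∧ killingForm ℂ s₁ x y = 1 := by
    intro a
    obtain ⟨x, hx⟩ := hq.ne a
    have : ∃ y, killingForm ℂ s₁ (q a x) y ≠ 0 := by
      by_contra! hh
      exact hx (kf_zero _ hh)
    obtain ⟨y, hy⟩ := this
    refine ⟨q a x, (killingForm ℂ s₁ (q a x) y)⁻¹ • y, hq.idem a x, ?_⟩
    rw [map_smul, smul_eq_mul, inv_mul_cancel₀ hy]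
  choose x y hx hy using hxy
  have hN : ∀ b, ∃ c : I → ℂ,
      (∀ u v : s₁, ∑ i, c i * killingForm ℂ L (p i u) v = killingForm ℂ s₁ (q b u) v) ∧
      (∀ u v : s₂, ∑ i, c i * killingForm ℂ L (p i u) v = 0) := by
    intro b
    obtain ⟨B, -, hB, hB1, hB2⟩ := extend_form d ((killingForm ℂ s₁) ∘ₗ q b)
      (fun u v => by
        rw [LinearMap.comp_apply, LinearMap.comp_apply, hq.kil, kf_comm])
      (fun u v w => by
        rw [LinearMap.comp_apply, LinearMap.comp_apply, hq.lie, kf_inv])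
    obtain ⟨c, hc⟩ := hp.scal B hB
    refine ⟨c, fun u v => ?_, fun u v => ?_⟩
    · rw [← hc, hB1]
      rfl
    · rw [← hc, hB2]
  choose N hN1 hN2 using hN
  refine ⟨x, y, N, hx, fun a => ?_, fun b a hba => ?_, hN2⟩
  · rw [hN1, hx, hy]
  · rw [hN1, ← hx, hq.orth b a hba, map_zero, LinearMap.zero_apply]

theorem inj_of_ne {s : LieSubalgebra ℂ L} [LieAlgebra.IsKilling ℂ s]
    {I A : Type*} [Fintype I] [Fintype A] {p : I → L →ₗ[ℂ] L} (hp : SD p)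
    {q : A → s →ₗ[ℂ] s} (hq : SD q) (i : I) (a : A) (x : s) (hx : q a x = x)
    (hne : p i (x : L) ≠ 0) (u : s) (hu : p i (q a u : s) = 0) : q a u = 0 := by
  by_contra h0
  have := hq.simple a (LinearMap.ker (p i ∘ₗ inc s)) (fun z w hw => ?_)
    ⟨q a u, hu, hq.idem a u, h0⟩ x
  · rw [hx] at this
    exact hne this
  · have hw' : p i (w : L) = 0 := hw
    show p i ((⁅z, w⁆ : s) : L) = 0
    rw [LieSubalgebra.coe_bracket, hp.lie', hw', lie_zero]

theorem matching {s₁ s₂ : LieSubalgebra ℂ L} {P Q : L →ₗ[ℂ] L} (d : Dec s₁ s₂ P Q)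
    [LieAlgebra.IsKilling ℂ s₁] [LieAlgebra.IsKilling ℂ s₂] :
    ∃ Φ : (s₁ × s₂) →ₗ[ℂ] L, Function.Injective Φ ∧
      ∀ u v : s₁ × s₂, Φ (⁅u.1, v.1⁆, ⁅u.2, v.2⁆) = ⁅Φ u, Φ v⁆ := by
  classical
  obtain ⟨p, hp⟩ := exists_SD L
  obtain ⟨p₁, hp₁⟩ := exists_SD s₁
  obtain ⟨p₂, hp₂⟩ := exists_SD s₂
  obtain ⟨x₁, y₁, N₁, hx₁, a₁, b₁, c₁⟩ := half d hp hp₁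
  obtain ⟨x₂, y₂, N₂, hx₂, a₂, b₂, c₂⟩ := half d.symm hp hp₂
  obtain ⟨σ, hσ, hM⟩ := hall_of_mul (A := At s₁ ⊕ At s₂) (I := At L) (Sum.elim N₁ N₂)
    (fun i => Sum.elim (fun a => killingForm ℂ L (p i (x₁ a)) (y₁ a))
      (fun a => killingForm ℂ L (p i (x₂ a)) (y₂ a)))
    (by
      rintro (a | a)
      · exact a₁ a
      · exact a₂ a)
    (by
      rintro (b | b) (a | a) hba
      · exact b₁ b a (fun h => hba (congrArg _ h))
      · exact c₁ b _ _
      · exact c₂ b _ _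
      · exact b₂ b a (fun h => hba (congrArg _ h)))
  let q : At s₁ ⊕ At s₂ → (s₁ × s₂) →ₗ[ℂ] L := Sum.elim
    (fun a => inc s₁ ∘ₗ p₁ a ∘ₗ LinearMap.fst ℂ s₁ s₂)
    (fun a => inc s₂ ∘ₗ p₂ a ∘ₗ LinearMap.snd ℂ s₁ s₂)
  have hqhom : ∀ a (u v : s₁ × s₂), q a (⁅u.1, v.1⁆, ⁅u.2, v.2⁆) = ⁅q a u, q a v⁆ := by
    rintro (a | a) u v
    · show ((p₁ a ⁅u.1, v.1⁆ : s₁) : L) = _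
      rw [hp₁.hom]
      rfl
    · show ((p₂ a ⁅u.2, v.2⁆ : s₂) : L) = _
      rw [hp₂.hom]
      rfl
  have hqinj : ∀ a u, p (σ a) (q a u) = 0 → q a u = 0 := by
    rintro (a | a) u hu
    · have := inj_of_ne hp hp₁ (σ (Sum.inl a)) a (x₁ a) (hx₁ a) (fun h => hM (Sum.inl a) (by
        simp [h])) u.1 hu
      exact congrArg Subtype.val this
    · have := inj_of_ne hp hp₂ (σ (Sum.inr a)) a (x₂ a) (hx₂ a) (fun h => hM (Sum.inr a) (by
        simp [h])) u.2 hu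
      exact congrArg Subtype.val this
  have hq0 : ∀ u, (∀ a, q a u = 0) → u = 0 := by
    intro u hu
    refine Prod.ext ?_ ?_
    · show u.1 = 0
      rw [← hp₁.sum u.1]
      exact Finset.sum_eq_zero fun a _ => Subtype.ext (hu (Sum.inl a))
    · show u.2 = 0
      rw [← hp₂.sum u.2]
      exact Finset.sum_eq_zero fun a _ => Subtype.ext (hu (Sum.inr a))
  let Φ : (s₁ × s₂) →ₗ[ℂ] L := ∑ a, p (σ a) ∘ₗ q a
  have hΦ : ∀ u, Φ u = ∑ a, p (σ a) (q a u) := by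
    intro u
    simp [Φ]
  refine ⟨Φ, ?_, fun u v => ?_⟩
  · rw [injective_iff_map_eq_zero]
    intro u hu
    refine hq0 u fun b => hqinj b u ?_
    have h1 : p (σ b) (Φ u) = p (σ b) (q b u) := by
      rw [hΦ, map_sum, Finset.sum_eq_single b (fun a _ hab =>
        hp.orth _ _ (fun h => hab (hσ h.symm)) _) (by simp), hp.idem]
    rw [← h1, hu, map_zero]
  · rw [hΦ, hΦ, hΦ, _root_.sum_lie]
    refine Finset.sum_congr rfl fun a _ => ?_
    rw [_root_.lie_sum, Finset.sum_eq_single a (fun b _ hab =>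
      hp.cross _ _ (fun h => hab (hσ h.symm)) _ _) (by simp), hqhom, hp.hom]

end

theorem final {L : Type*} [LieRing L] [LieAlgebra ℂ L] [Module.Finite ℂ L]
    (s₁ s₂ : LieSubalgebra ℂ L)
    (h₁ : LieAlgebra.HasTrivialRadical ℂ s₁)
    (h₂ : LieAlgebra.HasTrivialRadical ℂ s₂)
    (hsum : s₁.toSubmodule ⊔ s₂.toSubmodule = ⊤)
    (hdisj : s₁.toSubmodule ⊓ s₂.toSubmodule = ⊥) :
    LieAlgebra.HasTrivialRadical ℂ L ∧
      ∃ e : L ≃ₗ[ℂ] (↥s₁ × ↥s₂),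
        ∀ x y : L, e ⁅x, y⁆ = (⁅(e x).1, (e y).1⁆, ⁅(e x).2, (e y).2⁆) := by
  obtain ⟨P, Q, d⟩ := exists_dec s₁ s₂ hsum hdisj
  have k₁ : LieAlgebra.IsKilling ℂ s₁ := inferInstance
  have k₂ : LieAlgebra.IsKilling ℂ s₂ := inferInstance
  have hL : LieAlgebra.HasTrivialRadical ℂ L := part1 d
  have kL : LieAlgebra.IsKilling ℂ L := inferInstance
  refine ⟨hL, ?_⟩
  obtain ⟨Φ, hi, hb⟩ := matching d
  have hc : IsCompl s₁.toSubmodule s₂.toSubmodule :=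
    ⟨disjoint_iff.2 hdisj, codisjoint_iff.2 hsum⟩
  have hdim : Module.finrank ℂ (s₁ × s₂) = Module.finrank ℂ L :=
    (Submodule.prodEquivOfIsCompl s₁.toSubmodule s₂.toSubmodule hc).finrank_eq
  let E := LinearEquiv.ofBijective Φ
    ⟨hi, (LinearMap.injective_iff_surjective_of_finrank_eq_finrank hdim).1 hi⟩
  have hE : ∀ u, E u = Φ u := fun u => rfl
  refine ⟨E.symm, fun x y => ?_⟩
  rw [LinearEquiv.symm_apply_eq, hE, hb, ← hE, ← hE, E.apply_symm_apply, E.apply_symm_apply]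

end SDS

/-- Let `L` be a finite-dimensional complex Lie algebra which is
strongly disemisimple, i.e. `L = s₁ ∔ s₂` is the direct vector space sum of two
semisimple subalgebras `s₁` and `s₂`. Then `L` is semisimple and is isomorphic, as a
Lie algebra, to the external direct product of `s₁` and `s₂` (the isomorphism is a
linear equivalence carrying the bracket of `L` to the componentwise bracket of
`s₁ × s₂`). -/
theorem strongly_disemisimple_is_semisimple_direct_sum
    {L : Type*} [LieRing L] [LieAlgebra ℂ L] [Module.Finite ℂ L]
    (s₁ s₂ : LieSubalgebra ℂ L)
    (h₁ : LieAlgebra.HasTrivialRadical ℂ s₁)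
    (h₂ : LieAlgebra.HasTrivialRadical ℂ s₂)
    (hsum : s₁.toSubmodule ⊔ s₂.toSubmodule = ⊤)
    (hdisj : s₁.toSubmodule ⊓ s₂.toSubmodule = ⊥) :
    LieAlgebra.HasTrivialRadical ℂ L ∧
      ∃ e : L ≃ₗ[ℂ] (↥s₁ × ↥s₂),
        ∀ x y : L, e ⁅x, y⁆ = (⁅(e x).1, (e y).1⁆, ⁅(e x).2, (e y).2⁆) := by
  exact SDS.final s₁ s₂ h₁ h₂ hsum hdisj
end
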